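/- arXiv:math/0606151 — 3 statements merged into one kernel-verified Lean document; each statement's English description precedes it below -/
import Mathlib

section
/- Let N ≥ 3 and let Ω ⊂ ℝ^N be a smooth bounded domain containing the origin. Then there exists δ₀ > 0 such that for every 0 < δ ≤ δ₀, the infimum over all nonzero f ∈ C₀^∞(Ω_δ) of the quotient ( ∫_{Ω_δ} |x|^{2−N} · |∇f(x)|² dx ) / ( ∫_{Ω_δ} |x|^{2−N} · f(x)²/d(x)² dx ) equals 1/4. -/
open MeasureTheory Real

noncomputable section

/-- A set `Ω ⊆ ℝ^N` is a C² domain: it is the sublevel set of a C² function whose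
differential does not vanish on the boundary. -/
def IsC2Domain {N : ℕ} (Ω : Set (EuclideanSpace ℝ (Fin N))) : Prop :=
  ∃ φ : EuclideanSpace ℝ (Fin N) → ℝ,
    ContDiff ℝ 2 φ ∧ Ω = {x | φ x < 0} ∧ ∀ x ∈ frontier Ω, fderiv ℝ φ x ≠ 0

/-- Distance to the boundary of `Ω`. -/
def bdist {N : ℕ} (Ω : Set (EuclideanSpace ℝ (Fin N))) (x : EuclideanSpace ℝ (Fin N)) : ℝ :=
  Metric.infDist x (frontier Ω)

section geometry
variable {E : Type*} [NormedAddCommGroup E] [InnerProductSpace ℝ E] [FiniteDimensional ℝ E]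

lemma taylor_bound (φ : E → ℝ) (hφ : ContDiff ℝ 2 φ) (R : ℝ) : ∃ K : ℝ, 1 ≤ K ∧
    (∀ x ∈ Metric.closedBall (0:E) R, ‖fderiv ℝ φ x‖ ≤ K) ∧
    (∀ x ∈ Metric.closedBall (0:E) R, ‖fderiv ℝ (fderiv ℝ φ) x‖ ≤ K) ∧
    (∀ x ∈ Metric.closedBall (0:E) R, ∀ y ∈ Metric.closedBall (0:E) R,
      ‖fderiv ℝ φ y - fderiv ℝ φ x‖ ≤ K * ‖y - x‖) ∧
    (∀ x ∈ Metric.closedBall (0:E) R, ∀ y ∈ Metric.closedBall (0:E) R,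
      |φ y - φ x - fderiv ℝ φ x (y - x)| ≤ K * ‖y - x‖ ^ 2) := by
  have h1 : ContDiff ℝ 1 (fderiv ℝ φ) := hφ.fderiv_right (by norm_num)
  have hc1 : Continuous (fderiv ℝ φ) := h1.continuous
  have hc2 : Continuous (fderiv ℝ (fderiv ℝ φ)) := h1.continuous_fderiv (by norm_num)
  have hB : IsCompact (Metric.closedBall (0:E) R) := isCompact_closedBall 0 R
  obtain ⟨K1, hK1⟩ := hB.exists_bound_of_continuousOn hc1.continuousOn
  obtain ⟨K2, hK2'⟩ := hB.exists_bound_of_continuousOn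
    (f := fun x => ‖fderiv ℝ (fderiv ℝ φ) x‖) (Continuous.norm (E := E →L[ℝ] E →L[ℝ] ℝ) hc2).continuousOn
  have hK2 : ∀ x ∈ Metric.closedBall (0:E) R, ‖fderiv ℝ (fderiv ℝ φ) x‖ ≤ K2 := by
    exact fun x hx => (le_abs_self _).trans (hK2' x hx)
  set K := max 1 (max K1 K2) with hK
  have a1 : 1 ≤ K := le_max_left _ _
  have a2 : K1 ≤ K := (le_max_left _ _).trans (le_max_right _ _)
  have a3 : K2 ≤ K := (le_max_right _ _).trans (le_max_right _ _)
  have hcv : Convex ℝ (Metric.closedBall (0:E) R) := convex_closedBall 0 R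
  have hLip : ∀ x ∈ Metric.closedBall (0:E) R, ∀ y ∈ Metric.closedBall (0:E) R,
      ‖fderiv ℝ φ y - fderiv ℝ φ x‖ ≤ K * ‖y - x‖ := by
    intro x hx y hy
    exact hcv.norm_image_sub_le_of_norm_fderiv_le (𝕜 := ℝ)
      (fun z _ => (h1.differentiable (by norm_num)) z)
      (fun z hz => (hK2 z hz).trans a3) hx hy
  refine ⟨K, a1, fun x hx => (hK1 x hx).trans a2, fun x hx => (hK2 x hx).trans a3, hLip, ?_⟩
  intro x hx y hy
  have := (convex_segment x y).norm_image_sub_le_of_norm_fderiv_le' (𝕜 := ℝ) (f := φ)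
    (φ := fderiv ℝ φ x) (C := K * ‖y - x‖)
    (fun z _ => (hφ.differentiable (by norm_num)) z)
    (fun z hz => ?_) (left_mem_segment ℝ x y) (right_mem_segment ℝ x y)
  · rw [Real.norm_eq_abs] at this
    calc _ ≤ _ := this
      _ = _ := by ring
  · refine (hLip x hx z (hcv.segment_subset hx hy hz)).trans ?_
    have : ‖z - x‖ ≤ ‖y - x‖ := by
      rw [segment_eq_image'] at hz
      obtain ⟨t, ht, rfl⟩ := hz
      simp only [add_sub_cancel_left, norm_smul, Real.norm_eq_abs, abs_of_nonneg ht.1]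
      exact mul_le_of_le_one_left (norm_nonneg _) ht.2
    gcongr

lemma infDist_frontier_le {Ω : Set E} {x z : E} (hx : x ∈ Ω) (hz : z ∉ Ω) :
    Metric.infDist x (frontier Ω) ≤ dist x z := by
  obtain ⟨y, hy, h⟩ := exists_mem_frontier_infDist_compl_eq_dist hx
    (fun h => hz (h ▸ Set.mem_univ z))
  calc _ ≤ dist x y := Metric.infDist_le_dist_of_mem hy
    _ = _ := h.symm
    _ ≤ _ := Metric.infDist_le_dist_of_mem hz

set_option maxHeartbeats 2000000 in
lemma geom (φ : E → ℝ) (hφ : ContDiff ℝ 2 φ) (Ω : Set E) (hΩ : Ω = {x | φ x < 0})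
    (hfr : ∀ x ∈ frontier Ω, fderiv ℝ φ x ≠ 0) (hne : (frontier Ω).Nonempty)
    (hb : Bornology.IsBounded Ω) (hc : IsCompact (frontier Ω)) :
    ∃ δ₁ m C : ℝ, 0 < δ₁ ∧ 0 < m ∧ 1 ≤ C ∧ ∀ x ∈ Ω, Metric.infDist x (frontier Ω) ≤ δ₁ →
      m ≤ ‖fderiv ℝ φ x‖ ∧ ‖fderiv ℝ φ x‖ ≤ C ∧ ‖fderiv ℝ (fderiv ℝ φ) x‖ ≤ C ∧
      0 < Metric.infDist x (frontier Ω) ∧ -φ x ≤ C * Metric.infDist x (frontier Ω) ∧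
      1 / Metric.infDist x (frontier Ω) ^ 2 ≤ (‖fderiv ℝ φ x‖ ^ 2 + C * (-φ x)) / (-φ x) ^ 2 := by
  have hcφ : Continuous φ := hφ.continuous
  have hΩo : IsOpen Ω := by rw [hΩ]; exact isOpen_lt hcφ continuous_const
  obtain ⟨R, hR⟩ := hb.subset_closedBall (0:E)
  obtain ⟨K, hK1, hKd, hKdd, hKl, hKt⟩ := taylor_bound φ hφ (R + 1)
  have hsub : ∀ x ∈ closure Ω, x ∈ Metric.closedBall (0:E) (R+1) := by
    intro x hx
    have := closure_minimal hR Metric.isClosed_closedBall hx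
    exact Metric.closedBall_subset_closedBall (by linarith) this
  have hsubR : ∀ x ∈ Ω, ∀ z, ‖z‖ ≤ 1 → x + z ∈ Metric.closedBall (0:E) (R+1) := by
    intro x hx z hz
    have h1 := hR hx
    rw [mem_closedBall_zero_iff] at h1 ⊢
    linarith [norm_add_le x z]
  have hc1 : Continuous (fderiv ℝ φ) := hφ.continuous_fderiv (by norm_num)
  obtain ⟨y0, hy0, hmin⟩ := hc.exists_isMinOn hne hc1.norm.continuousOn
  set m := ‖fderiv ℝ φ y0‖ / 2 with hm
  have hm0 : 0 < m := by
    have := norm_pos_iff.mpr (hfr y0 hy0)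
    positivity
  have hm2 : ∀ y ∈ frontier Ω, 2 * m ≤ ‖fderiv ℝ φ y‖ := by
    intro y hy
    have := hmin hy
    simp only [Set.mem_ofPred_eq] at this
    linarith
  have hmK : 2 * m ≤ K := by
    have := hKd y0 (hsub _ (frontier_subset_closure hy0)); linarith
  have hK0 : 0 < K := by linarith
  have hδ : 0 < m^2 / (8 * K^2) := by positivity
  refine ⟨m^2 / (8*K^2), m, max (2 * K) (6 * K^2 / m), hδ, hm0,
    le_max_of_le_left (by linarith), ?_⟩
  intro x hx hdx
  obtain ⟨y, hy, hxy⟩ := hc.exists_infDist_eq_dist hne x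
  set d := Metric.infDist x (frontier Ω) with hd
  have hyΩ : y ∉ Ω := fun h => by
    have := hΩo.frontier_eq ▸ hy
    exact this.2 h
  have hφy : 0 ≤ φ y := by
    rw [hΩ] at hyΩ; simpa using hyΩ
  have hd0 : 0 < d := by
    rw [hxy, dist_pos]; rintro rfl; exact hyΩ hx
  have hu : 0 < -φ x := by
    rw [hΩ] at hx; simpa using hx
  have hKδ : 8 * K^2 * d ≤ m^2 := by
    rw [le_div_iff₀ (by positivity)] at hdx; linarith
  have hKδ2 : 4 * K * d ≤ m := by
    have : 4 * K * d * (2 * K) ≤ m * (2 * K) := by nlinarith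
    exact le_of_mul_le_mul_right this (by positivity)
  have hd1 : d ≤ 1 := by nlinarith
  have hxB := hsub x (subset_closure hx)
  have hyB := hsub y (frontier_subset_closure hy)
  have hnorm : ‖y - x‖ = d := by rw [hxy, dist_eq_norm, norm_sub_rev]
  set G := ‖fderiv ℝ φ x‖ with hG
  have hGm : m ≤ G := by
    have h1 := hKl x hxB y hyB
    have h2 := norm_sub_norm_le (fderiv ℝ φ y) (fderiv ℝ φ x)
    have h3 := hm2 y hy
    rw [hnorm] at h1
    nlinarith
  have hGK : G ≤ K := hKd x hxB
  have hu1 : -φ x ≤ G * d + K * d^2 := by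
    have h1 := hKt x hxB y hyB
    rw [hnorm] at h1
    have h2 := (fderiv ℝ φ x).le_opNorm (y - x)
    rw [hnorm, Real.norm_eq_abs] at h2
    have := (abs_le.mp h1).2
    have := (abs_le.mp h2).2
    linarith
  have hu2 : -φ x ≤ 2 * K * d := by nlinarith
  set u := -φ x with hu_def
  have hG0 : 0 < G := by linarith
  -- d ≤ 2 u / m
  have hdu : d ≤ 2 * u / m := by
    set g := (InnerProductSpace.toDual ℝ E).symm (fderiv ℝ φ x) with hg
    have hgn : ‖g‖ = G := by simp [hg, hG]
    have hgv : fderiv ℝ φ x g = G^2 := by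
      have : fderiv ℝ φ x g = inner ℝ g g := by
        rw [hg, InnerProductSpace.toDual_symm_apply]
      rw [this, real_inner_self_eq_norm_sq, hgn]
    set t := 2 * u / G with ht
    have ht0 : 0 ≤ t := by positivity
    have htG : t * G = 2 * u := by rw [ht]; field_simp
    have hzn : ‖(t / G) • g‖ = t := by
      rw [norm_smul, Real.norm_eq_abs, abs_of_nonneg (by positivity), hgn]; field_simp
    have ht1 : t ≤ 1 := by
      rw [ht, div_le_one hG0]; nlinarith
    have hzB := hsubR x hx ((t / G) • g) (by rw [hzn]; exact ht1)
    have h1 := hKt x hxB _ hzB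
    rw [add_sub_cancel_left, hzn, map_smul, hgv, smul_eq_mul] at h1
    have h2 : t / G * G^2 = 2 * u := by rw [← htG]; field_simp
    rw [h2] at h1
    have h3 : K * t^2 ≤ u := by
      have : t^2 * G^2 = 4 * u^2 := by rw [← mul_pow, htG]; ring
      have hGm2 : m^2 ≤ G^2 := by gcongr
      have : K * t^2 * G^2 ≤ u * G^2 := by
        rw [mul_assoc, this]
        have : 4 * K * u ≤ G^2 := by nlinarith
        nlinarith
      exact le_of_mul_le_mul_right this (by positivity)
    have h4 : x + (t / G) • g ∉ Ω := by
      rw [hΩ]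
      simp only [Set.mem_ofPred_eq, not_lt]
      have := (abs_le.mp h1).1
      linarith
    have h5 := infDist_frontier_le hx h4
    rw [dist_self_add_right, hzn] at h5
    calc d ≤ t := h5
      _ ≤ _ := by rw [ht]; gcongr
  refine ⟨hGm, hGK.trans (le_max_of_le_left (by linarith)),
    (hKdd x hxB).trans (le_max_of_le_left (by linarith)), hd0, ?_, ?_⟩
  · exact hu2.trans (by gcongr; exact le_max_left _ _)
  · rw [div_le_div_iff₀ (by positivity) (by positivity)]
    have h1 : u^2 ≤ (G * d + K * d^2)^2 := by gcongr
    have h2 : (G * d + K * d^2)^2 ≤ (G^2 + 3 * K^2 * d) * d^2 := by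
      have : (G * d + K * d^2)^2 = (G^2 + (2 * G * K + K^2 * d) * d) * d^2 := by ring
      rw [this]
      have : 2 * G * K + K^2 * d ≤ 3 * K^2 := by nlinarith
      gcongr
    have h3 : 3 * K^2 * d ≤ 6 * K^2 / m * u := by
      calc 3 * K^2 * d ≤ 3 * K^2 * (2 * u / m) := by gcongr
        _ = _ := by ring
    have h4 : 6 * K^2 / m * u ≤ max (2 * K) (6 * K^2 / m) * u := by
      gcongr; exact le_max_right _ _
    rw [one_mul]
    refine (h1.trans h2).trans ?_
    exact mul_le_mul_of_nonneg_right (by linarith) (by positivity)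

end geometry

lemma scalar_ineq (m C : ℝ) (hm : 0 < m) (hC : 1 ≤ C) : ∃ u₀ : ℝ, 0 < u₀ ∧ ∀ u G L : ℝ,
    0 < u → u ≤ u₀ → m ≤ G → G ≤ C → |L| ≤ C →
    (G ^ 2 + C * u) / (4 * u ^ 2) ≤
      (1 / (2 * u ^ 2) - 1 / (2 * (u * √u))) * G ^ 2 + (1 / (2 * u) - 1 / √u) * L
        - (1 / (2 * u) - 1 / √u) ^ 2 * G ^ 2 := by
  set t₀ := min (1/2) (m^2 / (2 * (C^2 + C))) with ht₀
  have hCp : 0 < C^2 + C := by positivity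
  have ht₀p : 0 < t₀ := by rw [ht₀]; positivity
  refine ⟨t₀^2, by positivity, ?_⟩
  intro u G L hu hut hmG hGC hL
  obtain ⟨t, ht, rfl⟩ : ∃ t : ℝ, 0 < t ∧ u = t^2 := ⟨√u, by positivity, by rw [Real.sq_sqrt hu.le]⟩
  rw [Real.sqrt_sq ht.le]
  have htt : t ≤ t₀ := by
    exact (sq_le_sq₀ ht.le ht₀p.le).mp hut
  have h1 : t ≤ 1/2 := htt.trans (min_le_left _ _)
  have h2 : t * (2 * (C^2 + C)) ≤ m^2 := by
    have := htt.trans (min_le_right _ _)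
    rwa [le_div_iff₀ (by positivity)] at this
  have hLl := (abs_le.mp hL).1
  have hGm : m^2 ≤ G^2 := by gcongr
  have hGC2 : G^2 ≤ C^2 := by
    have : 0 ≤ G := by linarith
    gcongr
  have key : 0 ≤ G^2/2 - G^2 * t + L * (t/2 - t^2) - C * t / 4 := by
    have a1 : -C * (t / 2) ≤ L * (t/2 - t^2) := by
      have : 0 ≤ t/2 - t^2 := by nlinarith
      have : -C * (t/2 - t^2) ≤ L * (t/2 - t^2) := by gcongr
      nlinarith
    nlinarith
  rw [← sub_nonneg]
  have : (1 / (2 * (t ^ 2) ^ 2) - 1 / (2 * (t ^ 2 * t))) * G ^ 2 + (1 / (2 * t ^ 2) - 1 / t) * L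
        - (1 / (2 * t ^ 2) - 1 / t) ^ 2 * G ^ 2 - (G ^ 2 + C * t ^ 2) / (4 * (t ^ 2) ^ 2)
      = (G^2/2 - G^2 * t + L * (t/2 - t^2) - C * t / 4) / t^3 := by
    field_simp
    ring
  rw [this]
  positivity

section ibp
variable {E : Type*} [NormedAddCommGroup E] [InnerProductSpace ℝ E] [FiniteDimensional ℝ E]
  [MeasurableSpace E] [BorelSpace E] {ι : Type*} [Fintype ι]

/-- A product with a function supported in an open set is continuous. -/
lemma cont_mul_of_tsupport {X : Type*} [TopologicalSpace X] (f g : X → ℝ) (U : Set X)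
    (hU : IsOpen U) (hf : Continuous f) (hfU : tsupport f ⊆ U) (hg : ContinuousOn g U) :
    Continuous (fun x => g x * f x) := by
  refine ContinuousOn.continuous_of_tsupport_subset (s := U) (hg.mul hf.continuousOn) hU ?_
  exact (tsupport_mul_subset_right (f := g) (g := f)).trans hfU

lemma integrable_mul_of_tsupport (μ : Measure E) [μ.IsAddHaarMeasure] (f g : E → ℝ) (U : Set E)
    (hU : IsOpen U) (hf : Continuous f) (hfc : HasCompactSupport f) (hfU : tsupport f ⊆ U)
    (hg : ContinuousOn g U) :
    Integrable (fun x => g x * f x) μ :=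
  (cont_mul_of_tsupport f g U hU hf hfU hg).integrable_of_hasCompactSupport hfc.mul_left

lemma ibp_laplace (μ : Measure E) [μ.IsAddHaarMeasure] (b : OrthonormalBasis ι ℝ E)
    (φ ψ : E → ℝ) (hφ : ContDiff ℝ 2 φ) (hψ : ContDiff ℝ 1 ψ) (hψc : HasCompactSupport ψ) :
    Integrable (fun x => fderiv ℝ ψ x (gradient φ x)
      + ψ x * ∑ i, fderiv ℝ (fderiv ℝ φ) x (b i) (b i)) μ ∧
    ∫ x, (fderiv ℝ ψ x (gradient φ x)
      + ψ x * ∑ i, fderiv ℝ (fderiv ℝ φ) x (b i) (b i)) ∂μ = 0 := by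
  have h1 : ContDiff ℝ 1 (fderiv ℝ φ) := hφ.fderiv_right (by norm_num)
  have hi : ∀ i, ContDiff ℝ 1 (fun x => fderiv ℝ φ x (b i)) := fun i => h1.clm_apply contDiff_const
  have hfd : ∀ i x, fderiv ℝ (fun x => fderiv ℝ φ x (b i)) x (b i)
      = fderiv ℝ (fderiv ℝ φ) x (b i) (b i) := by
    intro i x
    have hd : HasFDerivAt (fderiv ℝ φ) (fderiv ℝ (fderiv ℝ φ) x) x :=
      (h1.differentiable (by norm_num) x).hasFDerivAt
    have := (hd.clm_apply (hasFDerivAt_const (b i) x)).fderiv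
    rw [this]; simp
  have hexp : ∀ x, fderiv ℝ ψ x (gradient φ x)
      + ψ x * ∑ i, fderiv ℝ (fderiv ℝ φ) x (b i) (b i)
      = ∑ i, (fderiv ℝ ψ x (b i) * fderiv ℝ φ x (b i)
        + ψ x * fderiv ℝ (fun x => fderiv ℝ φ x (b i)) x (b i)) := by
    intro x
    rw [Finset.sum_add_distrib, ← Finset.mul_sum]
    simp only [hfd]
    congr 1
    conv_lhs => rw [← b.sum_repr' (gradient φ x)]
    rw [map_sum]
    refine Finset.sum_congr rfl fun i _ => ?_
    rw [map_smul, smul_eq_mul, mul_comm]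
    congr 1
    rw [real_inner_comm, gradient, InnerProductSpace.toDual_symm_apply]
  have I1 : ∀ i, Integrable (fun x => fderiv ℝ ψ x (b i) * fderiv ℝ φ x (b i)) μ := by
    intro i
    refine Continuous.integrable_of_hasCompactSupport ?_ ?_
    · exact ((hψ.continuous_fderiv (by norm_num)).clm_apply continuous_const).mul (hi i).continuous
    · exact (hψc.fderiv_apply (𝕜 := ℝ) (b i)).mul_right
  have I2 : ∀ i, Integrable (fun x => ψ x * fderiv ℝ (fun x => fderiv ℝ φ x (b i)) x (b i)) μ := by
    intro i
    refine Continuous.integrable_of_hasCompactSupport ?_ ?_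
    · exact hψ.continuous.mul (((hi i).continuous_fderiv (by norm_num)).clm_apply continuous_const)
    · exact hψc.mul_right
  have I3 : ∀ i, Integrable (fun x => ψ x * fderiv ℝ φ x (b i)) μ := by
    intro i
    refine Continuous.integrable_of_hasCompactSupport ?_ ?_
    · exact hψ.continuous.mul (hi i).continuous
    · exact hψc.mul_right
  simp only [hexp]
  have I12 : ∀ i ∈ Finset.univ, Integrable (fun x => fderiv ℝ ψ x (b i) * fderiv ℝ φ x (b i)
        + ψ x * fderiv ℝ (fun x => fderiv ℝ φ x (b i)) x (b i)) μ :=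
    fun i _ => (I1 i).add (I2 i)
  refine ⟨integrable_finsetSum _ I12, ?_⟩
  rw [integral_finsetSum _ I12]
  refine Finset.sum_eq_zero fun i _ => ?_
  rw [integral_add (I1 i) (I2 i)]
  rw [integral_mul_fderiv_eq_neg_fderiv_mul_of_integrable (I1 i) (I2 i) (I3 i)
    (fun x _ => hψ.differentiable (by norm_num) x)
    (fun x _ => (hi i).differentiable (by norm_num) x)]
  ring

/-- The one-variable profile of the vector field. -/
def prof (s : ℝ) : ℝ := 1 / (2 * (-s)) - 1 / √(-s)

lemma prof_hasDerivAt (s : ℝ) (hs : s < 0) :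
    HasDerivAt prof (1 / (2 * (-s) ^ 2) - 1 / (2 * ((-s) * √(-s)))) s := by
  have hs' : 0 < -s := by linarith
  have hr : 0 < √(-s) := Real.sqrt_pos.mpr hs'
  have hr2 : √(-s) ^ 2 = -s := Real.sq_sqrt hs'.le
  have h1 : HasDerivAt (fun s : ℝ => -s) (-1) s := hasDerivAt_neg s
  have h2 := (h1.const_mul 2).inv (by positivity)
  have h3 := (h1.sqrt (by positivity)).inv (by positivity)
  have := h2.sub h3
  refine (this.congr_deriv ?_).congr_of_eventuallyEq (Filter.Eventually.of_forall fun t => ?_)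
  · rw [hr2]; field_simp
  · simp [prof]

lemma prof_contDiffAt (s : ℝ) (hs : s < 0) : ContDiffAt ℝ 1 prof s := by
  have hs' : 0 < -s := by linarith
  have hr : 0 < √(-s) := Real.sqrt_pos.mpr hs'
  have h1 : ContDiffAt ℝ 1 (fun s : ℝ => -s) s := contDiffAt_id.neg
  have h2 := (contDiffAt_const (c := (2:ℝ)).mul h1).inv (by positivity)
  have h3 := (h1.sqrt (by positivity)).inv (by positivity)
  refine (h2.sub h3).congr_of_eventuallyEq (Filter.Eventually.of_forall fun t => ?_)
  simp [prof]

set_option maxHeartbeats 1000000 in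
lemma lower_core (μ : Measure E) [μ.IsAddHaarMeasure] (b : OrthonormalBasis ι ℝ E)
    (φ w d f : E → ℝ) (U : Set E) (hU : IsOpen U) (hφ : ContDiff ℝ 2 φ)
    (hφU : ∀ x ∈ U, φ x < 0) (hw : ∀ x ∈ U, ContDiffAt ℝ 1 w x) (hw0 : ∀ x ∈ U, 0 < w x)
    (hd : Continuous d) (hd0 : ∀ x ∈ U, 0 < d x)
    (hP : ∀ x ∈ U, 1 / 4 * (1 / d x ^ 2) ≤
      (1 / (2 * (-φ x) ^ 2) - 1 / (2 * ((-φ x) * √(-φ x)))) * ‖gradient φ x‖ ^ 2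
        + prof (φ x) * (∑ i, fderiv ℝ (fderiv ℝ φ) x (b i) (b i)
            + fderiv ℝ w x (gradient φ x) / w x)
        - prof (φ x) ^ 2 * ‖gradient φ x‖ ^ 2)
    (hf : ContDiff ℝ (⊤ : ℕ∞) f) (hfc : HasCompactSupport f) (hfU : tsupport f ⊆ U) :
    1 / 4 * ∫ x, w x * (f x ^ 2 / d x ^ 2) ∂μ ≤ ∫ x, w x * ‖gradient f x‖ ^ 2 ∂μ := by
  have hf1 : ContDiff ℝ 1 f := hf.of_le (by exact_mod_cast le_top)
  have hwc : ContinuousOn w U := fun x hx => (hw x hx).continuousAt.continuousWithinAt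
  set ψ : E → ℝ := fun x => f x ^ 2 * (w x * prof (φ x)) with hψ_def
  have hsupp : ∀ x, x ∉ tsupport f → f =ᶠ[nhds x] 0 := fun x hx => notMem_tsupport_iff_eventuallyEq.mp hx
  have hψ : ContDiff ℝ 1 ψ := by
    rw [contDiff_iff_contDiffAt]
    intro x
    by_cases hx : x ∈ tsupport f
    · have hxU := hfU hx
      exact (hf1.contDiffAt.pow 2).mul ((hw x hxU).mul
        ((prof_contDiffAt _ (hφU x hxU)).comp x (hφ.contDiffAt.of_le (by norm_num))))
    · have : ψ =ᶠ[nhds x] fun _ => 0 := by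
        filter_upwards [hsupp x hx] with y hy
        simp [hψ_def, hy]
      exact contDiffAt_const.congr_of_eventuallyEq this
  have hψc : HasCompactSupport ψ := by
    refine hfc.mono ?_
    intro x hx hfx
    apply hx
    simp [hψ_def, hfx]
  obtain ⟨hI, h0⟩ := ibp_laplace μ b φ ψ hφ hψ hψc
  have hgn : ∀ (g : E → ℝ) x v, fderiv ℝ g x v = inner ℝ (gradient g x) v := by
    intro g x v
    rw [gradient, InnerProductSpace.toDual_symm_apply]
  have hgc : Continuous (fun x => ‖gradient f x‖ ^ 2) := by
    have : Continuous (gradient f) :=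
      (InnerProductSpace.toDual ℝ E).symm.continuous.comp (hf1.continuous_fderiv (by norm_num))
    exact this.norm.pow 2
  have hg0 : ∀ x, x ∉ tsupport f → gradient f x = 0 := by
    intro x hx
    rw [gradient, (hsupp x hx).fderiv_eq]
    simp
  have hf2c : HasCompactSupport (fun x => f x ^ 2) := by
    refine hfc.mono ?_
    intro x hx hfx
    apply hx
    simp [hfx]
  have hf2U : tsupport (fun x => f x ^ 2) ⊆ U := by
    refine (closure_mono ?_).trans hfU
    intro x hx hfx
    apply hx
    simp [hfx]
  have hg2s : Function.support (fun x => ‖gradient f x‖ ^ 2) ⊆ tsupport f := by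
    intro x hx
    by_contra h
    apply hx
    simp [hg0 x h]
  have hg2c : HasCompactSupport (fun x => ‖gradient f x‖ ^ 2) := hfc.mono' hg2s
  have hg2U : tsupport (fun x => ‖gradient f x‖ ^ 2) ⊆ U :=
    (closure_minimal hg2s (isClosed_tsupport f)).trans hfU
  have IN := integrable_mul_of_tsupport μ _ w U hU hgc hg2c hg2U hwc
  have hdc : ContinuousOn (fun x => w x * (1 / d x ^ 2)) U :=
    hwc.mul (continuousOn_const.div (hd.pow 2).continuousOn
      (fun x hx => (pow_pos (hd0 x hx) 2).ne'))
  have ID0 := integrable_mul_of_tsupport μ _ _ U hU (hf1.continuous.pow 2) hf2c hf2U hdc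
  have ID : Integrable (fun x => 1 / 4 * (w x * (f x ^ 2 / d x ^ 2))) μ := by
    refine Integrable.const_mul ?_ _
    refine ID0.congr (Filter.Eventually.of_forall fun x => ?_)
    simp only [Pi.pow_apply]
    ring
  rw [← integral_const_mul]
  have key : ∀ x, 1 / 4 * (w x * (f x ^ 2 / d x ^ 2)) ≤ w x * ‖gradient f x‖ ^ 2
      + (fderiv ℝ ψ x (gradient φ x) + ψ x * ∑ i, fderiv ℝ (fderiv ℝ φ) x (b i) (b i)) := by
    intro x
    by_cases hx : x ∈ tsupport f
    · have hxU := hfU hx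
      have hwx := hw0 x hxU
      have hfd : HasFDerivAt f (fderiv ℝ f x) x := (hf1.differentiable (by norm_num) x).hasFDerivAt
      have hwd : HasFDerivAt w (fderiv ℝ w x) x :=
        ((hw x hxU).differentiableAt (by norm_num)).hasFDerivAt
      have hφd : HasFDerivAt φ (fderiv ℝ φ x) x :=
        (hφ.differentiable (by norm_num) x).hasFDerivAt
      have hpd := (prof_hasDerivAt _ (hφU x hxU)).comp_hasFDerivAt x hφd
      have hψd := ((hfd.pow 2).mul (hwd.mul hpd)).fderiv
      have hval : fderiv ℝ ψ x (gradient φ x) =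
          2 * f x * w x * prof (φ x) * fderiv ℝ f x (gradient φ x)
          + f x ^ 2 * prof (φ x) * fderiv ℝ w x (gradient φ x)
          + f x ^ 2 * w x * (1 / (2 * (-φ x) ^ 2) - 1 / (2 * ((-φ x) * √(-φ x))))
              * ‖gradient φ x‖ ^ 2 := by
        have hgg : fderiv ℝ φ x (gradient φ x) = ‖gradient φ x‖ ^ 2 := by
          rw [hgn, real_inner_self_eq_norm_sq]
        rw [← hgg]
        have : fderiv ℝ ψ x = _ := hψd
        rw [this]
        simp
        ring
      rw [hval]
      have hP' := mul_le_mul_of_nonneg_left (hP x hxU)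
        (mul_nonneg hwx.le (sq_nonneg (f x)))
      have hsq : 0 ≤ ‖gradient f x + (prof (φ x) * f x) • gradient φ x‖ ^ 2 := sq_nonneg _
      rw [norm_add_sq_real, inner_smul_right, ← hgn, norm_smul, mul_pow, Real.norm_eq_abs,
        sq_abs] at hsq
      have hsq' := mul_nonneg hwx.le hsq
      have e1 : w x * f x ^ 2 * (prof (φ x) * (∑ i, fderiv ℝ (fderiv ℝ φ) x (b i) (b i)
            + fderiv ℝ w x (gradient φ x) / w x)) =
          f x ^ 2 * (w x * prof (φ x)) * ∑ i, fderiv ℝ (fderiv ℝ φ) x (b i) (b i)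
          + f x ^ 2 * prof (φ x) * fderiv ℝ w x (gradient φ x) := by
        field_simp
      have e2 : 1 / 4 * (w x * (f x ^ 2 / d x ^ 2)) = w x * f x ^ 2 * (1 / 4 * (1 / d x ^ 2)) := by
        ring
      rw [e2]
      simp only [hψ_def]
      rw [mul_sub, mul_add, e1] at hP'
      linarith
    · have h1 : f x = 0 := image_eq_zero_of_notMem_tsupport hx
      have h2 : fderiv ℝ ψ x = 0 := by
        have : ψ =ᶠ[nhds x] fun _ => 0 := by
          filter_upwards [hsupp x hx] with y hy
          simp [hψ_def, hy]
        rw [this.fderiv_eq]; simp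
      have h3 : ψ x = 0 := by simp [hψ_def, h1]
      simp [h1, h2, hg0 x hx, h3]
  calc ∫ x, 1 / 4 * (w x * (f x ^ 2 / d x ^ 2)) ∂μ
      ≤ ∫ x, (w x * ‖gradient f x‖ ^ 2
      + (fderiv ℝ ψ x (gradient φ x) + ψ x * ∑ i, fderiv ℝ (fderiv ℝ φ) x (b i) (b i))) ∂μ :=
        integral_mono ID (IN.add hI) key
    _ = _ := by rw [integral_add IN hI, h0, add_zero]

/-- Positivity of the denominator. -/
lemma denom_pos (μ : Measure E) [μ.IsAddHaarMeasure]
    (w d f : E → ℝ) (U : Set E) (hU : IsOpen U)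
    (hw : ContinuousOn w U) (hw0 : ∀ x ∈ U, 0 < w x)
    (hd : Continuous d) (hd0 : ∀ x ∈ U, 0 < d x)
    (hf : Continuous f) (hfc : HasCompactSupport f) (hfU : tsupport f ⊆ U) (hf0 : f ≠ 0) :
    0 < ∫ x, w x * (f x ^ 2 / d x ^ 2) ∂μ := by
  have hf2c : HasCompactSupport (fun x => f x ^ 2) := by
    refine hfc.mono ?_
    intro x hx hfx
    apply hx
    simp [hfx]
  have hf2U : tsupport (fun x => f x ^ 2) ⊆ U := by
    refine (closure_mono ?_).trans hfU
    intro x hx hfx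
    apply hx
    simp [hfx]
  have hdc : ContinuousOn (fun x => w x * (1 / d x ^ 2)) U :=
    hw.mul (continuousOn_const.div (hd.pow 2).continuousOn
      (fun x hx => (pow_pos (hd0 x hx) 2).ne'))
  have he : (fun x => w x * (f x ^ 2 / d x ^ 2)) = fun x => w x * (1 / d x ^ 2) * f x ^ 2 := by
    ext x; ring
  rw [he]
  obtain ⟨x, hx⟩ := Function.ne_iff.mp hf0
  refine Continuous.integral_pos_of_hasCompactSupport_nonneg_nonzero (x := x)
    (cont_mul_of_tsupport _ _ U hU (hf.pow 2) hf2U hdc) hf2c.mul_left ?_ ?_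
  · intro y
    by_cases hy : y ∈ tsupport f
    · have := hw0 y (hfU hy)
      have := hd0 y (hfU hy)
      simp only [Pi.zero_apply]
      positivity
    · simp [image_eq_zero_of_notMem_tsupport hy]
  · have hxU : x ∈ U := hfU (subset_tsupport f hx)
    have := hw0 x hxU
    have := hd0 x hxU
    have : f x ≠ 0 := hx
    positivity

end ibp

lemma weight_contDiffAt {N : ℕ} (x : EuclideanSpace ℝ (Fin N)) (hx : x ≠ 0) :
    ContDiffAt ℝ 1 (fun x : EuclideanSpace ℝ (Fin N) => ‖x‖ ^ (2 - (N : ℝ))) x :=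
  (contDiffAt_norm ℝ hx).rpow_const_of_ne (norm_ne_zero_iff.mpr hx)

lemma weight_pos {N : ℕ} (x : EuclideanSpace ℝ (Fin N)) (hx : x ≠ 0) :
    0 < ‖x‖ ^ (2 - (N : ℝ)) := Real.rpow_pos_of_pos (norm_pos_iff.mpr hx) _

lemma weight_deriv_bound {N : ℕ} (r R : ℝ) (hr : 0 < r) : ∃ C : ℝ, 0 ≤ C ∧
    ∀ x : EuclideanSpace ℝ (Fin N), r ≤ ‖x‖ → ‖x‖ ≤ R →
      ‖fderiv ℝ (fun x : EuclideanSpace ℝ (Fin N) => ‖x‖ ^ (2 - (N : ℝ))) x‖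
        ≤ C * ‖x‖ ^ (2 - (N : ℝ)) := by
  set w := fun x : EuclideanSpace ℝ (Fin N) => ‖x‖ ^ (2 - (N : ℝ)) with hw
  set A : Set (EuclideanSpace ℝ (Fin N)) := Metric.closedBall 0 R ∩ {x | r ≤ ‖x‖} with hA
  have hAc : IsCompact A :=
    (isCompact_closedBall _ _).inter_right (isClosed_le continuous_const continuous_norm)
  have hA0 : ∀ x ∈ A, x ≠ 0 := by
    rintro x ⟨-, hx⟩ rfl
    simp at hx
    linarith
  have hcd : ContDiffOn ℝ 1 w {0}ᶜ := fun x hx => (weight_contDiffAt x hx).contDiffWithinAt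
  have h1 : ContinuousOn (fderiv ℝ w) A :=
    (hcd.continuousOn_fderiv_of_isOpen isOpen_compl_singleton (by norm_num)).mono
      (fun x hx => hA0 x hx)
  have h2 : ContinuousOn w A := hcd.continuousOn.mono (fun x hx => hA0 x hx)
  have h3 : ContinuousOn (fun x => ‖fderiv ℝ w x‖ / w x) A :=
    h1.norm.div h2 (fun x hx => (weight_pos x (hA0 x hx)).ne')
  obtain ⟨C, hC⟩ := hAc.exists_bound_of_continuousOn h3
  refine ⟨max C 0, le_max_right _ _, fun x hx1 hx2 => ?_⟩
  have hxA : x ∈ A := ⟨by simpa using hx2, hx1⟩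
  have hp : 0 < w x := weight_pos x (hA0 x hxA)
  have := hC x hxA
  rw [Real.norm_eq_abs] at this
  have h4 := (le_abs_self _).trans this
  rw [div_le_iff₀ hp] at h4
  refine h4.trans ?_
  have : C ≤ max C 0 := le_max_left _ _
  exact mul_le_mul_of_nonneg_right this hp.le

lemma bounded_frontier {N : ℕ} (hN : 3 ≤ N)
    (Ω : Set (EuclideanSpace ℝ (Fin N))) (hΩb : Bornology.IsBounded Ω)
    (h0 : (0 : EuclideanSpace ℝ (Fin N)) ∈ Ω) :
    (frontier Ω).Nonempty ∧ IsCompact (frontier Ω) := by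
  haveI : Nonempty (Fin N) := ⟨⟨0, by omega⟩⟩
  have hne : Ω ≠ Set.univ := by
    rintro rfl
    exact NormedSpace.unbounded_univ ℝ (EuclideanSpace ℝ (Fin N)) hΩb
  constructor
  · obtain ⟨y, hy, -⟩ := exists_mem_frontier_infDist_compl_eq_dist h0 hne
    exact ⟨y, hy⟩
  · exact hΩb.isCompact_closure.of_isClosed_subset isClosed_frontier frontier_subset_closure

lemma setIntegral_eq_of_tsupport {N : ℕ} (f : EuclideanSpace ℝ (Fin N) → ℝ)
    (S : Set (EuclideanSpace ℝ (Fin N))) (h : tsupport f ⊆ interior S)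
    (w d : EuclideanSpace ℝ (Fin N) → ℝ) :
    (∫ x in S, w x * ‖gradient f x‖ ^ 2) = (∫ x, w x * ‖gradient f x‖ ^ 2) ∧
    (∫ x in S, w x * (f x ^ 2 / d x ^ 2)) = ∫ x, w x * (f x ^ 2 / d x ^ 2) := by
  have hx : ∀ x ∉ S, x ∉ tsupport f := fun x hx h' => hx (interior_subset (h h'))
  constructor
  · refine setIntegral_eq_integral_of_forall_compl_eq_zero fun x hxS => ?_
    have : gradient f x = 0 := by
      rw [gradient, (notMem_tsupport_iff_eventuallyEq.mp (hx x hxS)).fderiv_eq]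
      simp
    simp [this]
  · refine setIntegral_eq_integral_of_forall_compl_eq_zero fun x hxS => ?_
    simp [image_eq_zero_of_notMem_tsupport (hx x hxS)]

set_option maxHeartbeats 1000000 in
lemma lower_bound (N : ℕ) (hN : 3 ≤ N)
    (Ω : Set (EuclideanSpace ℝ (Fin N))) (hΩo : IsOpen Ω)
    (hΩb : Bornology.IsBounded Ω) (hΩsm : IsC2Domain Ω)
    (h0 : (0 : EuclideanSpace ℝ (Fin N)) ∈ Ω) :
    ∃ δ₀ : ℝ, 0 < δ₀ ∧ ∀ δ : ℝ, 0 < δ → δ ≤ δ₀ →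
      ∀ f : EuclideanSpace ℝ (Fin N) → ℝ,
          ContDiff ℝ (⊤ : ℕ∞) f → HasCompactSupport f →
          tsupport f ⊆ interior {x | x ∈ Ω ∧ bdist Ω x ≤ δ} → f ≠ 0 →
          1 / 4 ≤ (∫ x in {x | x ∈ Ω ∧ bdist Ω x ≤ δ},
                ‖x‖ ^ (2 - (N : ℝ)) * ‖gradient f x‖ ^ 2) /
              (∫ x in {x | x ∈ Ω ∧ bdist Ω x ≤ δ},
                ‖x‖ ^ (2 - (N : ℝ)) * (f x ^ 2 / bdist Ω x ^ 2)) := by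
  obtain ⟨φ, hφ, hΩφ, hfr⟩ := hΩsm
  obtain ⟨hne, hcomp⟩ := bounded_frontier hN Ω hΩb h0
  obtain ⟨δ₁, m, C, hδ₁, hm, hC, hgeom⟩ := geom φ hφ Ω hΩφ hfr hne hΩb hcomp
  obtain ⟨R, hR⟩ := hΩb.subset_closedBall 0
  set r := Metric.infDist (0 : EuclideanSpace ℝ (Fin N)) (frontier Ω) with hr
  have hr0 : 0 < r := by
    refine (isClosed_frontier.notMem_iff_infDist_pos hne).mp ?_
    rw [hΩo.frontier_eq]
    exact fun h => h.2 h0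
  obtain ⟨Cw, hCw0, hCw⟩ := weight_deriv_bound (N := N) (r / 2) R (by positivity)
  set w := fun x : EuclideanSpace ℝ (Fin N) => ‖x‖ ^ (2 - (N : ℝ)) with hw
  set C' := C + N * C + Cw * C with hC'
  have hCC' : C ≤ C' := by
    have : 0 ≤ (N:ℝ) * C := by positivity
    have : 0 ≤ Cw * C := by positivity
    linarith
  obtain ⟨u₀, hu₀, hscal⟩ := scalar_ineq m C' hm (hC.trans hCC')
  have hC0 : 0 < C := by linarith
  refine ⟨min δ₁ (min (r / 2) (u₀ / C)), by positivity, ?_⟩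
  intro δ hδ hδ₀ f hf hfc hfU hf0
  obtain ⟨e1, e2⟩ := setIntegral_eq_of_tsupport f _ hfU w (bdist Ω)
  rw [e1, e2]
  set U := interior {x | x ∈ Ω ∧ bdist Ω x ≤ δ} with hU
  have hUS : ∀ x ∈ U, x ∈ Ω ∧ bdist Ω x ≤ δ := by
    intro x hx
    have h := interior_subset hx
    exact h
  have hUo : IsOpen U := isOpen_interior
  have hdcont : Continuous (bdist Ω) := Metric.continuous_infDist_pt _
  have hbig : ∀ x ∈ U, r / 2 ≤ ‖x‖ := by
    intro x hx
    have h1 : r ≤ bdist Ω x + dist 0 x := Metric.infDist_le_infDist_add_dist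
    have h2 := (hUS x hx).2
    have h3 : δ ≤ r / 2 := hδ₀.trans ((min_le_right _ _).trans (min_le_left _ _))
    rw [dist_zero_left] at h1
    linarith
  have hx0 : ∀ x ∈ U, x ≠ 0 := by
    rintro x hx rfl
    have := hbig _ hx
    simp at this
    linarith
  have hgU : ∀ x ∈ U, _ := fun x hx => hgeom x (hUS x hx).1
    ((hUS x hx).2.trans (hδ₀.trans (min_le_left _ _)))
  have hd0 : ∀ x ∈ U, 0 < bdist Ω x := fun x hx => (hgU x hx).2.2.2.1
  have hφU : ∀ x ∈ U, φ x < 0 := by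
    intro x hx
    have := (hUS x hx).1
    rw [hΩφ] at this
    exact this
  have hDpos := denom_pos volume w (bdist Ω) f U hUo
    (fun x hx => (weight_contDiffAt x (hx0 x hx)).continuousAt.continuousWithinAt)
    (fun x hx => weight_pos x (hx0 x hx)) hdcont hd0 hf.continuous hfc hfU hf0
  rw [le_div_iff₀ hDpos]
  refine lower_core volume (EuclideanSpace.basisFun (Fin N) ℝ) φ w (bdist Ω) f U hUo hφ hφU
    (fun x hx => weight_contDiffAt x (hx0 x hx)) (fun x hx => weight_pos x (hx0 x hx)) hdcont hd0
    ?_ hf hfc hfU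
  intro x hx
  obtain ⟨g1, g2, g3, g4, g5, g6⟩ := hgU x hx
  have hu : 0 < -φ x := by linarith [hφU x hx]
  have hgn : ‖gradient φ x‖ = ‖fderiv ℝ φ x‖ := by simp [gradient]
  rw [hgn]
  have hu1 : -φ x ≤ u₀ := by
    have h1 := (hUS x hx).2.trans (hδ₀.trans ((min_le_right _ _).trans (min_le_right _ _)))
    rw [le_div_iff₀ hC0] at h1
    have : bdist Ω x = Metric.infDist x (frontier Ω) := rfl
    rw [this] at h1
    linarith
  set b := EuclideanSpace.basisFun (Fin N) ℝ with hb
  have hwx : 0 < w x := weight_pos x (hx0 x hx)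
  have hL1 : |∑ i, fderiv ℝ (fderiv ℝ φ) x (b i) (b i)| ≤ N * C := by
    refine (Finset.abs_sum_le_sum_abs _ _).trans ?_
    have : ∀ i ∈ Finset.univ, |fderiv ℝ (fderiv ℝ φ) x (b i) (b i)| ≤ C := by
      intro i _
      have h1 := (fderiv ℝ (fderiv ℝ φ) x).le_opNorm₂ (b i) (b i)
      rw [b.norm_eq_one i, mul_one, mul_one, Real.norm_eq_abs] at h1
      exact h1.trans g3
    refine (Finset.sum_le_sum this).trans ?_
    simp
  have hL2 : |fderiv ℝ w x (gradient φ x) / w x| ≤ Cw * C := by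
    rw [abs_div, abs_of_pos hwx, div_le_iff₀ hwx]
    have h1 := (fderiv ℝ w x).le_opNorm (gradient φ x)
    rw [Real.norm_eq_abs, hgn] at h1
    refine h1.trans ?_
    have h2 := hCw x (hbig x hx) (by simpa using hR (hUS x hx).1)
    calc _ ≤ (Cw * w x) * C := mul_le_mul h2 g2 (norm_nonneg _) (by positivity)
      _ = _ := by ring
  have hL : |∑ i, fderiv ℝ (fderiv ℝ φ) x (b i) (b i) + fderiv ℝ w x (gradient φ x) / w x| ≤ C' := by
    refine (abs_add_le _ _).trans ?_
    linarith
  refine le_trans ?_ (hscal (-φ x) ‖fderiv ℝ φ x‖ _ hu hu1 g1 (g2.trans hCC') hL)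
  have g7 : 1 / bdist Ω x ^ 2 ≤ (‖fderiv ℝ φ x‖ ^ 2 + C * -φ x) / (-φ x) ^ 2 := g6
  have g8 : (‖fderiv ℝ φ x‖ ^ 2 + C * -φ x) / (-φ x) ^ 2
      ≤ (‖fderiv ℝ φ x‖ ^ 2 + C' * -φ x) / (-φ x) ^ 2 := by gcongr
  calc 1 / 4 * (1 / bdist Ω x ^ 2) ≤ 1 / 4 * ((‖fderiv ℝ φ x‖ ^ 2 + C' * -φ x) / (-φ x) ^ 2) := by
        linarith
    _ = _ := by field_simp

lemma slow_bump (ε : ℝ) (hε : 0 < ε) : ∃ z : ℝ → ℝ, ContDiff ℝ (⊤ : ℕ∞) z ∧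
    HasCompactSupport z ∧ 0 < ∫ t, z t ^ 2 ∧ ∫ t, deriv z t ^ 2 ≤ ε * ∫ t, z t ^ 2 := by
  let ζ : ContDiffBump (0:ℝ) := ⟨1, 2, by norm_num, by norm_num⟩
  have hζ : ContDiff ℝ (⊤ : ℕ∞) ζ := ζ.contDiff
  have hζc : HasCompactSupport ζ := ζ.hasCompactSupport
  have hpos : 0 < ∫ t, ζ t ^ 2 := by
    refine Continuous.integral_pos_of_hasCompactSupport_nonneg_nonzero (x := 0)
      (ζ.continuous.pow 2) ?_ (fun t => sq_nonneg _) ?_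
    · refine hζc.mono ?_
      intro x hx hfx
      apply hx
      simp [hfx]
    · have : ζ 0 = 1 := ζ.one_of_mem_closedBall (by simp [ζ])
      simp [this]
  set A := ∫ t, ζ t ^ 2 with hA
  set B := ∫ t, deriv ζ t ^ 2 with hB
  have hB0 : 0 ≤ B := integral_nonneg fun t => sq_nonneg _
  obtain ⟨k, hk, hkB⟩ : ∃ k : ℝ, 0 < k ∧ k ^ 2 * B ≤ ε * A := by
    refine ⟨√(ε * A / (B + 1)), by positivity, ?_⟩
    rw [Real.sq_sqrt (by positivity), div_mul_eq_mul_div, div_le_iff₀ (by positivity)]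
    have : 0 ≤ ε * A := by positivity
    nlinarith
  have hd : ∀ t, deriv (fun t => ζ (k * t)) t = k * deriv ζ (k * t) := by
    intro t
    have h1 : HasDerivAt ζ (deriv ζ (k * t)) (k * t) :=
      (hζ.differentiable (by simp) _).hasDerivAt
    have h2 : HasDerivAt (fun t : ℝ => k * t) k t := by
      simpa using (hasDerivAt_id t).const_mul k
    have := (h1.comp t h2).deriv
    rw [Function.comp_def] at this
    rw [this]; ring
  have i1 : ∫ t, ζ (k * t) ^ 2 = k⁻¹ * A := by
    have := Measure.integral_comp_mul_left (fun t => ζ t ^ 2) k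
    rw [this, abs_of_pos (by positivity), smul_eq_mul]
  have i2 : ∫ t, deriv ζ (k * t) ^ 2 = k⁻¹ * B := by
    have := Measure.integral_comp_mul_left (fun t => deriv ζ t ^ 2) k
    rw [this, abs_of_pos (by positivity), smul_eq_mul]
  refine ⟨fun t => ζ (k * t), hζ.comp (contDiff_const.mul contDiff_id), ?_, ?_, ?_⟩
  · exact hζc.comp_homeomorph (Homeomorph.mulLeft₀ k hk.ne')
  · rw [i1]; positivity
  · simp only [hd, mul_pow]
    rw [integral_const_mul, i1, i2]
    calc k ^ 2 * (k⁻¹ * B) = k⁻¹ * (k^2 * B) := by ring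
      _ ≤ k⁻¹ * (ε * A) := by gcongr
      _ = _ := by ring

lemma integral_exp_subst (F : ℝ → ℝ) (hF : ∀ s ≤ 0, F s = 0) :
    ∫ s, F s = ∫ t, rexp t * F (rexp t) := by
  have h := integral_image_eq_integral_abs_deriv_smul (s := Set.univ) (f := rexp) (f' := rexp)
    MeasurableSet.univ (fun x _ => (Real.hasDerivAt_exp x).hasDerivWithinAt)
    (Real.exp_injective.injOn) F
  rw [Set.image_univ, Real.range_exp, Measure.restrict_univ] at h
  rw [← setIntegral_eq_integral_of_forall_compl_eq_zero (s := Set.Ioi 0), h]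
  · simp [abs_of_pos (Real.exp_pos _)]
  · intro s hs
    exact hF s (by simpa using hs)

set_option maxHeartbeats 1000000 in
lemma hardy_1d (ε : ℝ) (hε : 0 < ε) : ∃ η : ℝ → ℝ, ContDiff ℝ (⊤ : ℕ∞) η ∧
    HasCompactSupport η ∧ tsupport η ⊆ Set.Ioi 0 ∧ 0 < ∫ s, η s ^ 2 / s ^ 2 ∧
    ∫ s, deriv η s ^ 2 ≤ (1 / 4 + ε) * ∫ s, η s ^ 2 / s ^ 2 := by
  obtain ⟨z, hz, hzc, hz0, hzε⟩ := slow_bump ε hε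
  obtain ⟨R, hR⟩ := hzc.isCompact.isBounded.subset_closedBall (0:ℝ)
  have hzR : ∀ t, z t ≠ 0 → |t| ≤ R := by
    intro t ht
    have := hR (subset_tsupport z ht)
    simpa using this
  set η : ℝ → ℝ := fun s => √s * z (Real.log s) with hη
  have hηneg : ∀ s ≤ 0, η s = 0 := by
    intro s hs
    simp [hη, Real.sqrt_eq_zero_of_nonpos hs]
  have hsupp : Function.support η ⊆ Set.Icc (rexp (-R)) (rexp R) := by
    intro s hs
    have hs0 : 0 < s := by
      by_contra h
      exact hs (hηneg s (not_lt.mp h))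
    have hz : z (Real.log s) ≠ 0 := fun h => hs (by simp [hη, h])
    have := abs_le.mp (hzR _ hz)
    constructor
    · rw [← Real.le_log_iff_exp_le hs0]; exact this.1
    · rw [← Real.log_le_iff_le_exp hs0]; exact this.2
  have htsupp : tsupport η ⊆ Set.Icc (rexp (-R)) (rexp R) := closure_minimal hsupp isClosed_Icc
  have htpos : tsupport η ⊆ Set.Ioi 0 := fun s hs => (Real.exp_pos _).trans_le (htsupp hs).1
  have hηc : HasCompactSupport η := isCompact_Icc.of_isClosed_subset (isClosed_tsupport η) htsupp
  have hηd : ContDiff ℝ (⊤ : ℕ∞) η := by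
    rw [contDiff_iff_contDiffAt]
    intro s
    by_cases hs : s ∈ tsupport η
    · have hs0 : s ≠ 0 := (htpos hs).ne'
      exact (Real.contDiffAt_sqrt hs0).mul (hz.contDiffAt.comp s (Real.contDiffAt_log.mpr hs0))
    · have : η =ᶠ[nhds s] fun _ => 0 := notMem_tsupport_iff_eventuallyEq.mp hs
      exact contDiffAt_const.congr_of_eventuallyEq this
  have hder : ∀ t, deriv η (rexp t) = (√(rexp t))⁻¹ * (1 / 2 * z t + deriv z t) := by
    intro t
    have ht := Real.exp_pos t
    have h1 : HasDerivAt z (deriv z (Real.log (rexp t))) (Real.log (rexp t)) :=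
      (hz.differentiable (by simp) _).hasDerivAt
    have h2 := h1.comp _ (Real.hasDerivAt_log ht.ne')
    have h3 := ((Real.hasDerivAt_sqrt ht.ne').mul h2).deriv
    have : deriv η (rexp t) = _ := h3
    rw [this, Function.comp, Real.log_exp]
    have hq : 0 < √(rexp t) := Real.sqrt_pos.mpr ht
    have hq2 : rexp t = √(rexp t) ^ 2 := (Real.sq_sqrt ht.le).symm
    generalize √(rexp t) = q at *
    rw [hq2]
    field_simp
  have hderneg : ∀ s ≤ 0, deriv η s = 0 := by
    intro s hs
    have : s ∉ tsupport η := fun h => absurd (htpos h) (by simpa using hs)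
    have h2 : η =ᶠ[nhds s] fun _ => 0 := notMem_tsupport_iff_eventuallyEq.mp this
    rw [h2.deriv_eq]; simp
  have i1 : ∫ s, η s ^ 2 / s ^ 2 = ∫ t, z t ^ 2 := by
    rw [integral_exp_subst _ (fun s hs => by simp [hηneg s hs])]
    congr 1; ext t
    have ht := Real.exp_pos t
    simp only [hη, Real.log_exp, mul_pow, Real.sq_sqrt ht.le]
    field_simp
  have zc : Continuous z := hz.continuous
  have zdc : Continuous (deriv z) := hz.continuous_deriv (by simp)
  have I1 : Integrable (fun t => 1 / 4 * z t ^ 2) :=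
    (((zc.pow 2).integrable_of_hasCompactSupport (hzc.mono fun x hx hfx => hx (by simp [hfx])))).const_mul _
  have I2 : Integrable (fun t => z t * deriv z t) :=
    (zc.mul zdc).integrable_of_hasCompactSupport hzc.mul_right
  have I2' : Integrable (fun t => deriv z t * z t) :=
    (zdc.mul zc).integrable_of_hasCompactSupport hzc.mul_left
  have I3 : Integrable (fun t => deriv z t ^ 2) :=
    (zdc.pow 2).integrable_of_hasCompactSupport (hzc.deriv.mono fun x hx hfx => hx (by simp [hfx]))
  have I4 : Integrable (fun t => z t * z t) :=
    (zc.mul zc).integrable_of_hasCompactSupport hzc.mul_left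
  have hzz : ∫ t, z t * deriv z t = 0 := by
    have := integral_mul_deriv_eq_deriv_mul_of_integrable (u := z) (v := z) (u' := deriv z)
      (v' := deriv z) (fun t _ => (hz.differentiable (by simp) t).hasDerivAt)
      (fun t _ => (hz.differentiable (by simp) t).hasDerivAt) I2 I2' I4
    have h2 : ∫ t, deriv z t * z t = ∫ t, z t * deriv z t := by
      congr 1; ext t; ring
    rw [h2] at this
    linarith
  have i2 : ∫ s, deriv η s ^ 2 = 1 / 4 * (∫ t, z t ^ 2) + ∫ t, deriv z t ^ 2 := by
    rw [integral_exp_subst _ (fun s hs => by simp [hderneg s hs])]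
    have : ∀ t, rexp t * deriv η (rexp t) ^ 2
        = (1 / 4 * z t ^ 2 + z t * deriv z t) + deriv z t ^ 2 := by
      intro t
      have ht := Real.exp_pos t
      rw [hder, mul_pow, inv_pow, Real.sq_sqrt ht.le]
      field_simp
      ring
    simp only [this]
    have I12 : Integrable (fun t => 1 / 4 * z t ^ 2 + z t * deriv z t) := I1.add I2
    rw [integral_add I12 I3, integral_add I1 I2, hzz, integral_const_mul, add_zero]
  refine ⟨η, hηd, hηc, htpos, by rw [i1]; exact hz0, ?_⟩
  rw [i1, i2]
  linarith

lemma integral_prod_euclid {N : ℕ} (k : Fin N → ℝ → ℝ) :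
    ∫ y : EuclideanSpace ℝ (Fin N), ∏ i, k i (y i) = ∏ i, ∫ t, k i t := by
  rw [← integral_fintype_prod_volume_eq_prod (E := fun _ => ℝ) k]
  have := (EuclideanSpace.volume_preserving_symm_measurableEquiv_toLp (Fin N)).integral_comp'
    (fun y : Fin N → ℝ => ∏ i, k i (y i))
  rw [← this]
  rfl

set_option maxHeartbeats 1000000 in
lemma hardy_halfspace {N : ℕ} (i₀ : Fin N) (ε : ℝ) (hε : 0 < ε) :
    ∃ g : EuclideanSpace ℝ (Fin N) → ℝ, ContDiff ℝ (⊤ : ℕ∞) g ∧ HasCompactSupport g ∧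
      (∀ y ∈ tsupport g, 0 < y i₀) ∧ 0 < ∫ y, g y ^ 2 / (y i₀) ^ 2 ∧
      ∫ y, ‖gradient g y‖ ^ 2 ≤ (1 / 4 + ε) * ∫ y, g y ^ 2 / (y i₀) ^ 2 := by
  obtain ⟨η, hη, hηc, hηs, hηD, hηQ⟩ := hardy_1d (ε / 2) (by positivity)
  set D := ∫ s, η s ^ 2 / s ^ 2 with hD
  set P₀ := ∫ s, η s ^ 2 with hP₀
  have hP₀0 : 0 ≤ P₀ := integral_nonneg fun s => sq_nonneg _
  set ε' := ε / 2 * D / ((N:ℝ) * P₀ + 1) with hε'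
  have hε'0 : 0 < ε' := by positivity
  have hε'D : N * ε' * P₀ ≤ ε / 2 * D := by
    have h1 : ε' * ((N:ℝ) * P₀ + 1) = ε / 2 * D := by
      rw [hε']; field_simp
    nlinarith
  obtain ⟨χ, hχ, hχc, hχ0, hχQ⟩ := slow_bump ε' hε'0
  let h : Fin N → ℝ → ℝ := fun i => if i = i₀ then η else χ
  have h_i₀ : h i₀ = η := by simp [h]
  have h_ne : ∀ i, i ≠ i₀ → h i = χ := fun i hi => by simp [h, hi]
  have hh : ∀ i, ContDiff ℝ (⊤ : ℕ∞) (h i) := by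
    intro i; by_cases hi : i = i₀
    · rw [hi, h_i₀]; exact hη
    · rw [h_ne i hi]; exact hχ
  have hhc : ∀ i, HasCompactSupport (h i) := by
    intro i; by_cases hi : i = i₀
    · rw [hi, h_i₀]; exact hηc
    · rw [h_ne i hi]; exact hχc
  set g : EuclideanSpace ℝ (Fin N) → ℝ := fun y => ∏ i, h i (y i) with hg
  have hcoord : ∀ i, ContDiff ℝ (⊤ : ℕ∞) (fun y : EuclideanSpace ℝ (Fin N) => y i) := by
    intro i; fun_prop
  have hgd : ContDiff ℝ (⊤ : ℕ∞) g := by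
    refine contDiff_prod fun i _ => ?_
    exact (hh i).comp (hcoord i)
  set T : Set (EuclideanSpace ℝ (Fin N)) :=
    (WithLp.toLp 2) '' (Set.univ.pi fun i => tsupport (h i)) with hT
  have hTc : IsCompact T :=
    (isCompact_univ_pi fun i => (hhc i).isCompact).image (PiLp.continuous_toLp 2 _)
  have hgT : tsupport g ⊆ T := by
    refine closure_minimal ?_ hTc.isClosed
    intro y hy
    refine ⟨WithLp.ofLp y, fun i _ => ?_, rfl⟩
    refine subset_tsupport _ ?_
    intro h0
    exact hy (Finset.prod_eq_zero (Finset.mem_univ i) h0)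
  have hgc : HasCompactSupport g := hTc.of_isClosed_subset (isClosed_tsupport g) hgT
  have hpos : ∀ y ∈ tsupport g, 0 < y i₀ := by
    intro y hy
    obtain ⟨v, hv, rfl⟩ := hgT hy
    have this : v i₀ ∈ tsupport (h i₀) := hv i₀ (Set.mem_univ _)
    rw [h_i₀] at this
    exact hηs this
  set P : Fin N → ℝ := fun i => ∫ t, h i t ^ 2 with hP
  have hP0 : ∀ i, i ≠ i₀ → 0 < P i := by
    intro i hi; simp only [hP]; rw [h_ne i hi]; exact hχ0
  set PP := ∏ i ∈ Finset.univ.erase i₀, P i with hPP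
  have hPP0 : 0 < PP := Finset.prod_pos fun i hi => hP0 i (Finset.ne_of_mem_erase hi)
  have hden : ∫ y, g y ^ 2 / (y i₀) ^ 2 = D * PP := by
    have e : ∀ y : EuclideanSpace ℝ (Fin N), g y ^ 2 / (y i₀) ^ 2
        = ∏ i, (fun i t => if i = i₀ then h i t ^ 2 / t ^ 2 else h i t ^ 2) i (y i) := by
      intro y
      rw [← Finset.mul_prod_erase _ _ (Finset.mem_univ i₀)]
      simp only [hg]
      rw [← Finset.mul_prod_erase _ _ (Finset.mem_univ i₀)]
      simp only [if_true]
      rw [mul_pow, ← Finset.prod_pow]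
      have : ∏ x ∈ Finset.univ.erase i₀,
          (if x = i₀ then h x (y x) ^ 2 / y x ^ 2 else h x (y x) ^ 2)
          = ∏ x ∈ Finset.univ.erase i₀, h x (y x) ^ 2 :=
        Finset.prod_congr rfl fun i hi => by rw [if_neg (Finset.ne_of_mem_erase hi)]
      rw [this]; ring
    refine (integral_congr_ae (Filter.Eventually.of_forall e)).trans
      ((integral_prod_euclid (fun i t => if i = i₀ then h i t ^ 2 / t ^ 2 else h i t ^ 2)).trans ?_)
    rw [← Finset.mul_prod_erase _ _ (Finset.mem_univ i₀)]
    congr 1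
    · simp [h_i₀, hD]
    · refine Finset.prod_congr rfl fun i hi => ?_
      simp [Finset.ne_of_mem_erase hi, hP]
  have hfd : ∀ (y : EuclideanSpace ℝ (Fin N)) j, gradient g y j
      = deriv (h j) (y j) * ∏ i ∈ Finset.univ.erase j, h i (y i) := by
    intro y j
    have e1 : gradient g y j = fderiv ℝ g y (EuclideanSpace.single j 1) := by
      rw [gradient, ← InnerProductSpace.toDual_symm_apply, EuclideanSpace.inner_single_right]
      simp
    have e2 : ∀ i ∈ Finset.univ, HasFDerivAt (fun y : EuclideanSpace ℝ (Fin N) => h i (y i))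
        (deriv (h i) (y i) • (EuclideanSpace.proj i : EuclideanSpace ℝ (Fin N) →L[ℝ] ℝ)) y := by
      intro i _
      have a1 : HasDerivAt (h i) (deriv (h i) (y i)) (y i) :=
        ((hh i).differentiable (by simp) _).hasDerivAt
      have a2 : HasFDerivAt (fun y : EuclideanSpace ℝ (Fin N) => y i)
          (EuclideanSpace.proj i : EuclideanSpace ℝ (Fin N) →L[ℝ] ℝ) y :=
        (EuclideanSpace.proj i : EuclideanSpace ℝ (Fin N) →L[ℝ] ℝ).hasFDerivAt
      exact a1.comp_hasFDerivAt y a2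
    have e3 := (HasFDerivAt.finsetProd e2).fderiv
    have e4 : fderiv ℝ g y = _ := e3
    rw [e1, e4]
    have e5 : ∀ i, (EuclideanSpace.proj i : EuclideanSpace ℝ (Fin N) →L[ℝ] ℝ)
        (EuclideanSpace.single j 1) = if i = j then 1 else 0 := by
      intro i
      simp
    simp only [_root_.sum_apply, _root_.smul_apply, smul_eq_mul, e5]
    rw [Finset.sum_eq_single j]
    · simp; ring
    · intro i _ hij
      simp [hij]
    · simp
  set Q : Fin N → ℝ := fun i => ∫ t, deriv (h i) t ^ 2 with hQ
  have hnum_j : ∀ j, ∫ y, (gradient g y j) ^ 2 = Q j * ∏ i ∈ Finset.univ.erase j, P i := by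
    intro j
    have e : ∀ y : EuclideanSpace ℝ (Fin N), (gradient g y j) ^ 2
        = ∏ i, (fun i t => if i = j then deriv (h i) t ^ 2 else h i t ^ 2) i (y i) := by
      intro y
      rw [hfd, ← Finset.mul_prod_erase _ _ (Finset.mem_univ j)]
      simp only [if_true]
      rw [mul_pow, ← Finset.prod_pow]
      congr 1
      exact Finset.prod_congr rfl fun i hi => by rw [if_neg (Finset.ne_of_mem_erase hi)]
    refine (integral_congr_ae (Filter.Eventually.of_forall e)).trans
      ((integral_prod_euclid (fun i t => if i = j then deriv (h i) t ^ 2 else h i t ^ 2)).trans ?_)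
    rw [← Finset.mul_prod_erase _ _ (Finset.mem_univ j)]
    congr 1
    · simp [hQ]
    · refine Finset.prod_congr rfl fun i hi => ?_
      simp [Finset.ne_of_mem_erase hi, hP]
  have hgradc : Continuous (gradient g) :=
    (InnerProductSpace.toDual ℝ _).symm.continuous.comp (hgd.continuous_fderiv (by simp))
  have hgint : ∀ j ∈ Finset.univ, Integrable (fun y => (gradient g y j) ^ 2) := by
    intro j _
    refine Continuous.integrable_of_hasCompactSupport ?_ ?_
    · have hpc : Continuous (fun y : EuclideanSpace ℝ (Fin N) => y j) := (hcoord j).continuous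
      exact (hpc.comp hgradc).pow 2
    · refine hgc.mono' ?_
      intro y hy
      by_contra hn
      apply hy
      have : gradient g y = 0 := by
        rw [gradient, (notMem_tsupport_iff_eventuallyEq.mp hn).fderiv_eq]
        simp
      simp [this]
  have hnum : ∫ y, ‖gradient g y‖ ^ 2 = ∑ j, Q j * ∏ i ∈ Finset.univ.erase j, P i := by
    simp only [EuclideanSpace.real_norm_sq_eq]
    rw [integral_finsetSum _ hgint]
    exact Finset.sum_congr rfl fun j _ => hnum_j j
  refine ⟨g, hgd, hgc, hpos, ?_, ?_⟩
  · rw [hden]; positivity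
  · rw [hnum, hden, ← Finset.add_sum_erase _ _ (Finset.mem_univ i₀)]
    have hPtot : ∏ i, P i = P₀ * PP := by
      rw [← Finset.mul_prod_erase _ _ (Finset.mem_univ i₀)]
      simp [hP, h_i₀, hP₀, hPP]
    have hQ0 : Q i₀ ≤ (1 / 4 + ε / 2) * D := by
      simp only [hQ]; rw [h_i₀]; exact hηQ
    have hPn : ∀ i, 0 ≤ P i := fun i => integral_nonneg fun t => sq_nonneg _
    have hother : ∑ j ∈ Finset.univ.erase i₀, Q j * ∏ i ∈ Finset.univ.erase j, P i
        ≤ N * (ε' * (P₀ * PP)) := by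
      have : ∀ j ∈ Finset.univ.erase i₀, Q j * ∏ i ∈ Finset.univ.erase j, P i
          ≤ ε' * (P₀ * PP) := by
        intro j hj
        have hj' := Finset.ne_of_mem_erase hj
        have hQj : Q j ≤ ε' * P j := by
          simp only [hQ, hP]; rw [h_ne j hj']; exact hχQ
        rw [← hPtot, ← Finset.mul_prod_erase _ _ (Finset.mem_univ j), ← mul_assoc]
        exact mul_le_mul_of_nonneg_right hQj (Finset.prod_nonneg fun i _ => hPn i)
      refine (Finset.sum_le_card_nsmul _ _ _ this).trans ?_
      rw [nsmul_eq_mul]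
      have hc : ((Finset.univ.erase i₀).card : ℝ) ≤ N := by
        have := Finset.card_le_card (Finset.erase_subset i₀ Finset.univ)
        rw [Finset.card_univ, Fintype.card_fin] at this
        exact_mod_cast this
      exact mul_le_mul_of_nonneg_right hc (by positivity)
    have h1 : Q i₀ * PP ≤ (1 / 4 + ε / 2) * D * PP := mul_le_mul_of_nonneg_right hQ0 hPP0.le
    have h2 : N * ε' * P₀ * PP ≤ ε / 2 * D * PP := mul_le_mul_of_nonneg_right hε'D hPP0.le
    nlinarith

section upper
variable {E : Type*} [NormedAddCommGroup E] [InnerProductSpace ℝ E] [FiniteDimensional ℝ E]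

lemma neg_on_compact (φ : E → ℝ) (p : E) (hφ : DifferentiableAt ℝ φ p) (hp : φ p ≤ 0)
    (K : Set E) (hK : IsCompact K) (hL : ∀ y ∈ K, fderiv ℝ φ p y < 0) :
    ∃ r₀ : ℝ, 0 < r₀ ∧ ∀ r, 0 < r → r < r₀ → ∀ y ∈ K, φ (p + r • y) < 0 := by
  obtain ⟨m, hm, hmK⟩ := hK.exists_forall_le' (f := fun y => - fderiv ℝ φ p y)
    (by fun_prop) (a := 0) (fun y hy => by have := hL y hy; linarith)
  obtain ⟨M, hM0, hM⟩ := hK.isBounded.exists_pos_norm_le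
  have ho := hasFDerivAt_iff_isLittleO_nhds_zero.mp hφ.hasFDerivAt
  have hb := ho.bound (c := m / (2 * M)) (by positivity)
  obtain ⟨ρ, hρ, hρb⟩ := Metric.eventually_nhds_iff.mp hb
  refine ⟨ρ / (2 * M), by positivity, fun r hr hrr y hy => ?_⟩
  have h1 : ‖r • y‖ ≤ r * M := by
    rw [norm_smul, Real.norm_of_nonneg hr.le]
    exact mul_le_mul_of_nonneg_left (hM y hy) hr.le
  have h2 : r * M < ρ := by
    rw [lt_div_iff₀ (by positivity)] at hrr
    nlinarith
  have h3 := hρb (y := r • y) (by rw [dist_zero_right]; linarith)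
  have h4 : m / (2 * M) * ‖r • y‖ ≤ r * m / 2 := by
    calc m / (2 * M) * ‖r • y‖ ≤ m / (2 * M) * (r * M) :=
          mul_le_mul_of_nonneg_left h1 (by positivity)
      _ = r * m / 2 := by field_simp
  rw [Real.norm_eq_abs, map_smul, smul_eq_mul] at h3
  have h5 := (le_abs_self _).trans (h3.trans h4)
  have h6 := hmK y hy
  nlinarith

lemma touching_point (φ : E → ℝ) (hφ : Differentiable ℝ φ) (Ω : Set E) (hΩo : IsOpen Ω)
    (hΩ : Ω = {x | φ x < 0}) (hΩb : Bornology.IsBounded Ω) (h0 : (0 : E) ∈ Ω)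
    (hne : (frontier Ω).Nonempty) (hfr : ∀ x ∈ frontier Ω, fderiv ℝ φ x ≠ 0) :
    ∃ (e : E) (R : ℝ), ‖e‖ = 1 ∧ 0 < R ∧ R • e ∈ frontier Ω ∧ φ (R • e) ≤ 0 ∧
      (∀ x ∈ Ω, Metric.infDist x (frontier Ω) ≤ R - inner ℝ e x) ∧
      (∀ y, inner ℝ e y < 0 → fderiv ℝ φ (R • e) y < 0) := by
  have hcc : IsCompact (closure Ω) := hΩb.isCompact_closure
  obtain ⟨p, hpc, hpmax⟩ := hcc.exists_isMaxOn ⟨0, subset_closure h0⟩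
    (f := fun x => ‖x‖) (by fun_prop)
  have hmax : ∀ x ∈ closure Ω, ‖x‖ ≤ ‖p‖ := fun x hx => hpmax hx
  have hR : 0 < ‖p‖ := by
    rcases (norm_nonneg p).lt_or_eq with h | h
    · exact h
    · exfalso
      obtain ⟨q, hq⟩ := hne
      rw [hΩo.frontier_eq] at hq
      have h1 := hmax q hq.1
      have h2 : q = 0 := norm_le_zero_iff.mp (by rw [h]; exact h1)
      exact hq.2 (h2 ▸ h0)
  set R := ‖p‖ with hRdef
  have hlt : ∀ x ∈ Ω, ‖x‖ < R := by
    have : Ω ⊆ interior (Metric.closedBall (0:E) R) :=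
      interior_maximal (fun x hx => by simpa using hmax x (subset_closure hx)) hΩo
    rw [interior_closedBall _ hR.ne'] at this
    intro x hx
    simpa using this hx
  have hpΩ : p ∉ Ω := fun h => lt_irrefl _ (hlt p h)
  have hpf : p ∈ frontier Ω := by rw [hΩo.frontier_eq]; exact ⟨hpc, hpΩ⟩
  have hp0 : φ p ≤ 0 := by
    have hcl : IsClosed {x | φ x ≤ 0} := isClosed_le hφ.continuous continuous_const
    have hs : Ω ⊆ {x | φ x ≤ 0} := by
      rw [hΩ]; intro x hx
      have hx' : φ x < 0 := hx
      exact hx'.le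
    have := closure_minimal hs hcl hpc
    exact this
  have hnot : ∀ z, R ≤ ‖z‖ → z ∉ Ω := fun z hz h => absurd (hlt z h) (not_lt.mpr hz)
  have hLnn : ∀ y, 0 < inner ℝ p y → 0 ≤ fderiv ℝ φ p y := by
    intro y hy
    by_contra hneg
    push Not at hneg
    obtain ⟨r₀, hr₀, h⟩ := neg_on_compact φ p (hφ p) hp0 {y} isCompact_singleton
      (by intro z hz; rw [Set.mem_singleton_iff.mp hz]; exact hneg)
    have h1 := h (r₀ / 2) (by positivity) (by linarith) y rfl
    refine hnot (p + (r₀ / 2) • y) ?_ (by rw [hΩ]; exact h1)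
    have : R ^ 2 ≤ ‖p + (r₀ / 2) • y‖ ^ 2 := by
      rw [norm_add_sq_real, inner_smul_right]
      have : 0 < r₀ / 2 * inner ℝ p y := by positivity
      nlinarith [sq_nonneg ‖(r₀ / 2) • y‖]
    exact le_of_sq_le_sq this (norm_nonneg _)
  have hpp : inner ℝ p p = R ^ 2 := real_inner_self_eq_norm_sq p
  have hperp1 : ∀ v, inner ℝ p v = 0 → 0 ≤ fderiv ℝ φ p v := by
    intro v hv
    refine le_of_forall_pos_le_add fun t ht => ?_
    set a := fderiv ℝ φ p p with ha
    have ha0 : 0 ≤ a := hLnn p (by rw [hpp]; positivity)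
    have h1 := hLnn (v + (t / (a + 1)) • p) (by
      rw [inner_add_right, hv, inner_smul_right, hpp]; positivity)
    rw [map_add, map_smul, smul_eq_mul, ← ha] at h1
    have : t / (a + 1) * a ≤ t := by
      rw [div_mul_eq_mul_div, div_le_iff₀ (by positivity)]; nlinarith
    linarith
  have hperp : ∀ v, inner ℝ p v = 0 → fderiv ℝ φ p v = 0 := by
    intro v hv
    have h1 := hperp1 v hv
    have h2 := hperp1 (-v) (by rw [inner_neg_right, hv, neg_zero])
    rw [map_neg] at h2
    linarith
  have hform : ∀ y, fderiv ℝ φ p y = inner ℝ p y / R ^ 2 * fderiv ℝ φ p p := by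
    intro y
    have h1 := hperp (y - (inner ℝ p y / R ^ 2) • p) (by
      rw [inner_sub_right, inner_smul_right, hpp]; field_simp; ring)
    rw [map_sub, map_smul, smul_eq_mul] at h1
    linarith
  have hLp : 0 < fderiv ℝ φ p p := by
    rcases (hLnn p (by rw [hpp]; positivity)).lt_or_eq with h | h
    · exact h
    · exfalso
      apply hfr p hpf
      ext y
      rw [hform y, ← h]; simp
  have hRe : R • (R⁻¹ • p) = p := by rw [smul_smul, mul_inv_cancel₀ hR.ne', one_smul]
  have hen : ‖R⁻¹ • p‖ = 1 := by
    rw [norm_smul, Real.norm_of_nonneg (by positivity), ← hRdef, inv_mul_cancel₀ hR.ne']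
  refine ⟨R⁻¹ • p, R, hen, hR, by rwa [hRe], by rwa [hRe], ?_, ?_⟩
  · intro x hx
    set e := R⁻¹ • p with he
    have hee : inner ℝ e e = (1:ℝ) := by rw [real_inner_self_eq_norm_sq, hen]; norm_num
    have hxe : inner ℝ e x < R := by
      have := real_inner_le_norm e x
      rw [hen, one_mul] at this
      exact this.trans_lt (hlt x hx)
    have hz : x + (R - inner ℝ e x) • e ∉ Ω := by
      apply hnot
      have h1 := real_inner_le_norm e (x + (R - inner ℝ e x) • e)
      rw [inner_add_right, inner_smul_right, hee, hen] at h1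
      linarith
    have := infDist_frontier_le hx hz
    rw [dist_eq_norm, sub_add_cancel_left, norm_neg, norm_smul, hen, mul_one,
      Real.norm_of_nonneg (by linarith)] at this
    exact this
  · intro y hy
    rw [hRe, hform y]
    rw [real_inner_smul_left] at hy
    have : inner ℝ p y < 0 := by
      by_contra hc
      push Not at hc
      have : 0 ≤ R⁻¹ * inner ℝ p y := by positivity
      linarith
    exact mul_neg_of_neg_of_pos (div_neg_of_neg_of_pos this (by positivity)) hLp

end upper
lemma int_change {N : ℕ} (b : OrthonormalBasis (Fin N) ℝ (EuclideanSpace ℝ (Fin N)))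
    (p : EuclideanSpace ℝ (Fin N)) (r : ℝ) (hr : 0 < r) (F : EuclideanSpace ℝ (Fin N) → ℝ) :
    ∫ x, F (b.repr (r⁻¹ • (x - p))) = r ^ N * ∫ y, F y := by
  rw [integral_sub_right_eq_self (fun x => F (b.repr (r⁻¹ • x))) p,
    Measure.integral_comp_inv_smul_of_nonneg volume (fun x => F (b.repr x)) hr.le,
    b.repr.measurePreserving.integral_comp b.repr.toHomeomorph.measurableEmbedding F]
  simp

lemma norm_gradient_eq {N : ℕ} (f : EuclideanSpace ℝ (Fin N) → ℝ) (x) :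
    ‖gradient f x‖ = ‖fderiv ℝ f x‖ := by
  rw [gradient, LinearIsometryEquiv.norm_map]

lemma grad_change {N : ℕ} (b : OrthonormalBasis (Fin N) ℝ (EuclideanSpace ℝ (Fin N)))
    (p : EuclideanSpace ℝ (Fin N)) (r : ℝ) (hr : 0 < r) (g : EuclideanSpace ℝ (Fin N) → ℝ)
    (hg : Differentiable ℝ g) (x : EuclideanSpace ℝ (Fin N)) :
    ‖gradient (fun x => g (b.repr (r⁻¹ • (x - p)))) x‖
      = r⁻¹ * ‖gradient g (b.repr (r⁻¹ • (x - p)))‖ := by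
  rw [norm_gradient_eq, norm_gradient_eq]
  set y := b.repr (r⁻¹ • (x - p)) with hy
  have h1 : HasFDerivAt (fun x => b.repr (r⁻¹ • (x - p)))
      (r⁻¹ • (b.repr.toContinuousLinearEquiv : EuclideanSpace ℝ (Fin N) →L[ℝ] EuclideanSpace ℝ (Fin N))) x := by
    have h2 : HasFDerivAt (fun x => r⁻¹ • (x - p)) (r⁻¹ • ContinuousLinearMap.id ℝ _) x :=
      ((hasFDerivAt_id x).sub_const p).const_smul r⁻¹
    have h3 := (b.repr.toContinuousLinearEquiv :
      EuclideanSpace ℝ (Fin N) →L[ℝ] EuclideanSpace ℝ (Fin N)).hasFDerivAt.comp x h2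
    refine h3.congr_fderiv ?_
    ext v i
    simp
  have h2 := ((hg y).hasFDerivAt.comp x h1).fderiv
  have h3 : fderiv ℝ (fun x => g (b.repr (r⁻¹ • (x - p)))) x = _ := h2
  rw [h3, ContinuousLinearMap.comp_smul, norm_smul, Real.norm_of_nonneg (by positivity)]
  congr 1
  exact ContinuousLinearMap.opNorm_comp_linearIsometryEquiv _ b.repr

lemma exists_basis {N : ℕ} (i₀ : Fin N) (e : EuclideanSpace ℝ (Fin N)) (he : ‖e‖ = 1) :
    ∃ b : OrthonormalBasis (Fin N) ℝ (EuclideanSpace ℝ (Fin N)),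
      ∀ y, (b.repr y) i₀ = - inner ℝ e y := by
  have ho : Orthonormal ℝ (({i₀} : Set (Fin N)).domRestrict (fun _ => -e)) := by
    constructor
    · intro i; simp [he]
    · intro i j hij
      exact absurd (Subsingleton.elim i j) hij
  obtain ⟨b, hb⟩ := ho.exists_orthonormalBasis_extension_of_card_eq (by simp)
  refine ⟨b, fun y => ?_⟩
  rw [OrthonormalBasis.repr_apply_apply, hb i₀ rfl, inner_neg_left]
set_option maxHeartbeats 1000000 in
lemma upper_bound (N : ℕ) (hN : 3 ≤ N)
    (Ω : Set (EuclideanSpace ℝ (Fin N))) (hΩo : IsOpen Ω)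
    (hΩb : Bornology.IsBounded Ω) (hΩsm : IsC2Domain Ω)
    (h0 : (0 : EuclideanSpace ℝ (Fin N)) ∈ Ω) (δ : ℝ) (hδ : 0 < δ) (τ : ℝ) (hτ : 0 < τ)
    (hτ2 : τ < 1 / 2) :
    ∃ f : EuclideanSpace ℝ (Fin N) → ℝ,
          ContDiff ℝ (⊤ : ℕ∞) f ∧ HasCompactSupport f ∧
          tsupport f ⊆ interior {x | x ∈ Ω ∧ bdist Ω x ≤ δ} ∧ f ≠ 0 ∧
          (∫ x in {x | x ∈ Ω ∧ bdist Ω x ≤ δ},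
                ‖x‖ ^ (2 - (N : ℝ)) * ‖gradient f x‖ ^ 2) /
              (∫ x in {x | x ∈ Ω ∧ bdist Ω x ≤ δ},
                ‖x‖ ^ (2 - (N : ℝ)) * (f x ^ 2 / bdist Ω x ^ 2)) ≤ 1 / 4 + 4 * τ := by
  obtain ⟨φ, hφ, hΩφ, hfr⟩ := hΩsm
  obtain ⟨hne, -⟩ := bounded_frontier hN Ω hΩb h0
  obtain ⟨e, R, he, hR, hpf, hp0, hdR, hL⟩ := touching_point φ (hφ.differentiable (by norm_num))
    Ω hΩo hΩφ hΩb h0 hne hfr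
  set p := R • e with hp
  have hpn : ‖p‖ = R := by rw [hp, norm_smul, he, mul_one, Real.norm_of_nonneg hR.le]
  have hp_ne : p ≠ 0 := by rw [← norm_pos_iff, hpn]; exact hR
  set i₀ : Fin N := ⟨0, by omega⟩
  obtain ⟨b, hb⟩ := exists_basis i₀ e he
  obtain ⟨g, hg, hgc, hgs, hgD, hgQ⟩ := hardy_halfspace i₀ τ hτ
  set w : EuclideanSpace ℝ (Fin N) → ℝ := fun x => ‖x‖ ^ (2 - (N:ℝ)) with hw
  have hwp : 0 < w p := weight_pos p hp_ne
  have hwc : ∀ x, x ≠ 0 → ContinuousAt w x := fun x hx => (weight_contDiffAt x hx).continuousAt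
  obtain ⟨ρ, hρ, hρw⟩ := Metric.continuousAt_iff.mp (hwc p hp_ne) (τ * w p) (by positivity)
  set K : Set (EuclideanSpace ℝ (Fin N)) := b.repr ⁻¹' tsupport g with hK
  have hKc : IsCompact K := by
    exact b.repr.toHomeomorph.isCompact_preimage.mpr hgc.isCompact
  obtain ⟨r₀, hr₀, hneg⟩ := neg_on_compact φ p (hφ.differentiable (by norm_num) p) hp0 K hKc
    (fun y hy => hL y (by
      have := hgs _ hy
      rw [hb] at this; linarith))
  obtain ⟨M, hM, hMK⟩ := hKc.isBounded.exists_pos_norm_le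
  set m := min (min δ ρ) R with hm
  have hm0 : 0 < m := lt_min (lt_min hδ hρ) hR
  set r := min (r₀ / 2) (m / (2 * M)) with hrdef
  have hr : 0 < r := lt_min (by positivity) (by positivity)
  have hr1 : r < r₀ := (min_le_left _ _).trans_lt (by linarith)
  have hr2 : r * M < m := by
    have : r ≤ m / (2 * M) := min_le_right _ _
    rw [le_div_iff₀ (by positivity)] at this
    nlinarith
  set A : EuclideanSpace ℝ (Fin N) → EuclideanSpace ℝ (Fin N) :=
    fun x => b.repr (r⁻¹ • (x - p)) with hA
  have hAc : Continuous A := by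
    simp only [hA]
    exact b.repr.continuous.comp (by fun_prop)
  have hAs : ContDiff ℝ (⊤ : ℕ∞) A := by
    simp only [hA]
    exact b.repr.contDiff.comp (by fun_prop)
  set f : EuclideanSpace ℝ (Fin N) → ℝ := fun x => g (A x) with hf
  have hfs : ContDiff ℝ (⊤ : ℕ∞) f := hg.comp hAs
  have hfts : ∀ x ∈ tsupport f, A x ∈ tsupport g := fun x hx =>
    tsupport_comp_subset_preimage g hAc hx
  have hxy : ∀ x, x = p + r • (r⁻¹ • (x - p)) := by
    intro x; rw [smul_smul, mul_inv_cancel₀ hr.ne', one_smul, add_sub_cancel]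
  -- facts on the support
  have hsΩ : ∀ x ∈ tsupport f, x ∈ Ω := by
    intro x hx
    have := hneg r hr hr1 (r⁻¹ • (x - p)) (hfts x hx)
    rw [← hxy] at this
    rw [hΩφ]; exact this
  have hsm : ∀ x ∈ tsupport f, dist x p < m := by
    intro x hx
    have h1 := hMK (r⁻¹ • (x - p)) (hfts x hx)
    rw [norm_smul, Real.norm_of_nonneg (by positivity), inv_mul_le_iff₀ hr] at h1
    rw [dist_eq_norm]; linarith
  set V : Set (EuclideanSpace ℝ (Fin N)) := Ω ∩ Metric.ball p m with hV
  have hVo : IsOpen V := hΩo.inter Metric.isOpen_ball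
  have hfV : tsupport f ⊆ V := fun x hx => ⟨hsΩ x hx, hsm x hx⟩
  have hmδ : m ≤ δ := (min_le_left _ _).trans (min_le_left _ _)
  have hmρ : m ≤ ρ := (min_le_left _ _).trans (min_le_right _ _)
  have hmR : m ≤ R := min_le_right _ _
  have hVS : V ⊆ interior {x | x ∈ Ω ∧ bdist Ω x ≤ δ} := by
    refine interior_maximal ?_ hVo
    intro x hx
    have h1 : bdist Ω x ≤ dist x p := Metric.infDist_le_dist_of_mem hpf
    have h2 : dist x p < m := hx.2
    have h3 : bdist Ω x ≤ δ := by linarith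
    exact ⟨hx.1, h3⟩
  have hV0 : ∀ x ∈ V, x ≠ 0 := by
    rintro x hx rfl
    have h2 : dist (0 : EuclideanSpace ℝ (Fin N)) p < m := hx.2
    rw [dist_zero_left, hpn] at h2
    linarith
  have hVw : ∀ x ∈ V, (1 - τ) * w p ≤ w x ∧ w x ≤ (1 + τ) * w p := by
    intro x hx
    have h2 : dist x p < m := hx.2
    have h3 := hρw (h2.trans_le hmρ)
    rw [Real.dist_eq, abs_lt] at h3
    constructor <;> linarith [h3.1, h3.2]
  have hVd : ∀ x ∈ V, 0 < bdist Ω x := by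
    intro x hx
    have hx1 : x ∉ frontier Ω := by
      rw [hΩo.frontier_eq]; exact fun h => h.2 hx.1
    exact (isClosed_frontier.notMem_iff_infDist_pos hne).mp hx1
  have hAi : ∀ x, R - inner ℝ e x = r * (A x) i₀ := by
    intro x
    simp only [hA]
    rw [hb, inner_smul_right, inner_sub_right, hp, inner_smul_right,
      real_inner_self_eq_norm_sq, he]
    field_simp
    ring
  have hVdA : ∀ x ∈ V, bdist Ω x ≤ r * (A x) i₀ := by
    intro x hx
    rw [← hAi]; exact hdR x hx.1
  have hfc : HasCompactSupport f := by
    refine HasCompactSupport.of_support_subset_isCompact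
      (hΩb.isCompact_closure) (fun x hx => subset_closure (hsΩ x (subset_tsupport _ hx)))
  have hf_ne : f ≠ 0 := by
    intro hf0
    have hg0 : g = 0 := by
      ext y
      have h1 : f (p + r • b.repr.symm y) = 0 := by rw [hf0]; rfl
      simp only [hf, hA] at h1
      rw [add_sub_cancel_left, smul_smul, inv_mul_cancel₀ hr.ne', one_smul,
        LinearIsometryEquiv.apply_symm_apply] at h1
      exact h1
    rw [hg0] at hgD
    simp at hgD
  refine ⟨f, hfs, hfc, hfV.trans hVS, hf_ne, ?_⟩
  obtain ⟨e1, e2⟩ := setIntegral_eq_of_tsupport f _ (hfV.trans hVS) w (bdist Ω)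
  rw [e1, e2]
  have hwV : ContinuousOn w V := fun x hx => (hwc x (hV0 x hx)).continuousWithinAt
  have hdc : Continuous (bdist Ω) := Metric.continuous_infDist_pt _
  have hden0 : 0 < ∫ x, w x * (f x ^ 2 / bdist Ω x ^ 2) :=
    denom_pos volume w (bdist Ω) f V hVo hwV (fun x hx => weight_pos x (hV0 x hx)) hdc hVd
      hfs.continuous hfc hfV hf_ne
  rw [div_le_iff₀ hden0]
  set I1 := ∫ y, ‖gradient g y‖ ^ 2 with hI1
  set I2 := ∫ y, g y ^ 2 / (y i₀) ^ 2 with hI2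
  have hgrad0 : ∀ x, x ∉ tsupport f → gradient f x = 0 := by
    intro x hx
    rw [gradient, (notMem_tsupport_iff_eventuallyEq.mp hx).fderiv_eq]
    simp
  have hf0 : ∀ x, x ∉ tsupport f → f x = 0 := fun x hx => image_eq_zero_of_notMem_tsupport hx
  have hgradc : Continuous (gradient f) :=
    (InnerProductSpace.toDual ℝ _).symm.continuous.comp (hfs.continuous_fderiv (by simp))
  have hgi : Integrable (fun x => ‖gradient f x‖ ^ 2) := by
    refine Continuous.integrable_of_hasCompactSupport (hgradc.norm.pow 2) ?_
    refine hfc.mono' ?_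
    intro x hx
    by_contra hn
    apply hx
    simp [hgrad0 x hn]
  have hnum : ∫ x, w x * ‖gradient f x‖ ^ 2 ≤ (1 + τ) * w p * (r⁻¹ ^ 2 * (r ^ N * I1)) := by
    have h1 : ∫ x, ‖gradient f x‖ ^ 2 = r⁻¹ ^ 2 * (r ^ N * I1) := by
      rw [hI1, ← int_change b p r hr (fun y => ‖gradient g y‖ ^ 2), ← integral_const_mul]
      refine integral_congr_ae (Filter.Eventually.of_forall fun x => ?_)
      have := grad_change b p r hr g (hg.differentiable (by simp)) x
      simp only
      rw [← mul_pow, ← this]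
    rw [← h1, ← integral_const_mul]
    refine integral_mono_of_nonneg (Filter.Eventually.of_forall fun x => ?_)
      (hgi.const_mul _) (Filter.Eventually.of_forall fun x => ?_)
    · exact mul_nonneg (Real.rpow_nonneg (norm_nonneg _) _) (sq_nonneg _)
    · by_cases hx : x ∈ tsupport f
      · exact mul_le_mul_of_nonneg_right (hVw x (hfV hx)).2 (sq_nonneg _)
      · simp [hgrad0 x hx]
  have hdi : Integrable (fun x => w x * (f x ^ 2 / bdist Ω x ^ 2)) := by
    by_contra hn
    rw [integral_undef hn] at hden0
    exact lt_irrefl _ hden0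
  have hden : (1 - τ) * w p * (r⁻¹ ^ 2 * (r ^ N * I2)) ≤ ∫ x, w x * (f x ^ 2 / bdist Ω x ^ 2) := by
    rw [hI2, ← int_change b p r hr (fun y => g y ^ 2 / (y i₀) ^ 2), ← integral_const_mul,
      ← integral_const_mul]
    have h1τ : 0 < (1 - τ) * w p := mul_pos (by linarith) hwp
    refine integral_mono_of_nonneg (Filter.Eventually.of_forall fun x => ?_)
      hdi (Filter.Eventually.of_forall fun x => ?_)
    · show (0:ℝ) ≤ (1 - τ) * w p * (r⁻¹ ^ 2 * (g (A x) ^ 2 / (A x) i₀ ^ 2))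
      positivity
    · show (1 - τ) * w p * (r⁻¹ ^ 2 * (f x ^ 2 / (A x) i₀ ^ 2)) ≤ w x * (f x ^ 2 / bdist Ω x ^ 2)
      by_cases hx : x ∈ tsupport f
      · have hxV := hfV hx
        have hd0 := hVd x hxV
        have hdA := hVdA x hxV
        have h2 : r⁻¹ ^ 2 * (f x ^ 2 / (A x) i₀ ^ 2) = f x ^ 2 / (r * (A x) i₀) ^ 2 := by
          rw [mul_pow, inv_pow, ← div_eq_inv_mul, div_div, mul_comm]
        rw [h2]
        have h3 : f x ^ 2 / (r * (A x) i₀) ^ 2 ≤ f x ^ 2 / bdist Ω x ^ 2 :=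
          div_le_div_of_nonneg_left (sq_nonneg _) (by positivity)
            (pow_le_pow_left₀ hd0.le hdA 2)
        exact mul_le_mul (hVw x hxV).1 h3 (by positivity) (weight_pos x (hV0 x hxV)).le
      · simp [hf0 x hx]
  have hc : 0 < w p * (r⁻¹ ^ 2 * r ^ N) := by positivity
  calc ∫ x, w x * ‖gradient f x‖ ^ 2 ≤ (1 + τ) * w p * (r⁻¹ ^ 2 * (r ^ N * I1)) := hnum
    _ = (1 + τ) * (w p * (r⁻¹ ^ 2 * r ^ N)) * I1 := by ring
    _ ≤ (1 + τ) * (w p * (r⁻¹ ^ 2 * r ^ N)) * ((1 / 4 + τ) * I2) :=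
        mul_le_mul_of_nonneg_left hgQ (by positivity)
    _ = ((1 + τ) * (1 / 4 + τ)) * (w p * (r⁻¹ ^ 2 * r ^ N) * I2) := by ring
    _ ≤ ((1 / 4 + 4 * τ) * (1 - τ)) * (w p * (r⁻¹ ^ 2 * r ^ N) * I2) :=
        mul_le_mul_of_nonneg_right (by nlinarith) (by positivity)
    _ = (1 / 4 + 4 * τ) * ((1 - τ) * w p * (r⁻¹ ^ 2 * (r ^ N * I2))) := by ring
    _ ≤ _ := mul_le_mul_of_nonneg_left hden (by positivity)

/-- On sufficiently thin boundary strips `Ω_δ`, the infimum of the weighted Hardy quotient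
with weight `|x|^{2-N}` equals `1/4`. -/
theorem hardy_quotient_boundary_strip
    (N : ℕ) (hN : 3 ≤ N)
    (Ω : Set (EuclideanSpace ℝ (Fin N))) (hΩo : IsOpen Ω) (hΩconn : IsConnected Ω)
    (hΩb : Bornology.IsBounded Ω) (hΩsm : IsC2Domain Ω)
    (h0 : (0 : EuclideanSpace ℝ (Fin N)) ∈ Ω) :
    ∃ δ₀ : ℝ, 0 < δ₀ ∧ ∀ δ : ℝ, 0 < δ → δ ≤ δ₀ →
      sInf {q : ℝ | ∃ f : EuclideanSpace ℝ (Fin N) → ℝ,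
          ContDiff ℝ (⊤ : ℕ∞) f ∧ HasCompactSupport f ∧
          tsupport f ⊆ interior {x | x ∈ Ω ∧ bdist Ω x ≤ δ} ∧ f ≠ 0 ∧
          q = (∫ x in {x | x ∈ Ω ∧ bdist Ω x ≤ δ},
                ‖x‖ ^ (2 - (N : ℝ)) * ‖gradient f x‖ ^ 2) /
              (∫ x in {x | x ∈ Ω ∧ bdist Ω x ≤ δ},
                ‖x‖ ^ (2 - (N : ℝ)) * (f x ^ 2 / bdist Ω x ^ 2))} = 1 / 4 := by
  obtain ⟨δ₀, hδ₀, hlow⟩ := lower_bound N hN Ω hΩo hΩb hΩsm h0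
  refine ⟨δ₀, hδ₀, fun δ hδ hδδ => ?_⟩
  have hlb : ∀ q ∈ {q : ℝ | ∃ f : EuclideanSpace ℝ (Fin N) → ℝ,
          ContDiff ℝ (⊤ : ℕ∞) f ∧ HasCompactSupport f ∧
          tsupport f ⊆ interior {x | x ∈ Ω ∧ bdist Ω x ≤ δ} ∧ f ≠ 0 ∧
          q = (∫ x in {x | x ∈ Ω ∧ bdist Ω x ≤ δ},
                ‖x‖ ^ (2 - (N : ℝ)) * ‖gradient f x‖ ^ 2) /
              (∫ x in {x | x ∈ Ω ∧ bdist Ω x ≤ δ},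
                ‖x‖ ^ (2 - (N : ℝ)) * (f x ^ 2 / bdist Ω x ^ 2))}, (1 / 4 : ℝ) ≤ q := by
    rintro q ⟨f, h1, h2, h3, h4, rfl⟩
    exact hlow δ hδ hδδ f h1 h2 h3 h4
  apply le_antisymm
  · refine le_of_forall_pos_le_add fun ε hε => ?_
    obtain ⟨f, h1, h2, h3, h4, h5⟩ := upper_bound N hN Ω hΩo hΩb hΩsm h0 δ hδ
      (min (1 / 4) (ε / 4)) (lt_min (by norm_num) (by positivity))
      ((min_le_left _ _).trans_lt (by norm_num))
    have h6 : min (1 / 4) (ε / 4) ≤ ε / 4 := min_le_right _ _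
    refine (csInf_le ⟨1 / 4, hlb⟩ ⟨f, h1, h2, h3, h4, rfl⟩).trans (h5.trans ?_)
    linarith
  · obtain ⟨f, h1, h2, h3, h4, -⟩ := upper_bound N hN Ω hΩo hΩb hΩsm h0 δ hδ
      (1 / 4) (by norm_num) (by norm_num)
    exact le_csInf ⟨_, f, h1, h2, h3, h4, rfl⟩ hlb
end
end

section
/- Let N ≥ 3 and let Ω ⊂ ℝ^N be a bounded domain containing the origin (not necessarily smooth) for which there exists a constant C > 0 with ∫_Ω |∇u|² dx ≥ C ∫_Ω u²/d(x)² dx for all u ∈ C₀^∞(Ω). Then there exists a constant C̃ > 0 such that for every u ∈ C₀^∞(Ω), ∫_Ω ( |∇u(x)|² − ((N−2)²/(4|x|²)) · u(x)² ) dx ≥ C̃ · ∫_Ω u(x)²/d(x)² dx. -/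
open MeasureTheory Real

noncomputable section

/-- Compactly supported continuous over the squared norm is integrable in dimension at least 3. -/
lemma integrable_div_norm_sq {N : ℕ} (hN : 3 ≤ N) {g : EuclideanSpace ℝ (Fin N) → ℝ}
    (hg : Continuous g) (hgc : HasCompactSupport g) :
    Integrable (fun x => g x / ‖x‖ ^ 2) := by
  have h1 : LocallyIntegrable (fun x : EuclideanSpace ℝ (Fin N) => (‖x‖ ^ 2)⁻¹) := by
    refine locallyIntegrable_of_norm_le_rpow (α := 2) (C := 1) ?_ ?_ ?_ ?_
    · simp; omega
    · simp; exact_mod_cast hN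
    · refine Filter.Eventually.of_forall fun x => ?_
      rw [Real.rpow_neg (norm_nonneg _)]
      simp
    · have : Measurable (fun x : EuclideanSpace ℝ (Fin N) => (‖x‖ ^ 2)⁻¹) := by fun_prop
      exact this.aestronglyMeasurable
  have h2 := h1.integrable_smul_left_of_hasCompactSupport hg hgc
  simpa [div_eq_mul_inv] using h2

/-- Euler field integration by parts. -/
lemma integral_fderiv_self {N : ℕ} {v : EuclideanSpace ℝ (Fin N) → ℝ}
    (hv : ContDiff ℝ 1 v) (hvc : HasCompactSupport v) :
    ∫ x, fderiv ℝ v x x = - (N : ℝ) * ∫ x, v x := by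
  have hd : Continuous (fderiv ℝ v) := hv.continuous_fderiv (by norm_num)
  have hdc : HasCompactSupport (fderiv ℝ v) := hvc.fderiv ℝ
  have key : ∀ i : Fin N, Integrable (fun x : EuclideanSpace ℝ (Fin N) =>
        x i * fderiv ℝ v x (EuclideanSpace.single i 1)) ∧
      ∫ x : EuclideanSpace ℝ (Fin N), x i * fderiv ℝ v x (EuclideanSpace.single i 1)
        = - ∫ x, v x := by
    intro i
    have hfd : ∀ x : EuclideanSpace ℝ (Fin N),
        fderiv ℝ (fun y : EuclideanSpace ℝ (Fin N) => y i) x (EuclideanSpace.single i 1) = 1 := by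
      intro x
      have : HasFDerivAt (fun y : EuclideanSpace ℝ (Fin N) => y i)
          (EuclideanSpace.proj i : EuclideanSpace ℝ (Fin N) →L[ℝ] ℝ) x :=
        (EuclideanSpace.proj i : EuclideanSpace ℝ (Fin N) →L[ℝ] ℝ).hasFDerivAt
      rw [this.fderiv]
      simp
    have hint : Integrable (fun x : EuclideanSpace ℝ (Fin N) =>
        x i * fderiv ℝ v x (EuclideanSpace.single i 1)) := by
      refine Continuous.integrable_of_hasCompactSupport (by fun_prop) ?_
      exact (hvc.fderiv_apply ℝ _).mul_left
    refine ⟨hint, ?_⟩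
    rw [integral_mul_fderiv_eq_neg_fderiv_mul_of_integrable]
    · simp [hfd]
    · simp only [hfd, one_mul]
      exact hv.continuous.integrable_of_hasCompactSupport hvc
    · exact hint
    · exact Continuous.integrable_of_hasCompactSupport
        (by have := hv.continuous; fun_prop) hvc.mul_left
    · intro x _; fun_prop
    · intro x _; exact (hv.differentiable (by norm_num)).differentiableAt
  have hsum : ∀ x : EuclideanSpace ℝ (Fin N), fderiv ℝ v x x =
      ∑ i, x i * fderiv ℝ v x (EuclideanSpace.single i 1) := by
    intro x
    have h : ∀ A : EuclideanSpace ℝ (Fin N) →L[ℝ] ℝ,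
        A x = ∑ i, x i * A (EuclideanSpace.single i 1) := by
      intro A
      conv_lhs => rw [← (EuclideanSpace.basisFun (Fin N) ℝ).sum_repr x]
      simp [map_sum]
    exact h _
  simp_rw [hsum]
  rw [integral_finsetSum _ fun i _ => (key i).1]
  simp [fun i => (key i).2]

lemma hasCompactSupport_fderiv_self {N : ℕ} {v : EuclideanSpace ℝ (Fin N) → ℝ}
    (hvc : HasCompactSupport v) : HasCompactSupport (fun x => fderiv ℝ v x x) := by
  refine (hvc.fderiv ℝ).mono ?_
  intro x hx h
  apply hx
  simp only [h]
  rfl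

/-- Integration by parts against `x / ‖x‖ ^ 2`. -/
lemma integral_fderiv_self_div {N : ℕ} (hN : 3 ≤ N) {w : EuclideanSpace ℝ (Fin N) → ℝ}
    (hw : ContDiff ℝ 1 w) (hwc : HasCompactSupport w) :
    ∫ x, fderiv ℝ w x x / ‖x‖ ^ 2 = - ((N : ℝ) - 2) * ∫ x, w x / ‖x‖ ^ 2 := by
  have hd : Continuous (fderiv ℝ w) := hw.continuous_fderiv (by norm_num)
  have hdc : Continuous (fun x => fderiv ℝ w x x) := by fun_prop
  have hds := hasCompactSupport_fderiv_self hwc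
  have hcw := hw.continuous
  have i1 := integrable_div_norm_sq hN hdc hds
  have i2 := integrable_div_norm_sq hN hw.continuous hwc
  -- regularised identity
  have reg : ∀ n : ℕ, ∫ x, (fderiv ℝ w x x / (‖x‖ ^ 2 + 1 / ((n : ℝ) + 1)) +
      w x * (N / (‖x‖ ^ 2 + 1 / ((n : ℝ) + 1)) -
        2 * ‖x‖ ^ 2 / (‖x‖ ^ 2 + 1 / ((n : ℝ) + 1)) ^ 2)) = 0 := by
    intro n
    set e : ℝ := 1 / ((n : ℝ) + 1) with he
    have hepos : 0 < e := by positivity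
    have hpos : ∀ x : EuclideanSpace ℝ (Fin N), ‖x‖ ^ 2 + e ≠ 0 := fun x => by positivity
    set v : EuclideanSpace ℝ (Fin N) → ℝ := fun x => w x * (‖x‖ ^ 2 + e)⁻¹ with hvdef
    have hv : ContDiff ℝ 1 v := by
      refine hw.mul (ContDiff.inv ?_ hpos)
      exact (contDiff_norm_sq ℝ).add contDiff_const
    have hvc : HasCompactSupport v := hwc.mul_right
    have hfd : ∀ x, fderiv ℝ v x x = fderiv ℝ w x x / (‖x‖ ^ 2 + e) -
        w x * (2 * ‖x‖ ^ 2 / (‖x‖ ^ 2 + e) ^ 2) := by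
      intro x
      have hwx : HasFDerivAt w (fderiv ℝ w x) x :=
        (hw.differentiable (by norm_num)).differentiableAt.hasFDerivAt
      have hn : HasFDerivAt (fun y : EuclideanSpace ℝ (Fin N) => ‖y‖ ^ 2 + e)
          (2 • (innerSL ℝ x)) x := (hasStrictFDerivAt_norm_sq x).hasFDerivAt.add_const e
      have hi := (hasDerivAt_inv (hpos x)).comp_hasFDerivAt x hn
      have hm := hwx.mul hi
      have : fderiv ℝ v x = _ := hm.fderiv
      rw [this]
      simp
      have := hpos x
      field_simp
      ring
    have h1 := integral_fderiv_self hv hvc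
    have hvi : Integrable v := hv.continuous.integrable_of_hasCompactSupport hvc
    have hdi : Integrable (fun x => fderiv ℝ v x x) := by
      refine Continuous.integrable_of_hasCompactSupport ?_ (hasCompactSupport_fderiv_self hvc)
      have : Continuous (fderiv ℝ v) := hv.continuous_fderiv (by norm_num)
      fun_prop
    have h2 : ∫ x, (fderiv ℝ v x x + N * v x) = 0 := by
      rw [integral_add hdi (hvi.const_mul _), integral_const_mul, h1]; ring
    rw [← h2]
    congr 1
    ext x
    rw [hfd]
    simp only [hvdef]
    ring
  have lim : Filter.Tendsto (fun n : ℕ => ∫ x, (fderiv ℝ w x x / (‖x‖ ^ 2 + 1 / ((n : ℝ) + 1)) +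
      w x * (N / (‖x‖ ^ 2 + 1 / ((n : ℝ) + 1)) -
        2 * ‖x‖ ^ 2 / (‖x‖ ^ 2 + 1 / ((n : ℝ) + 1)) ^ 2))) Filter.atTop
      (nhds (∫ x, (fderiv ℝ w x x / ‖x‖ ^ 2 + ((N : ℝ) - 2) * (w x / ‖x‖ ^ 2)))) := by
    refine tendsto_integral_of_dominated_convergence
      (fun x => ‖fderiv ℝ w x x / ‖x‖ ^ 2‖ + (N + 2) * ‖w x / ‖x‖ ^ 2‖) ?_ ?_ ?_ ?_
    · intro n
      refine Measurable.aestronglyMeasurable ?_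
      have := hdc.measurable
      have := hcw.measurable
      fun_prop
    · exact i1.norm.add (i2.norm.const_mul _)
    · intro n
      have hne : ∀ᵐ x : EuclideanSpace ℝ (Fin N), x ≠ 0 := by
        have : Nonempty (Fin N) := ⟨⟨0, by omega⟩⟩
        exact Measure.ae_ne volume 0
      filter_upwards [hne] with x hx
      have hx2 : 0 < ‖x‖ ^ 2 := by positivity
      have hepos : (0 : ℝ) < 1 / ((n : ℝ) + 1) := by positivity
      generalize 1 / ((n : ℝ) + 1) = e at hepos
      generalize ‖x‖ ^ 2 = s at hx2
      have b1 : |1 / (s + e)| ≤ 1 / s := by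
        rw [abs_of_pos (by positivity)]
        exact one_div_le_one_div_of_le hx2 (by linarith)
      have b2 : |N / (s + e) - 2 * s / (s + e) ^ 2| ≤ (N + 2) / s := by
        have e1 : (N : ℝ) / (s + e) ≤ N / s := by gcongr; linarith
        have e2 : 2 * s / (s + e) ^ 2 ≤ 2 / s := by
          rw [div_le_div_iff₀ (by positivity) hx2]; nlinarith
        have e3 : 0 ≤ (N : ℝ) / (s + e) := by positivity
        have e4 : 0 ≤ 2 * s / (s + e) ^ 2 := by positivity
        rw [add_div, abs_le]
        constructor <;> have e5 : 0 ≤ (N : ℝ) / s := by positivity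
        · linarith
        · have : 0 ≤ 2 / s := by positivity
          linarith
      simp only [Real.norm_eq_abs]
      refine (abs_add_le _ _).trans ?_
      refine add_le_add ?_ ?_
      · rw [abs_div, abs_div, abs_of_pos hx2, abs_of_pos (by positivity : 0 < s + e)]
        gcongr; linarith
      · rw [abs_mul, abs_div, abs_of_pos hx2]
        calc _ ≤ |w x| * ((N + 2) / s) := by gcongr
          _ = _ := by ring
    · have hne : ∀ᵐ x : EuclideanSpace ℝ (Fin N), x ≠ 0 := by
        have : Nonempty (Fin N) := ⟨⟨0, by omega⟩⟩
        exact Measure.ae_ne volume 0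
      filter_upwards [hne] with x hx
      have hx2 : 0 < ‖x‖ ^ 2 := by positivity
      have h0 : Filter.Tendsto (fun n : ℕ => ‖x‖ ^ 2 + 1 / ((n : ℝ) + 1)) Filter.atTop
          (nhds (‖x‖ ^ 2)) := by
        simpa using tendsto_const_nhds.add (tendsto_one_div_add_atTop_nhds_zero_nat (𝕜 := ℝ))
      have d1 : Filter.Tendsto (fun n : ℕ => fderiv ℝ w x x / (‖x‖ ^ 2 + 1 / ((n : ℝ) + 1)))
          Filter.atTop (nhds (fderiv ℝ w x x / ‖x‖ ^ 2)) := tendsto_const_nhds.div h0 hx2.ne'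
      have d2 : Filter.Tendsto (fun n : ℕ => (N : ℝ) / (‖x‖ ^ 2 + 1 / ((n : ℝ) + 1)))
          Filter.atTop (nhds (N / ‖x‖ ^ 2)) := tendsto_const_nhds.div h0 hx2.ne'
      have d3 : Filter.Tendsto
          (fun n : ℕ => 2 * ‖x‖ ^ 2 / (‖x‖ ^ 2 + 1 / ((n : ℝ) + 1)) ^ 2)
          Filter.atTop (nhds (2 * ‖x‖ ^ 2 / (‖x‖ ^ 2) ^ 2)) :=
        tendsto_const_nhds.div (h0.pow 2) (by positivity)
      have hval : fderiv ℝ w x x / ‖x‖ ^ 2 + ((N : ℝ) - 2) * (w x / ‖x‖ ^ 2) =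
          fderiv ℝ w x x / ‖x‖ ^ 2 + w x * (N / ‖x‖ ^ 2 - 2 * ‖x‖ ^ 2 / (‖x‖ ^ 2) ^ 2) := by
        have : ‖x‖ ≠ 0 := by simpa using hx
        field_simp
      rw [hval]
      exact d1.add ((d2.sub d3).const_mul (w x))
  have hz : ∫ x, (fderiv ℝ w x x / ‖x‖ ^ 2 + ((N : ℝ) - 2) * (w x / ‖x‖ ^ 2)) = 0 := by
    refine tendsto_nhds_unique lim ?_
    simp_rw [reg]
    exact tendsto_const_nhds
  rw [integral_add i1 (i2.const_mul _), integral_const_mul] at hz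
  linarith

lemma continuous_gradient_of {N : ℕ} {u : EuclideanSpace ℝ (Fin N) → ℝ}
    (hu : ContDiff ℝ 1 u) : Continuous (gradient u) := by
  have : Continuous (fderiv ℝ u) := hu.continuous_fderiv (by norm_num)
  exact (InnerProductSpace.toDual ℝ (EuclideanSpace ℝ (Fin N))).symm.continuous.comp this

lemma gradient_eq_zero_of_notMem {N : ℕ} {u : EuclideanSpace ℝ (Fin N) → ℝ}
    {x : EuclideanSpace ℝ (Fin N)} (hx : x ∉ tsupport u) : gradient u x = 0 := by
  have h : fderiv ℝ u x = 0 := by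
    by_contra h
    exact hx (tsupport_fderiv_subset ℝ (subset_tsupport _ h))
  simp [gradient, h]

lemma hasCompactSupport_gradient {N : ℕ} {u : EuclideanSpace ℝ (Fin N) → ℝ}
    (hu : HasCompactSupport u) : HasCompactSupport (gradient u) :=
  HasCompactSupport.intro hu fun _ hx => gradient_eq_zero_of_notMem hx

/-- The twisted gradient of the ground state representation. -/
def twist {N : ℕ} (u : EuclideanSpace ℝ (Fin N) → ℝ) (x : EuclideanSpace ℝ (Fin N)) :
    EuclideanSpace ℝ (Fin N) :=
  gradient u x + (((N : ℝ) - 2) / 2 * u x / ‖x‖ ^ 2) • x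

lemma norm_twist_sq {N : ℕ} (u : EuclideanSpace ℝ (Fin N) → ℝ)
    (x : EuclideanSpace ℝ (Fin N)) :
    ‖twist u x‖ ^ 2 = ‖gradient u x‖ ^ 2 + ((N : ℝ) - 2) * (u x * fderiv ℝ u x x / ‖x‖ ^ 2)
      + ((N : ℝ) - 2) ^ 2 / 4 * (u x ^ 2 / ‖x‖ ^ 2) := by
  rw [twist, norm_add_sq_real, inner_smul_right, inner_gradient_left, norm_smul, mul_pow,
    Real.norm_eq_abs, sq_abs]
  rcases eq_or_ne x 0 with rfl | hx
  · simp
  · have : ‖x‖ ≠ 0 := by simpa using hx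
    field_simp
    ring

lemma fderiv_sq_self {N : ℕ} {u : EuclideanSpace ℝ (Fin N) → ℝ}
    (hu : ContDiff ℝ 1 u) (x : EuclideanSpace ℝ (Fin N)) :
    fderiv ℝ (fun y => u y ^ 2) x x = 2 * (u x * fderiv ℝ u x x) := by
  have h : HasFDerivAt u (fderiv ℝ u x) x :=
    (hu.differentiable (by norm_num)).differentiableAt.hasFDerivAt
  rw [(h.pow 2).fderiv]
  simp
  ring

lemma hardy_identity {N : ℕ} (hN : 3 ≤ N) {u : EuclideanSpace ℝ (Fin N) → ℝ}
    (hu : ContDiff ℝ 1 u) (huc : HasCompactSupport u) :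
    Integrable (fun x => ‖twist u x‖ ^ 2) ∧
    ∫ x, ‖twist u x‖ ^ 2 = ∫ x, (‖gradient u x‖ ^ 2 -
            ((N : ℝ) - 2) ^ 2 / (4 * ‖x‖ ^ 2) * u x ^ 2) := by
  have hcu := hu.continuous
  have hd : Continuous (fderiv ℝ u) := hu.continuous_fderiv (by norm_num)
  have hu2 : HasCompactSupport (fun x => u x ^ 2) := huc.comp_left (g := fun t : ℝ => t ^ 2) (by simp)
  have iG : Integrable (fun x => ‖gradient u x‖ ^ 2) := by
    refine Continuous.integrable_of_hasCompactSupport ((continuous_gradient_of hu).norm.pow 2) ?_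
    exact (hasCompactSupport_gradient huc).comp_left (g := fun t => ‖t‖ ^ 2) (by simp)
  have iD : Integrable (fun x => u x * fderiv ℝ u x x / ‖x‖ ^ 2) :=
    integrable_div_norm_sq hN (g := fun x => u x * fderiv ℝ u x x) (by fun_prop) huc.mul_right
  have iB : Integrable (fun x => u x ^ 2 / ‖x‖ ^ 2) :=
    integrable_div_norm_sq hN (g := fun x => u x ^ 2) (by fun_prop) hu2
  have e1 := integral_fderiv_self_div hN (hu.pow 2) hu2
  simp_rw [fderiv_sq_self hu, mul_div_assoc, integral_const_mul] at e1
  simp_rw [← mul_div_assoc] at e1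
  have hr : ∀ x : EuclideanSpace ℝ (Fin N), ‖gradient u x‖ ^ 2 -
      ((N : ℝ) - 2) ^ 2 / (4 * ‖x‖ ^ 2) * u x ^ 2 =
      ‖gradient u x‖ ^ 2 - ((N : ℝ) - 2) ^ 2 / 4 * (u x ^ 2 / ‖x‖ ^ 2) := by
    intro x
    rw [div_mul_div_comm, div_mul_eq_mul_div]
  simp_rw [norm_twist_sq, hr]
  have iGD : Integrable (fun x => ‖gradient u x‖ ^ 2 +
      ((N : ℝ) - 2) * (u x * fderiv ℝ u x x / ‖x‖ ^ 2)) := iG.add (iD.const_mul _)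
  refine ⟨iGD.add (iB.const_mul _), ?_⟩
  rw [integral_add iGD (iB.const_mul _),
    integral_add iG (iD.const_mul _), integral_sub iG (iB.const_mul _),
    integral_const_mul, integral_const_mul]
  linear_combination ((N : ℝ) - 2) / 2 * e1

lemma hardy_remainder {N : ℕ} (hN : 3 ≤ N) {u : EuclideanSpace ℝ (Fin N) → ℝ}
    (hu : ContDiff ℝ 1 u) (huc : HasCompactSupport u) {R : ℝ} (hR : 0 < R)
    (hs : ∀ x, u x ≠ 0 → ‖x‖ ≤ R) :
    1 / R ^ 2 * ∫ x, u x ^ 2 ≤ ∫ x, ‖twist u x‖ ^ 2 := by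
  have hcu := hu.continuous
  have hd : Continuous (fderiv ℝ u) := hu.continuous_fderiv (by norm_num)
  have hu2 : HasCompactSupport (fun x => u x ^ 2) := huc.comp_left (g := fun t : ℝ => t ^ 2) (by simp)
  have iT := (hardy_identity hN hu huc).1
  have iU : Integrable (fun x => u x ^ 2) :=
    Continuous.integrable_of_hasCompactSupport (by fun_prop) hu2
  have iE : Integrable (fun x => u x * fderiv ℝ u x x) :=
    Continuous.integrable_of_hasCompactSupport (by fun_prop) huc.mul_right
  have e2 := integral_fderiv_self (hu.pow 2) hu2
  simp_rw [fderiv_sq_self hu, integral_const_mul] at e2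
  set k : ℝ := 1 / R ^ 2 with hk
  have hkpos : 0 < k := by positivity
  have pt : ∀ x, 0 ≤ ‖twist u x‖ ^ 2 + 2 * k * (u x * fderiv ℝ u x x) +
      k * ((N : ℝ) - 1) * u x ^ 2 := by
    intro x
    by_cases hux : u x = 0
    · simp [hux]
    have hxR := hs x hux
    have h1 : 0 ≤ ‖twist u x + (k * u x) • x‖ ^ 2 := by positivity
    rw [norm_add_sq_real, inner_smul_right, norm_smul, mul_pow, Real.norm_eq_abs, sq_abs,
      twist, inner_add_left, inner_gradient_left, inner_smul_left, real_inner_self_eq_norm_sq,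
      ← twist] at h1
    have h2 : k * ‖x‖ ^ 2 ≤ 1 := by
      rw [hk, div_mul_eq_mul_div, one_mul, div_le_one (by positivity)]
      gcongr
    have h3 : u x * (((N : ℝ) - 2) / 2 * u x / ‖x‖ ^ 2 * ‖x‖ ^ 2) ≤ ((N : ℝ) - 2) / 2 * u x ^ 2 := by
      have hN2 : (0 : ℝ) ≤ (N : ℝ) - 2 := by
        have : (3 : ℝ) ≤ N := by exact_mod_cast hN
        linarith
      rcases eq_or_ne x 0 with rfl | hx
      · simp; positivity
      · have : ‖x‖ ≠ 0 := by simpa using hx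
        field_simp
        simp
    have h4 : (k * u x) ^ 2 * ‖x‖ ^ 2 ≤ k * u x ^ 2 := by
      calc _ = (k * u x ^ 2) * (k * ‖x‖ ^ 2) := by ring
        _ ≤ (k * u x ^ 2) * 1 := by gcongr
        _ = _ := by ring
    have h5 := mul_le_mul_of_nonneg_left h3 hkpos.le
    simp only [conj_trivial] at h1
    nlinarith
  have hI : 0 ≤ ∫ x, (‖twist u x‖ ^ 2 + 2 * k * (u x * fderiv ℝ u x x) +
      k * ((N : ℝ) - 1) * u x ^ 2) := integral_nonneg pt
  have iTE : Integrable (fun x => ‖twist u x‖ ^ 2 + 2 * k * (u x * fderiv ℝ u x x)) :=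
    iT.add (iE.const_mul _)
  rw [integral_add iTE (iU.const_mul _), integral_add iT (iE.const_mul _),
    integral_const_mul, integral_const_mul] at hI
  have e3 := congrArg (fun t => k * t) e2
  nlinarith

lemma integrable_sq_div_bdist {N : ℕ} {Ω : Set (EuclideanSpace ℝ (Fin N))}
    (hpos : ∀ x ∈ Ω, 0 < bdist Ω x) {u : EuclideanSpace ℝ (Fin N) → ℝ}
    (hu : Continuous u) (huc : HasCompactSupport u) (hs : tsupport u ⊆ Ω) :
    Integrable (fun x => u x ^ 2 / bdist Ω x ^ 2) := by
  have hc : Continuous (bdist Ω) := Metric.continuous_infDist_pt _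
  have h1 : IntegrableOn (fun x => u x ^ 2 / bdist Ω x ^ 2) (tsupport u) := by
    refine ContinuousOn.integrableOn_compact huc ?_
    refine ContinuousOn.div (by fun_prop) (by fun_prop) ?_
    intro x hx
    have := hpos x (hs hx)
    positivity
  refine (integrableOn_iff_integrable_of_support_subset ?_).1 h1
  intro x hx
  refine subset_tsupport _ fun h => hx ?_
  simp [h]

lemma twist_eq_zero_of_notMem {N : ℕ} {u : EuclideanSpace ℝ (Fin N) → ℝ}
    {x : EuclideanSpace ℝ (Fin N)} (hx : x ∉ tsupport u) : twist u x = 0 := by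
  simp [twist, gradient_eq_zero_of_notMem hx, image_eq_zero_of_notMem_tsupport hx]

/-- Pointwise bound on the gradient of the cut-off function. -/
lemma norm_gradient_cutoff_sq_le {N : ℕ} (hN : 3 ≤ N) {r L : ℝ} (hr : 0 < r)
    {χ u : EuclideanSpace ℝ (Fin N) → ℝ} (hχ : ContDiff ℝ 1 χ) (hu : ContDiff ℝ 1 u)
    (hχ0 : ∀ x, 0 ≤ χ x) (hχ1 : ∀ x, χ x ≤ 1) (hχin : ∀ x, ‖x‖ ≤ r / 2 → χ x = 1)
    (hL : ∀ x, ‖gradient χ x‖ ≤ L) (x : EuclideanSpace ℝ (Fin N)) :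
    ‖gradient (fun y => (1 - χ y) * u y) x‖ ^ 2 ≤
      2 * ‖twist u x‖ ^ 2 + 2 * (((N : ℝ) - 2) / r + L) ^ 2 * u x ^ 2 := by
  have hN2 : (0 : ℝ) ≤ (N : ℝ) - 2 := by
    have : (3 : ℝ) ≤ N := by exact_mod_cast hN
    linarith
  have hg : gradient (fun y => (1 - χ y) * u y) x =
      (1 - χ x) • gradient u x - u x • gradient χ x := by
    have h1 : HasFDerivAt χ (fderiv ℝ χ x) x :=
      (hχ.differentiable (by norm_num)).differentiableAt.hasFDerivAt
    have h2 : HasFDerivAt u (fderiv ℝ u x) x :=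
      (hu.differentiable (by norm_num)).differentiableAt.hasFDerivAt
    have h3 := ((h1.const_sub 1).mul h2).fderiv
    have h4 : fderiv ℝ (fun y => (1 - χ y) * u y) x =
      (1 - χ x) • fderiv ℝ u x + u x • -fderiv ℝ χ x := h3
    simp only [gradient, h4]
    simp [sub_eq_add_neg]
  have hmid : ‖((1 - χ x) * (((N : ℝ) - 2) / 2 * u x / ‖x‖ ^ 2)) • x‖ ≤
      ((N : ℝ) - 2) / r * |u x| := by
    have h1 := hχ0 x
    have h2 := hχ1 x
    by_cases hx : ‖x‖ ≤ r / 2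
    · rw [hχin x hx]
      simp
      positivity
    · push Not at hx
      have hxp : 0 < ‖x‖ := by linarith
      rw [norm_smul, Real.norm_eq_abs, abs_mul, abs_div, abs_mul, abs_of_nonneg (by linarith : 0 ≤ 1 - χ x),
        abs_of_nonneg (by positivity : 0 ≤ ((N : ℝ) - 2) / 2), abs_of_nonneg (by positivity : 0 ≤ ‖x‖ ^ 2)]
      calc (1 - χ x) * (((N : ℝ) - 2) / 2 * |u x| / ‖x‖ ^ 2) * ‖x‖
          ≤ 1 * (((N : ℝ) - 2) / 2 * |u x| / ‖x‖ ^ 2) * ‖x‖ := by gcongr; linarith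
        _ = (((N : ℝ) - 2) / 2 * |u x|) / ‖x‖ := by field_simp
        _ ≤ (((N : ℝ) - 2) / 2 * |u x|) / (r / 2) := by gcongr
        _ = _ := by field_simp
  have hdec : gradient (fun y => (1 - χ y) * u y) x =
      (1 - χ x) • twist u x - ((1 - χ x) * (((N : ℝ) - 2) / 2 * u x / ‖x‖ ^ 2)) • x
        - u x • gradient χ x := by
    rw [hg, twist, smul_add, smul_smul]
    abel
  have hn : ‖gradient (fun y => (1 - χ y) * u y) x‖ ≤
      ‖twist u x‖ + (((N : ℝ) - 2) / r + L) * |u x| := by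
    rw [hdec]
    refine (norm_sub_le _ _).trans ?_
    refine (add_le_add_left (norm_sub_le _ _) _).trans ?_
    have a1 : ‖(1 - χ x) • twist u x‖ ≤ ‖twist u x‖ := by
      rw [norm_smul, Real.norm_eq_abs, abs_of_nonneg (by linarith [hχ1 x])]
      exact mul_le_of_le_one_left (norm_nonneg _) (by linarith [hχ0 x])
    have a2 : ‖u x • gradient χ x‖ ≤ L * |u x| := by
      rw [norm_smul, Real.norm_eq_abs, mul_comm]
      gcongr
      exact hL x
    linarith
  calc ‖gradient (fun y => (1 - χ y) * u y) x‖ ^ 2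
      ≤ (‖twist u x‖ + (((N : ℝ) - 2) / r + L) * |u x|) ^ 2 := by gcongr
    _ ≤ 2 * (‖twist u x‖ ^ 2 + ((((N : ℝ) - 2) / r + L) * |u x|) ^ 2) := add_sq_le
    _ = _ := by rw [mul_pow, sq_abs]; ring

/-- If the boundary Hardy inequality holds on a bounded domain `Ω` containing the origin,
then it can be improved by subtracting the critical inverse-square potential at the
origin. -/
theorem improved_hardy_of_boundary_hardy
    (N : ℕ) (hN : 3 ≤ N)
    (Ω : Set (EuclideanSpace ℝ (Fin N))) (hΩo : IsOpen Ω) (hΩconn : IsConnected Ω)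
    (hΩb : Bornology.IsBounded Ω) (h0 : (0 : EuclideanSpace ℝ (Fin N)) ∈ Ω)
    (C : ℝ) (hC : 0 < C)
    (hHardy : ∀ u : EuclideanSpace ℝ (Fin N) → ℝ,
      ContDiff ℝ (⊤ : ℕ∞) u → HasCompactSupport u → tsupport u ⊆ Ω →
      C * ∫ x in Ω, u x ^ 2 / bdist Ω x ^ 2 ≤ ∫ x in Ω, ‖gradient u x‖ ^ 2) :
    ∃ C' : ℝ, 0 < C' ∧
      ∀ u : EuclideanSpace ℝ (Fin N) → ℝ,
        ContDiff ℝ (⊤ : ℕ∞) u → HasCompactSupport u → tsupport u ⊆ Ω →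
        C' * ∫ x in Ω, u x ^ 2 / bdist Ω x ^ 2 ≤
          ∫ x in Ω, (‖gradient u x‖ ^ 2 -
            ((N : ℝ) - 2) ^ 2 / (4 * ‖x‖ ^ 2) * u x ^ 2) := by
  obtain ⟨R, hR, hRΩ⟩ := hΩb.exists_pos_norm_le
  obtain ⟨ρ, hρ, hρΩ⟩ := Metric.isOpen_iff.1 hΩo 0 h0
  have hNpos : (3 : ℝ) ≤ N := by exact_mod_cast hN
  have hne : (frontier Ω).Nonempty := by
    have : Nonempty (Fin N) := ⟨⟨0, by omega⟩⟩
    refine nonempty_frontier_iff.2 ⟨⟨0, h0⟩, ?_⟩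
    rintro rfl
    exact NormedSpace.unbounded_univ ℝ (EuclideanSpace ℝ (Fin N)) hΩb
  have hdisj : ∀ y ∈ frontier Ω, y ∉ Ω := by
    intro y hy hyΩ
    rw [hΩo.frontier_eq] at hy
    exact hy.2 hyΩ
  have hpos : ∀ x ∈ Ω, 0 < bdist Ω x := by
    intro x hx
    exact (isClosed_frontier.notMem_iff_infDist_pos hne).1 fun h => hdisj x h hx
  set r : ℝ := ρ / 2 with hrdef
  have hr : 0 < r := by positivity
  have hdr : ∀ x : EuclideanSpace ℝ (Fin N), ‖x‖ < r → r ≤ bdist Ω x := by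
    intro x hx
    refine (Metric.le_infDist hne).2 ?_
    intro y hy
    have hy' : ρ ≤ ‖y‖ := by
      by_contra h
      push Not at h
      exact hdisj y hy (hρΩ (by simpa using h))
    have h2 : ‖y‖ ≤ ‖x‖ + dist x y := by
      rw [dist_eq_norm, norm_sub_rev]
      calc ‖y‖ = ‖x + (y - x)‖ := by congr 1; abel
        _ ≤ _ := norm_add_le _ _
    linarith
  let χ : ContDiffBump (0 : EuclideanSpace ℝ (Fin N)) := ⟨r / 2, r, by positivity, by linarith⟩
  have hχ : ContDiff ℝ (⊤ : ℕ∞) χ := χ.contDiff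
  have hχ1 : ContDiff ℝ 1 χ := χ.contDiff
  obtain ⟨L, hL⟩ := (hasCompactSupport_gradient χ.hasCompactSupport).exists_bound_of_continuous
    (continuous_gradient_of hχ1)
  set K : ℝ := 2 * (((N : ℝ) - 2) / r + L) ^ 2 with hK
  have hK0 : 0 ≤ K := by positivity
  set M : ℝ := (2 + K * R ^ 2) / C + R ^ 2 / r ^ 2 with hM
  have hMpos : 0 < M := by positivity
  refine ⟨1 / M, by positivity, ?_⟩
  intro u hu huc hus
  have hu1 : ContDiff ℝ 1 u := hu.of_le (by exact_mod_cast le_top)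
  have hu0 : ∀ x, x ∉ Ω → x ∉ tsupport u := fun x hx h => hx (hus h)
  have hcu := hu.continuous
  obtain ⟨iT, hI⟩ := hardy_identity hN hu1 huc
  have hrem := hardy_remainder hN hu1 huc hR fun x hx =>
    hRΩ x (hus (subset_tsupport _ hx))
  have iU : Integrable (fun x => u x ^ 2) :=
    Continuous.integrable_of_hasCompactSupport (by fun_prop)
      (huc.comp_left (g := fun t : ℝ => t ^ 2) (by simp))
  have iUd := integrable_sq_div_bdist hpos hcu huc hus
  -- the cut-off function
  set v : EuclideanSpace ℝ (Fin N) → ℝ := fun y => (1 - χ y) * u y with hv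
  have hvs : ContDiff ℝ (⊤ : ℕ∞) v := (contDiff_const.sub hχ).mul hu
  have hv1 : ContDiff ℝ 1 v := hvs.of_le (by exact_mod_cast le_top)
  have hvc : HasCompactSupport v := huc.mul_left
  have hvt : tsupport v ⊆ Ω := (tsupport_mul_subset_right).trans hus
  have hv0 : ∀ x, x ∉ Ω → x ∉ tsupport v := fun x hx h => hx (hvt h)
  have iVd := integrable_sq_div_bdist hpos hvs.continuous hvc hvt
  have iGv : Integrable (fun x => ‖gradient v x‖ ^ 2) := by
    refine Continuous.integrable_of_hasCompactSupport ((continuous_gradient_of hv1).norm.pow 2) ?_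
    exact (hasCompactSupport_gradient hvc).comp_left (g := fun t => ‖t‖ ^ 2) (by simp)
  have hH := hHardy v hvs hvc hvt
  rw [setIntegral_eq_integral_of_forall_compl_eq_zero (fun x hx => by
      simp [image_eq_zero_of_notMem_tsupport (hv0 x hx)]),
    setIntegral_eq_integral_of_forall_compl_eq_zero (fun x hx => by
      simp [gradient_eq_zero_of_notMem (hv0 x hx)])] at hH
  rw [setIntegral_eq_integral_of_forall_compl_eq_zero (fun x hx => by
      simp [image_eq_zero_of_notMem_tsupport (hu0 x hx)]),
    setIntegral_eq_integral_of_forall_compl_eq_zero (fun x hx => by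
      simp [gradient_eq_zero_of_notMem (hu0 x hx), image_eq_zero_of_notMem_tsupport (hu0 x hx)]),
    ← hI]
  have b1 : ∫ x, ‖gradient v x‖ ^ 2 ≤ 2 * (∫ x, ‖twist u x‖ ^ 2) + K * ∫ x, u x ^ 2 := by
    rw [← integral_const_mul, ← integral_const_mul,
      ← integral_add (iT.const_mul _) (iU.const_mul _)]
    refine integral_mono iGv ((iT.const_mul _).add (iU.const_mul _)) fun x => ?_
    exact norm_gradient_cutoff_sq_le hN hr hχ1 hu1 (fun x => χ.nonneg) (fun x => χ.le_one)
      (fun x hx => χ.one_of_mem_closedBall (by simpa [χ] using hx)) hL x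
  have b2 : ∫ x, u x ^ 2 / bdist Ω x ^ 2 ≤
      (∫ x, v x ^ 2 / bdist Ω x ^ 2) + 1 / r ^ 2 * ∫ x, u x ^ 2 := by
    rw [← integral_const_mul, ← integral_add iVd (iU.const_mul _)]
    refine integral_mono iUd (iVd.add (iU.const_mul _)) fun x => ?_
    beta_reduce
    by_cases hx : ‖x‖ < r
    · have h1 := hdr x hx
      have h2 : u x ^ 2 / bdist Ω x ^ 2 ≤ u x ^ 2 / r ^ 2 := by gcongr
      have h3 : 0 ≤ v x ^ 2 / bdist Ω x ^ 2 := by positivity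
      have h4 : 1 / r ^ 2 * u x ^ 2 = u x ^ 2 / r ^ 2 := by ring
      linarith
    · push Not at hx
      have hz : χ x = 0 := χ.zero_of_le_dist (by simpa [χ] using hx)
      have hvx : v x = u x := by simp [hv, hz]
      rw [hvx]
      have : 0 ≤ 1 / r ^ 2 * u x ^ 2 := by positivity
      linarith
  generalize (∫ x, ‖twist u x‖ ^ 2) = I at *
  generalize (∫ x, u x ^ 2) = S at *
  generalize (∫ x, v x ^ 2 / bdist Ω x ^ 2) = V at *
  have hS : S ≤ R ^ 2 * I := by
    rw [one_div, inv_mul_le_iff₀ (by positivity)] at hrem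
    exact hrem
  have hV : V ≤ (2 * I + K * (R ^ 2 * I)) / C := by
    rw [le_div_iff₀ hC]
    have := mul_le_mul_of_nonneg_left hS hK0
    linarith
  have hS2 : 1 / r ^ 2 * S ≤ 1 / r ^ 2 * (R ^ 2 * I) := by gcongr
  rw [one_div, inv_mul_le_iff₀ hMpos]
  calc _ ≤ V + 1 / r ^ 2 * S := b2
    _ ≤ (2 * I + K * (R ^ 2 * I)) / C + 1 / r ^ 2 * (R ^ 2 * I) := add_le_add hV hS2
    _ = M * I := by rw [hM]; ring
end
end

section
/- Let N ≥ 3 and let Ω ⊂ ℝ^N be a smooth bounded domain containing the origin. For ε > 0 define V_ε(x) := (N−2)²/(4|x|²) if d(x) ≥ ε, and V_ε(x) := 1/(4 d(x)²) if d(x) < ε. Then there exists ε₀ = ε₀(Ω) > 0 such that for every 0 < ε ≤ ε₀ and every u ∈ C₀^∞(Ω), ∫_Ω |∇u(x)|² dx ≥ ∫_Ω V_ε(x) · u(x)² dx. -/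
open MeasureTheory Real Classical

noncomputable section

lemma disc_hardy {N : ℕ} (u W : EuclideanSpace ℝ (Fin N) → ℝ) (hu : Continuous u)
    (hs : HasCompactSupport u) (hW : Continuous W) (v : EuclideanSpace ℝ (Fin N)) :
    Integrable (fun x => u x ^ 2 * (2 - exp (W (x + v) - W x) - exp (W (x - v) - W x))) ∧
    ∫ x, u x ^ 2 * (2 - exp (W (x + v) - W x) - exp (W (x - v) - W x)) ≤
      ∫ x, (u (x + v) - u x) ^ 2 := by
  have hs2 : HasCompactSupport (fun x => u x ^ 2) :=
    hs.comp_left (g := fun y : ℝ => y ^ 2) (by norm_num)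
  have hcs : ∀ g : EuclideanSpace ℝ (Fin N) → ℝ, Continuous g →
      Integrable (fun x => u x ^ 2 * g x) := by
    intro g hg
    exact ((hu.pow 2).mul hg).integrable_of_hasCompactSupport hs2.mul_right
  have h1 := hcs (fun x => 1 - exp (W (x + v) - W x)) (by fun_prop)
  have h2 := hcs (fun x => 1 - exp (W (x - v) - W x)) (by fun_prop)
  have h12 := hcs (fun x => 2 - exp (W (x + v) - W x) - exp (W (x - v) - W x)) (by fun_prop)
  refine ⟨h12, ?_⟩
  have h3 : Integrable (fun x => u (x + v) ^ 2 * (1 - exp (W x - W (x + v)))) := by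
    have := h2.comp_add_right v
    simpa using this
  have e3 : ∫ x, u (x + v) ^ 2 * (1 - exp (W x - W (x + v))) =
      ∫ x, u x ^ 2 * (1 - exp (W (x - v) - W x)) := by
    have := integral_add_right_eq_self (μ := volume)
      (fun x => u x ^ 2 * (1 - exp (W (x - v) - W x))) v
    simpa using this
  have hsv : HasCompactSupport (fun x => u (x + v)) :=
    hs.comp_homeomorph (Homeomorph.addRight v)
  have h4 : Integrable (fun x => (u (x + v) - u x) ^ 2) := by
    apply Continuous.integrable_of_hasCompactSupport (by fun_prop)
    exact (hsv.sub hs).comp_left (g := fun y : ℝ => y ^ 2) (by norm_num)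
  calc ∫ x, u x ^ 2 * (2 - exp (W (x + v) - W x) - exp (W (x - v) - W x))
      = ∫ x, (u x ^ 2 * (1 - exp (W (x + v) - W x)) + u x ^ 2 * (1 - exp (W (x - v) - W x))) := by
        congr 1; ext x; ring
    _ = ∫ x, (u x ^ 2 * (1 - exp (W (x + v) - W x))
          + u (x + v) ^ 2 * (1 - exp (W x - W (x + v)))) := by
        rw [integral_add h1 h2, integral_add h1 h3, e3]
    _ ≤ _ := by
        apply integral_mono (h1.add h3) h4
        intro x
        simp only [Pi.add_apply]
        set p := exp ((W (x + v) - W x) / 2) with hp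
        set q := exp ((W x - W (x + v)) / 2) with hq
        have hpq : p * q = 1 := by rw [hp, hq, ← exp_add]; simp; ring
        have e1 : exp (W (x + v) - W x) = p ^ 2 := by
          rw [hp, ← exp_nat_mul]; congr 1; push_cast; ring
        have e2 : exp (W x - W (x + v)) = q ^ 2 := by
          rw [hq, ← exp_nat_mul]; congr 1; push_cast; ring
        rw [e1, e2]
        have := sq_nonneg (u x * p - u (x + v) * q)
        have h5 : u x * p * (u (x + v) * q) = u x * u (x + v) := by
          calc _ = u x * u (x + v) * (p * q) := by ring
            _ = _ := by rw [hpq, mul_one]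
        nlinarith

lemma quot_tendsto {N : ℕ} (u : EuclideanSpace ℝ (Fin N) → ℝ) (hu : ContDiff ℝ 1 u)
    (hs : HasCompactSupport u) (v : EuclideanSpace ℝ (Fin N)) :
    Filter.Tendsto (fun h : ℝ => (∫ x, (u (x + h • v) - u x) ^ 2) / h ^ 2)
      (nhdsWithin 0 (Set.Ioi 0)) (nhds (∫ x, (fderiv ℝ u x v) ^ 2)) := by
  obtain ⟨C, hC⟩ := hu.lipschitzWith_of_hasCompactSupport hs (by norm_num)
  set k := Metric.cthickening ‖v‖ (tsupport u) with hk
  have hkc : IsCompact k := IsCompact.cthickening hs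
  have : ∀ h : ℝ, (∫ x, (u (x + h • v) - u x) ^ 2) / h ^ 2 =
      ∫ x, ((u (x + h • v) - u x) / h) ^ 2 := by
    intro h
    rw [← integral_div]; congr 1; ext x; rw [div_pow]
  simp_rw [this]
  have huc := hu.continuous
  apply tendsto_integral_filter_of_dominated_convergence
    (k.indicator (fun _ => ((C : ℝ) * ‖v‖) ^ 2))
  · filter_upwards with h
    exact (by fun_prop : Continuous fun x => ((u (x + h • v) - u x) / h) ^ 2).aestronglyMeasurable
  · have : Set.Ioo (0:ℝ) 1 ∈ nhdsWithin (0:ℝ) (Set.Ioi 0) := Ioo_mem_nhdsGT one_pos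
    filter_upwards [this] with h hh
    filter_upwards with x
    by_cases hx : x ∈ k
    · rw [Set.indicator_of_mem hx, norm_pow]
      gcongr
      rw [norm_div, div_le_iff₀ (by simpa using hh.1.ne')]
      have := hC.norm_sub_le (x + h • v) x
      rw [add_sub_cancel_left, norm_smul] at this
      linarith
    · rw [Set.indicator_of_notMem hx]
      have a1 : u x = 0 := by
        by_contra hne
        exact hx (Metric.self_subset_cthickening _ (subset_tsupport u hne))
      have a2 : u (x + h • v) = 0 := by
        by_contra hne
        refine hx (Metric.mem_cthickening_of_dist_le x (x + h • v) _ _ (subset_tsupport u hne) ?_)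
        rw [dist_self_add_right, norm_smul, norm_eq_abs, abs_of_pos hh.1]
        nlinarith [norm_nonneg v, hh.2]
      simp [a1, a2]
  · rw [integrable_indicator_iff hkc.measurableSet]
    exact continuousOn_const.integrableOn_compact hkc
  · filter_upwards with x
    have hd := ((hu.differentiable (by norm_num)) x).hasFDerivAt.hasLineDerivAt v
    have := hd.tendsto_slope_zero_right
    refine Filter.Tendsto.pow ?_ 2
    refine this.congr fun t => ?_
    simp [div_eq_inv_mul]

lemma grad_norm {N : ℕ} (u : EuclideanSpace ℝ (Fin N) → ℝ) (x : EuclideanSpace ℝ (Fin N)) :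
    ‖gradient u x‖ ^ 2 = ∑ i, (fderiv ℝ u x (EuclideanSpace.single i 1)) ^ 2 := by
  rw [EuclideanSpace.norm_sq_eq]
  congr 1; ext i
  have : fderiv ℝ u x (EuclideanSpace.single i 1) = gradient u x i := by
    have h1 : fderiv ℝ u x (EuclideanSpace.single i 1) =
        inner ℝ (gradient u x) (EuclideanSpace.single i 1) := by
      rw [gradient, InnerProductSpace.toDual_symm_apply]
    rw [h1, EuclideanSpace.inner_single_right]
    simp
  rw [this]; simp

lemma limit_hardy {N : ℕ} (u W U : EuclideanSpace ℝ (Fin N) → ℝ) (hu : ContDiff ℝ 1 u)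
    (hs : HasCompactSupport u) (hW : Continuous W) (hU : Integrable fun x => U x * u x ^ 2)
    (K h0 : ℝ) (hh0 : 0 < h0)
    (H : ∀ x ∈ tsupport u, ∀ h, 0 < h → h < h0 →
      ∑ i, (exp (W (x + h • EuclideanSpace.single i 1) - W x) +
        exp (W (x - h • EuclideanSpace.single i 1) - W x) - 2) ≤ - U x * h ^ 2 + K * h ^ 3) :
    ∫ x, U x * u x ^ 2 ≤ ∫ x, ‖gradient u x‖ ^ 2 := by
  have hs2 : HasCompactSupport (fun x => u x ^ 2) :=
    hs.comp_left (g := fun y : ℝ => y ^ 2) (by norm_num)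
  have huc := hu.continuous
  have hu2 : Integrable (fun x => u x ^ 2) :=
    (huc.pow 2).integrable_of_hasCompactSupport hs2
  have hg : ∫ x, ‖gradient u x‖ ^ 2 =
      ∑ i, ∫ x, (fderiv ℝ u x (EuclideanSpace.single i 1)) ^ 2 := by
    simp_rw [grad_norm]
    refine integral_finsetSum _ fun i _ => ?_
    apply Continuous.integrable_of_hasCompactSupport
    · exact ((hu.continuous_fderiv (by norm_num)).clm_apply continuous_const).pow 2
    · have := (hs.fderiv (𝕜 := ℝ)).comp_left
        (g := fun L : EuclideanSpace ℝ (Fin N) →L[ℝ] ℝ => (L (EuclideanSpace.single i 1)) ^ 2)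
        (by simp)
      exact this
  rw [hg]
  have T1 : Filter.Tendsto (fun h : ℝ => ∑ i : Fin N,
      (∫ x, (u (x + h • EuclideanSpace.single i 1) - u x) ^ 2) / h ^ 2)
      (nhdsWithin 0 (Set.Ioi 0))
      (nhds (∑ i : Fin N, ∫ x, (fderiv ℝ u x (EuclideanSpace.single i 1)) ^ 2)) :=
    tendsto_finsetSum _ fun i _ => quot_tendsto u hu hs _
  have T2 : Filter.Tendsto (fun h : ℝ => (∫ x, U x * u x ^ 2) - K * h * ∫ x, u x ^ 2)
      (nhdsWithin 0 (Set.Ioi 0)) (nhds (∫ x, U x * u x ^ 2)) := by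
    have : Filter.Tendsto (fun h : ℝ => (∫ x, U x * u x ^ 2) - K * h * ∫ x, u x ^ 2)
      (nhds 0) (nhds ((∫ x, U x * u x ^ 2) - K * 0 * ∫ x, u x ^ 2)) :=
      Continuous.tendsto (by fun_prop) 0
    simp only [mul_zero, zero_mul, sub_zero] at this
    exact this.mono_left nhdsWithin_le_nhds
  refine le_of_tendsto_of_tendsto T2 T1 ?_
  filter_upwards [Ioo_mem_nhdsGT hh0] with h hh
  have D := fun i : Fin N => disc_hardy u W huc hs hW (h • EuclideanSpace.single i 1)
  rw [← Finset.sum_div, le_div_iff₀ (by have := hh.1; positivity)]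
  refine le_trans ?_ (Finset.sum_le_sum fun i _ => (D i).2)
  rw [← integral_finsetSum _ fun i _ => (D i).1, ← integral_const_mul, ← integral_sub hU
    (hu2.const_mul _), ← integral_mul_const]
  apply integral_mono ((hU.sub (hu2.const_mul _)).mul_const _)
    (integrable_finsetSum _ fun i _ => (D i).1)
  intro x
  simp only
  rw [← Finset.mul_sum]
  by_cases hx : x ∈ tsupport u
  · have h1 := H x hx h hh.1 hh.2
    have h2 : ∑ i : Fin N, (2 - exp (W (x + h • EuclideanSpace.single i 1) - W x) -
        exp (W (x - h • EuclideanSpace.single i 1) - W x)) =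
        - ∑ i : Fin N, (exp (W (x + h • EuclideanSpace.single i 1) - W x) +
        exp (W (x - h • EuclideanSpace.single i 1) - W x) - 2) := by
      rw [← Finset.sum_neg_distrib]; congr 1; ext i; ring
    rw [h2]
    have := mul_le_mul_of_nonneg_left h1 (sq_nonneg (u x))
    simp only [Pi.sub_apply] 
    nlinarith
  · have : u x = 0 := image_eq_zero_of_notMem_tsupport hx
    simp [this]
lemma ext_ball {N : ℕ} (Ω : Set (EuclideanSpace ℝ (Fin N))) (hΩo : IsOpen Ω)
    (hΩb : Bornology.IsBounded Ω) (hΩsm : IsC2Domain Ω) (hne : (frontier Ω).Nonempty) :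
    ∃ r : ℝ, 0 < r ∧ ∀ y ∈ frontier Ω, ∃ z, dist y z = r ∧
      ∀ w ∈ Ω, r ≤ dist w z := by
  obtain ⟨φ, hφ, rfl, hd⟩ := hΩsm
  set Ω : Set (EuclideanSpace ℝ (Fin N)) := {x | φ x < 0} with hΩ
  have hcpt : IsCompact (frontier Ω) :=
    Metric.isCompact_of_isClosed_isBounded isClosed_frontier
      (hΩb.closure.subset frontier_subset_closure)
  have hφ1 : ContDiff ℝ 1 (fderiv ℝ φ) := hφ.fderiv_right (by norm_num)
  obtain ⟨y0, hy0, hmin⟩ := hcpt.exists_isMinOn hne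
    (f := fun y => ‖fderiv ℝ φ y‖) (hφ1.continuous.norm.continuousOn)
  set m := ‖fderiv ℝ φ y0‖ with hm
  have hmpos : 0 < m := norm_pos_iff.mpr (hd y0 hy0)
  obtain ⟨R, hR⟩ := hΩb.closure.subset_closedBall 0
  have hcb : IsCompact (Metric.closedBall (0 : EuclideanSpace ℝ (Fin N)) R) :=
    isCompact_closedBall _ _
  obtain ⟨C, hC⟩ := hcb.exists_bound_of_continuousOn
    (f := fderiv ℝ (fderiv ℝ φ)) (hφ1.continuous_fderiv (by norm_num)).continuousOn
  set M := max C 1 with hM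
  have hMpos : 0 < M := lt_of_lt_of_le one_pos (le_max_right _ _)
  have hconv : Convex ℝ (Metric.closedBall (0 : EuclideanSpace ℝ (Fin N)) R) :=
    convex_closedBall _ _
  have lip : ∀ x ∈ Metric.closedBall (0 : EuclideanSpace ℝ (Fin N)) R,
      ∀ y ∈ Metric.closedBall (0 : EuclideanSpace ℝ (Fin N)) R,
      ‖fderiv ℝ φ y - fderiv ℝ φ x‖ ≤ M * ‖y - x‖ := by
    intro x hx y hy
    refine hconv.norm_image_sub_le_of_norm_fderiv_le (𝕜 := ℝ) (f := fderiv ℝ φ) ?_ ?_ hx hy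
    · intro p _
      exact hφ1.differentiable (by norm_num) p
    · intro p hp
      exact (hC p hp).trans (le_max_left _ _)
  have tay : ∀ x ∈ Metric.closedBall (0 : EuclideanSpace ℝ (Fin N)) R,
      ∀ y ∈ Metric.closedBall (0 : EuclideanSpace ℝ (Fin N)) R,
      ‖φ y - φ x - fderiv ℝ φ x (y - x)‖ ≤ M * ‖y - x‖ * ‖y - x‖ := by
    intro x hx y hy
    have hseg : segment ℝ x y ⊆ Metric.closedBall (0 : EuclideanSpace ℝ (Fin N)) R :=
      hconv.segment_subset hx hy
    refine (convex_segment x y).norm_image_sub_le_of_norm_fderiv_le' (𝕜 := ℝ) (f := φ) ?_ ?_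
      (left_mem_segment ℝ x y) (right_mem_segment ℝ x y)
    · intro p _
      exact hφ.differentiable (by norm_num) p
    · intro p hp
      refine (lip x hx p (hseg hp)).trans ?_
      gcongr
      exact norm_sub_le_of_mem_segment hp
  refine ⟨m / (2 * M), by positivity, ?_⟩
  intro y hy
  set r := m / (2 * M) with hr
  have hrpos : 0 < r := by positivity
  have hφy : 0 ≤ φ y := by
    have : y ∉ Ω := by
      rw [hΩo.frontier_eq] at hy; exact hy.2
    simpa [hΩ] using this
  set G := gradient φ y with hG
  have hGn : ‖G‖ = ‖fderiv ℝ φ y‖ := by simp [hG, gradient]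
  have hmG : m ≤ ‖G‖ := by rw [hGn]; exact hmin hy
  have hGpos : 0 < ‖G‖ := hmpos.trans_le hmG
  have hGi : ∀ p, fderiv ℝ φ y p = inner ℝ G p := by
    intro p; simp [hG, gradient]
  refine ⟨y + (r / ‖G‖) • G, ?_, ?_⟩
  · rw [dist_self_add_right, norm_smul, norm_div, norm_norm, Real.norm_of_nonneg hrpos.le]
    field_simp
  · intro w hw
    by_contra hlt
    push Not at hlt
    have hyR : y ∈ Metric.closedBall (0 : EuclideanSpace ℝ (Fin N)) R :=
      hR (frontier_subset_closure hy)
    have hwR : w ∈ Metric.closedBall (0 : EuclideanSpace ℝ (Fin N)) R :=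
      hR (subset_closure hw)
    have h1 := tay y hyR w hwR
    rw [Real.norm_eq_abs, hGi] at h1
    have h2 := (abs_le.mp h1).1
    have h3 : φ w < 0 := hw
    rw [dist_eq_norm, ← sub_sub] at hlt
    have h4 : ‖w - y - (r / ‖G‖) • G‖ ^ 2 < r ^ 2 := by
      gcongr
    rw [norm_sub_sq_real, norm_smul, inner_smul_right, norm_div, norm_norm,
      Real.norm_of_nonneg hrpos.le, div_mul_cancel₀ _ hGpos.ne', real_inner_comm] at h4
    have h5 : ‖w - y‖ ^ 2 < 2 * (r / ‖G‖) * inner ℝ G (w - y) := by linarith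
    have h6 : ‖w - y‖ ^ 2 * ‖G‖ < 2 * r * inner ℝ G (w - y) := by
      calc _ < 2 * (r / ‖G‖) * inner ℝ G (w - y) * ‖G‖ := by gcongr
        _ = _ := by field_simp
    have h7 : ‖w - y‖ ^ 2 * m ≤ ‖w - y‖ ^ 2 * ‖G‖ := by gcongr
    have h8 : m = 2 * M * r := by rw [hr]; field_simp
    have h9 : 2 * r * (M * ‖w - y‖ ^ 2) < 2 * r * inner ℝ G (w - y) := by
      rw [h8] at h7; linarith
    have h10 := lt_of_mul_lt_mul_left h9 (by positivity)
    nlinarith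

lemma touching {N : ℕ} (Ω : Set (EuclideanSpace ℝ (Fin N))) (hΩo : IsOpen Ω)
    (hΩb : Bornology.IsBounded Ω) (hne : (frontier Ω).Nonempty) (r : ℝ) (hr : 0 < r)
    (H : ∀ y ∈ frontier Ω, ∃ z, dist y z = r ∧ ∀ w ∈ Ω, r ≤ dist w z)
    (x : EuclideanSpace ℝ (Fin N)) (hx : x ∈ Ω) :
    0 < bdist Ω x ∧ Metric.ball x (bdist Ω x) ⊆ Ω ∧
    ∃ n : EuclideanSpace ℝ (Fin N), ‖n‖ = 1 ∧ ∀ v, x + v ∈ Ω →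
      bdist Ω (x + v) ≤ bdist Ω x + inner ℝ n v + ‖v‖ ^ 2 / (2 * r) := by
  have hcpt : IsCompact (frontier Ω) :=
    Metric.isCompact_of_isClosed_isBounded isClosed_frontier
      (hΩb.closure.subset frontier_subset_closure)
  have hball : ∀ y ∈ Ω, Metric.ball y (bdist Ω y) ⊆ Ω := by
    intro y hy
    have hdis : Disjoint (Metric.ball y (bdist Ω y)) (frontier Ω) := Metric.disjoint_ball_infDist
    by_cases hp : 0 < bdist Ω y
    · have hpc : IsPreconnected (Metric.ball y (bdist Ω y)) :=
        (convex_ball _ _).isPreconnected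
      refine hpc.subset_left_of_subset_union hΩo (isClosed_closure (s := Ω)).isOpen_compl ?_ ?_
        ⟨y, Metric.mem_ball_self hp, hy⟩
      · exact Set.disjoint_left.mpr fun p hp1 hp2 => hp2 (subset_closure hp1)
      · intro p hp1
        by_contra hp2
        rw [Set.mem_union, not_or, Set.mem_compl_iff, not_not] at hp2
        refine Set.disjoint_left.mp hdis hp1 ?_
        rw [hΩo.frontier_eq]
        exact ⟨hp2.2, hp2.1⟩
    · rw [Metric.ball_eq_empty.mpr (not_lt.mp hp)]; simp
  have hpos : 0 < bdist Ω x := by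
    refine (isClosed_frontier.notMem_iff_infDist_pos hne).mp ?_
    intro h
    rw [hΩo.frontier_eq] at h
    exact h.2 hx
  refine ⟨hpos, hball x hx, ?_⟩
  obtain ⟨y, hy, hxy⟩ := hcpt.exists_infDist_eq_dist hne x
  obtain ⟨z, hyz, hz⟩ := H y hy
  have key : ∀ w ∈ Ω, bdist Ω w + r ≤ dist w z := by
    intro w hw
    by_contra hlt
    push Not at hlt
    have hni : ¬ Disjoint (Metric.ball w (bdist Ω w)) (Metric.ball z r) := by
      by_cases hp : 0 < bdist Ω w
      · rw [disjoint_ball_ball_iff hp hr]; exact not_le.mpr hlt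
      · have := hz w hw
        linarith
    rw [Set.not_disjoint_iff] at hni
    obtain ⟨p, hp1, hp2⟩ := hni
    exact absurd (hz p (hball w hw hp1)) (not_le.mpr hp2)
  set R := bdist Ω x + r with hR
  have hRpos : 0 < R := by positivity
  have hxz : dist x z = R := by
    refine le_antisymm ?_ (key x hx)
    calc dist x z ≤ dist x y + dist y z := dist_triangle _ _ _
      _ = R := by rw [hyz, ← hxy]; rfl
  refine ⟨R⁻¹ • (x - z), ?_, ?_⟩
  · rw [norm_smul, ← dist_eq_norm, hxz, norm_inv, Real.norm_of_nonneg hRpos.le,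
      inv_mul_cancel₀ hRpos.ne']
  · intro v hv
    have h1 := key _ hv
    rw [inner_smul_left]
    simp only [conj_trivial]
    rw [dist_eq_norm] at h1 hxz
    have h2 : ‖x + v - z‖ ^ 2 = R ^ 2 + 2 * inner ℝ (x - z) v + ‖v‖ ^ 2 := by
      rw [← hxz, ← norm_add_sq_real]; congr 2; abel
    set I : ℝ := inner ℝ (x - z) v
    have h3 : ‖x + v - z‖ ≤ R + R⁻¹ * I + ‖v‖ ^ 2 / (2 * R) := by
      have : R * ‖x + v - z‖ ≤ (R ^ 2 + ‖x + v - z‖ ^ 2) / 2 := by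
        nlinarith [sq_nonneg (R - ‖x + v - z‖)]
      rw [h2] at this
      have h4 : R * (R + R⁻¹ * I + ‖v‖ ^ 2 / (2 * R)) =
        (R ^ 2 + (R ^ 2 + 2 * I + ‖v‖ ^ 2)) / 2 := by field_simp; ring
      rw [← h4] at this
      exact le_of_mul_le_mul_left this hRpos
    have h5 : ‖v‖ ^ 2 / (2 * R) ≤ ‖v‖ ^ 2 / (2 * r) := by
      gcongr; rw [hR]; linarith
    linarith
lemma log_quad (K p q s : ℝ) (hK : 1 ≤ K) (hp : |p| ≤ K) (hq : |q| ≤ K) (hs : |s| ≤ 1 / (4 * K)) :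
    |log (1 + (p * s + q * s ^ 2)) - (p * s + (q - p ^ 2 / 2) * s ^ 2)| ≤ 18 * K ^ 3 * |s| ^ 3 := by
  have hs1 : 4 * K * |s| ≤ 1 := by
    rw [le_div_iff₀ (by positivity)] at hs; linarith
  have hs0 := abs_nonneg s
  have hs2 : |s| ≤ 1 := by nlinarith
  set y := p * s + q * s ^ 2 with hy
  have hps : |p * s| ≤ K * |s| := by rw [abs_mul]; gcongr
  have hqs : |q * s ^ 2| ≤ K * |s| ^ 2 := by rw [abs_mul, abs_pow]; gcongr
  have hss : |s| ^ 2 ≤ |s| := by nlinarith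
  have hy2 : |y| ≤ 2 * K * |s| := by
    refine (abs_add_le _ _).trans ?_
    nlinarith
  have hyh : |y| ≤ 1 / 2 := by linarith
  have h := abs_log_sub_add_sum_range_le (x := -y) (by rw [abs_neg]; linarith) 2
  simp only [Finset.sum_range_succ, Finset.sum_range_zero, abs_neg, sub_neg_eq_add] at h
  norm_num at h
  have h1 : |y| ^ 3 / (1 - |y|) ≤ 2 * |y| ^ 3 := by
    rw [div_le_iff₀ (by linarith)]
    have : 0 ≤ |y| ^ 3 := by positivity
    nlinarith
  have h2 : |y| ^ 3 ≤ 8 * K ^ 3 * |s| ^ 3 := by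
    calc |y| ^ 3 ≤ (2 * K * |s|) ^ 3 := by gcongr
      _ = _ := by ring
  have h3 : |(p * s) * (q * s ^ 2)| ≤ K ^ 2 * |s| ^ 3 := by
    rw [abs_mul]
    calc _ ≤ (K * |s|) * (K * |s| ^ 2) := by gcongr
      _ = _ := by ring
  have h4 : |(q * s ^ 2) ^ 2| ≤ K ^ 2 * |s| ^ 3 := by
    rw [abs_pow]
    calc _ ≤ (K * |s| ^ 2) ^ 2 := by gcongr
      _ = K ^ 2 * |s| ^ 3 * |s| := by ring
      _ ≤ K ^ 2 * |s| ^ 3 * 1 := by gcongr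
      _ = _ := by ring
  have h5 : K ^ 2 * |s| ^ 3 ≤ K ^ 3 * |s| ^ 3 := by
    gcongr
    · norm_num
  have e : log (1 + y) - (p * s + (q - p ^ 2 / 2) * s ^ 2) =
      (-y + y ^ 2 / 2 + log (1 + y)) - (p * s) * (q * s ^ 2) - (q * s ^ 2) ^ 2 / 2 := by
    rw [hy]; ring
  rw [e]
  have h' := h.trans h1
  rw [abs_le] at *
  constructor <;> linarith [h'.1, h'.2, h3.1, h3.2, h4.1, h4.2]

lemma exp_quad (K α β h X Y : ℝ) (hK : 1 ≤ K) (hα : |α| ≤ K) (hβ : |β| ≤ K)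
    (h0 : 0 < h) (hh : h ≤ 1 / (3 * K))
    (hX : X ≤ α * h + β * h ^ 2 + K * h ^ 3) (hY : Y ≤ - α * h + β * h ^ 2 + K * h ^ 3) :
    exp X + exp Y - 2 ≤ (2 * β + α ^ 2) * h ^ 2 + 64 * K ^ 3 * h ^ 3 := by
  have hs1 : 3 * K * h ≤ 1 := by
    rw [le_div_iff₀ (by positivity)] at hh; linarith
  have hh1 : h ≤ 1 := by nlinarith
  have key : ∀ A, |A| ≤ K → exp (A * h + β * h ^ 2 + K * h ^ 3) ≤
      1 + A * h + (β + A ^ 2 / 2) * h ^ 2 + 32 * K ^ 3 * h ^ 3 := by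
    intro A hA
    have a1 : |A * h| ≤ K * h := by rw [abs_mul, abs_of_pos h0]; gcongr
    have a2 : |β * h ^ 2 + K * h ^ 3| ≤ 2 * K * h ^ 2 := by
      refine (abs_add_le _ _).trans ?_
      rw [abs_mul, abs_of_pos (by positivity : 0 < h ^ 2),
        abs_of_pos (by positivity : 0 < K * h ^ 3)]
      have : |β| * h ^ 2 ≤ K * h ^ 2 := by gcongr
      have : K * h ^ 3 ≤ K * h ^ 2 := by
        gcongr 1
        nlinarith [sq_nonneg h]
      linarith
    set B := β * h ^ 2 + K * h ^ 3 with hB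
    have e : A * h + β * h ^ 2 + K * h ^ 3 = A * h + B := by rw [hB]; ring
    rw [e]
    have hh2 : h ^ 2 ≤ h := by nlinarith
    have a3 : |A * h + B| ≤ 3 * K * h := by
      refine (abs_add_le _ _).trans ?_
      nlinarith
    have b := Real.exp_bound (x := A * h + B) (by linarith) (n := 3) (by norm_num)
    simp only [Finset.sum_range_succ, Finset.sum_range_zero] at b
    norm_num [Nat.factorial] at b
    have b1 := (abs_le.mp b).2
    have a4 : |A * h + B| ^ 3 ≤ 27 * K ^ 3 * h ^ 3 := by
      calc _ ≤ (3 * K * h) ^ 3 := by gcongr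
        _ = _ := by ring
    have a5 : (A * h) * B ≤ 2 * K ^ 2 * h ^ 3 := by
      refine (le_abs_self _).trans ?_
      rw [abs_mul]
      calc _ ≤ (K * h) * (2 * K * h ^ 2) := by gcongr
        _ = _ := by ring
    have a6 : B ^ 2 ≤ 4 * K ^ 2 * h ^ 3 := by
      rw [← sq_abs]
      calc _ ≤ (2 * K * h ^ 2) ^ 2 := by gcongr
        _ = 4 * K ^ 2 * h ^ 3 * h := by ring
        _ ≤ 4 * K ^ 2 * h ^ 3 * 1 := by gcongr
        _ = _ := by ring
    have a7 : K ^ 2 * h ^ 3 ≤ K ^ 3 * h ^ 3 := by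
      gcongr
      · norm_num
    have a8 : K * h ^ 3 ≤ K ^ 3 * h ^ 3 := by
      gcongr
      exact le_self_pow₀ hK (by norm_num)
    nlinarith
  have k1 := (exp_le_exp.mpr hX).trans (key α hα)
  have k2 := (exp_le_exp.mpr hY).trans (key (-α) (by rwa [abs_neg]))
  nlinarith

lemma dir_est (a c K0 p1 q1 p2 q2 ν b h X Y : ℝ) (ha : 0 ≤ a) (hc : 0 ≤ c) (hK : 1 ≤ K0)
    (hp1 : |p1| ≤ K0) (hq1 : |q1| ≤ K0) (hp2 : |p2| ≤ K0) (hq2 : |q2| ≤ K0)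
    (hν : |ν| ≤ K0) (hb : |b| ≤ K0) (h0 : 0 < h)
    (hh : h ≤ 1 / (3 * (18 * (a + 1 + c) * K0 ^ 3)))
    (hX : X ≤ -(a / 2) * log (1 + (p1 * h + q1 * h ^ 2)) + 1 / 2 * log (1 + (p2 * h + q2 * h ^ 2))
      - c * (ν * h + b * h ^ 2))
    (hY : Y ≤ -(a / 2) * log (1 + (p1 * (-h) + q1 * (-h) ^ 2))
      + 1 / 2 * log (1 + (p2 * (-h) + q2 * (-h) ^ 2)) - c * (ν * (-h) + b * (-h) ^ 2)) :
    exp X + exp Y - 2 ≤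
      (-a * (q1 - p1 ^ 2 / 2) + (q2 - p2 ^ 2 / 2) - 2 * c * b +
        (-(a / 2) * p1 + p2 / 2 - c * ν) ^ 2) * h ^ 2
        + 64 * (18 * (a + 1 + c) * K0 ^ 3) ^ 3 * h ^ 3 := by
  set K := 18 * (a + 1 + c) * K0 ^ 3 with hKdef
  have hK2 : K0 ≤ K0 ^ 2 := by nlinarith
  have hK3 : K0 ^ 2 ≤ K0 ^ 3 := by nlinarith [sq_nonneg K0]
  have hK31 : 1 ≤ K0 ^ 3 := by linarith
  have e1 : K = 18 * (a * K0 ^ 3) + 18 * K0 ^ 3 + 18 * (c * K0 ^ 3) := by rw [hKdef]; ring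
  have aK : a * K0 ≤ a * K0 ^ 3 := by gcongr; linarith
  have aK2 : a * K0 ^ 2 ≤ a * K0 ^ 3 := by gcongr
  have cK : c * K0 ≤ c * K0 ^ 3 := by gcongr; linarith
  have az : 0 ≤ a * K0 ^ 3 := by positivity
  have cz : 0 ≤ c * K0 ^ 3 := by positivity
  have hK1 : 1 ≤ K := by linarith
  have hh4 : h ≤ 1 / (4 * K0) := by
    refine hh.trans ?_
    gcongr 1 / ?_
    linarith
  have habs : |h| = h := abs_of_pos h0
  have hnabs : |(-h)| = h := by rw [abs_neg, habs]
  have sqb : ∀ p q : ℝ, |p| ≤ K0 → |q| ≤ K0 → |q - p ^ 2 / 2| ≤ 2 * K0 ^ 2 := by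
    intro p q hp hq
    have : p ^ 2 ≤ K0 ^ 2 := by rw [← sq_abs]; gcongr
    rw [abs_le] at *
    constructor <;> nlinarith [sq_nonneg p]
  have s1 := sqb p1 q1 hp1 hq1
  have s2 := sqb p2 q2 hp2 hq2
  have m1 : |a * p1| ≤ a * K0 := by rw [abs_mul, abs_of_nonneg ha]; gcongr
  have m2 : |c * ν| ≤ c * K0 := by rw [abs_mul, abs_of_nonneg hc]; gcongr
  have m3 : |c * b| ≤ c * K0 := by rw [abs_mul, abs_of_nonneg hc]; gcongr
  have m4 : |a * (q1 - p1 ^ 2 / 2)| ≤ a * (2 * K0 ^ 2) := by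
    rw [abs_mul, abs_of_nonneg ha]; gcongr
  have G := exp_quad K (-(a / 2) * p1 + p2 / 2 - c * ν)
    (-(a / 2) * (q1 - p1 ^ 2 / 2) + (q2 - p2 ^ 2 / 2) / 2 - c * b) h X Y hK1 ?_ ?_ h0 hh ?_ ?_
  · refine G.trans (le_of_eq ?_)
    ring
  · rw [abs_le] at *
    constructor <;> linarith [m1.1, m1.2, m2.1, m2.2, hp2.1, hp2.2]
  · rw [abs_le] at *
    constructor <;> linarith [m4.1, m4.2, m3.1, m3.2, s2.1, s2.2]
  · have l1 := log_quad K0 p1 q1 h hK hp1 hq1 (by rw [habs]; exact hh4)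
    have l2 := log_quad K0 p2 q2 h hK hp2 hq2 (by rw [habs]; exact hh4)
    rw [habs] at l1 l2
    have l1' := mul_le_mul_of_nonneg_left (abs_le.mp l1).1 ha
    have l2' := (abs_le.mp l2).2
    have c0 : 0 ≤ c * K0 ^ 3 * h ^ 3 := by positivity
    have c1 : 0 ≤ a * K0 ^ 3 * h ^ 3 := by positivity
    have c2 : 0 ≤ K0 ^ 3 * h ^ 3 := by positivity
    rw [e1]
    linarith
  · have l1 := log_quad K0 p1 q1 (-h) hK hp1 hq1 (by rw [hnabs]; exact hh4)
    have l2 := log_quad K0 p2 q2 (-h) hK hp2 hq2 (by rw [hnabs]; exact hh4)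
    rw [hnabs] at l1 l2
    have l1' := mul_le_mul_of_nonneg_left (abs_le.mp l1).1 ha
    have l2' := (abs_le.mp l2).2
    have c0 : 0 ≤ c * K0 ^ 3 * h ^ 3 := by positivity
    have c1 : 0 ≤ a * K0 ^ 3 * h ^ 3 := by positivity
    have c2 : 0 ≤ K0 ^ 3 * h ^ 3 := by positivity
    rw [e1]
    linarith

lemma prof_mono (c s t : ℝ) (hs : 0 < s) (hst : s ≤ t) (ht : 2 * c * t ≤ 1) :
    1 / 2 * log s - c * s ≤ 1 / 2 * log t - c * t := by
  have ht0 : 0 < t := hs.trans_le hst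
  have h := one_sub_inv_le_log_of_pos (div_pos ht0 hs)
  rw [log_div ht0.ne' hs.ne', inv_div] at h
  have h2 : 2 * c * (t - s) ≤ 1 - s / t := by
    have : 1 - s / t = (t - s) / t := by field_simp
    rw [this, le_div_iff₀ ht0]
    nlinarith
  linarith

lemma sum_case1 {N : ℕ} (a c r r0 δ t : ℝ) (x n : EuclideanSpace ℝ (Fin N)) (ha : 0 ≤ a)
    (hN : (N : ℝ) = 2 * a + 2) (hr : 0 < r) (hr0 : 0 < r0) (hδ : 0 < δ) (ht : 0 < t)
    (hc : c = N / r + 2 * a / r0) (htc : 2 * c * t ≤ 1) (hn : ‖n‖ = 1) (hx : r0 ≤ ‖x‖) :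
    ∑ i, (-a * (1 / (‖x‖ ^ 2 + δ) - (2 * x i / (‖x‖ ^ 2 + δ)) ^ 2 / 2)
      + (1 / (2 * r * t) - (n i / t) ^ 2 / 2) - 2 * c * (1 / (2 * r)) +
      (-(a / 2) * (2 * x i / (‖x‖ ^ 2 + δ)) + n i / t / 2 - c * n i) ^ 2) ≤
      - (a ^ 2 / (‖x‖ ^ 2 + δ) + 1 / (4 * t ^ 2)) := by
  set S := ‖x‖ ^ 2 + δ with hS
  have hSpos : 0 < S := by positivity
  set g := 1 / (2 * t) - c with hg
  have hg0 : 0 ≤ g := by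
    rw [hg, sub_nonneg, le_div_iff₀ (by positivity)]; linarith
  have hcpos : 0 ≤ c := by rw [hc]; positivity
  have hxx : ∑ i, x i ^ 2 = ‖x‖ ^ 2 := by rw [EuclideanSpace.norm_sq_eq]; simp
  have hnn : ∑ i, n i ^ 2 = 1 := by
    have : ‖n‖ ^ 2 = ∑ i, n i ^ 2 := by rw [EuclideanSpace.norm_sq_eq]; simp
    rw [← this, hn]; norm_num
  have hxn : ∑ i, x i * n i = inner ℝ n x := by
    rw [PiLp.inner_apply]; simp
  have e : ∀ i, (-a * (1 / S - (2 * x i / S) ^ 2 / 2)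
      + (1 / (2 * r * t) - (n i / t) ^ 2 / 2) - 2 * c * (1 / (2 * r)) +
      (-(a / 2) * (2 * x i / S) + n i / t / 2 - c * n i) ^ 2) =
      (- a / S + g / r) + ((2 * a + a ^ 2) / S ^ 2) * x i ^ 2 + (- 2 * a * g / S) * (x i * n i)
       + (g ^ 2 - 1 / (2 * t ^ 2)) * n i ^ 2 := by
    intro i; rw [hg]; field_simp; ring
  simp_rw [e]
  rw [Finset.sum_add_distrib, Finset.sum_add_distrib, Finset.sum_add_distrib, ← Finset.mul_sum,
    ← Finset.mul_sum, ← Finset.mul_sum, hxx, hnn, hxn]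
  simp only [Finset.sum_const, Finset.card_univ, Fintype.card_fin, nsmul_eq_mul]
  have i1 : (2 * a + a ^ 2) / S ^ 2 * ‖x‖ ^ 2 ≤ (2 * a + a ^ 2) / S := by
    rw [div_mul_eq_mul_div, div_le_div_iff₀ (by positivity) hSpos]
    have : ‖x‖ ^ 2 ≤ S := by rw [hS]; linarith
    calc _ ≤ (2 * a + a ^ 2) * S * S := by gcongr
      _ = _ := by ring
  have i2 : -2 * a * g / S * inner ℝ n x ≤ 2 * a * g / r0 := by
    have h1 : |inner ℝ n x| ≤ ‖x‖ := by
      have := abs_real_inner_le_norm n x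
      rwa [hn, one_mul] at this
    have h2 : - inner ℝ n x / S ≤ 1 / r0 := by
      rw [div_le_div_iff₀ hSpos hr0]
      have := (abs_le.mp h1).1
      have h3 : - inner ℝ n x * r0 ≤ ‖x‖ * ‖x‖ := by
        calc _ ≤ ‖x‖ * r0 := by gcongr; linarith
          _ ≤ _ := by gcongr
      rw [hS]; nlinarith
    calc _ = 2 * a * g * (- inner ℝ n x / S) := by ring
      _ ≤ 2 * a * g * (1 / r0) := by gcongr
      _ = _ := by ring
  have i3 : (N : ℝ) * (g / r) + 2 * a * g / r0 = c * g := by rw [hc]; ring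
  have i4 : (g ^ 2 - 1 / (2 * t ^ 2)) + c * g ≤ - (1 / (4 * t ^ 2)) := by
    have h1 : g ^ 2 - 1 / (2 * t ^ 2) + c * g + 1 / (4 * t ^ 2) = - (c * (1 / (2 * t))) := by
      rw [hg]; field_simp; ring
    have : 0 ≤ c * (1 / (2 * t)) := by positivity
    linarith
  have i5 : (N : ℝ) * (- a / S) + (2 * a + a ^ 2) / S = - (a ^ 2 / S) := by
    rw [hN]; field_simp; ring
  linarith

lemma sum_case2 {N : ℕ} (a c δ : ℝ) (x : EuclideanSpace ℝ (Fin N)) (ha : 0 ≤ a)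
    (hN : (N : ℝ) = 2 * a + 2) (hδ : 0 < δ) :
    ∑ i, (-a * (1 / (‖x‖ ^ 2 + δ) - (2 * x i / (‖x‖ ^ 2 + δ)) ^ 2 / 2)
      + (0 - (0:ℝ) ^ 2 / 2) - 2 * c * 0 +
      (-(a / 2) * (2 * x i / (‖x‖ ^ 2 + δ)) + 0 / 2 - c * 0) ^ 2) ≤
      - (a ^ 2 / (‖x‖ ^ 2 + δ)) := by
  set S := ‖x‖ ^ 2 + δ with hS
  have hSpos : 0 < S := by positivity
  have hxx : ∑ i, x i ^ 2 = ‖x‖ ^ 2 := by rw [EuclideanSpace.norm_sq_eq]; simp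
  have e : ∀ i, (-a * (1 / S - (2 * x i / S) ^ 2 / 2)
      + (0 - (0:ℝ) ^ 2 / 2) - 2 * c * 0 +
      (-(a / 2) * (2 * x i / S) + 0 / 2 - c * 0) ^ 2) =
      (- a / S) + ((2 * a + a ^ 2) / S ^ 2) * x i ^ 2 := by
    intro i; field_simp; ring
  simp_rw [e]
  rw [Finset.sum_add_distrib, ← Finset.mul_sum, hxx]
  simp only [Finset.sum_const, Finset.card_univ, Fintype.card_fin, nsmul_eq_mul]
  have i1 : (2 * a + a ^ 2) / S ^ 2 * ‖x‖ ^ 2 ≤ (2 * a + a ^ 2) / S := by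
    rw [div_mul_eq_mul_div, div_le_div_iff₀ (by positivity) hSpos]
    have : ‖x‖ ^ 2 ≤ S := by rw [hS]; linarith
    calc _ ≤ (2 * a + a ^ 2) * S * S := by gcongr
      _ = _ := by ring
  have i5 : (N : ℝ) * (- a / S) + (2 * a + a ^ 2) / S = - (a ^ 2 / S) := by
    rw [hN]; field_simp; ring
  linarith

def Wfun {N : ℕ} (Ω : Set (EuclideanSpace ℝ (Fin N))) (a δ c m' t1 : ℝ)
    (y : EuclideanSpace ℝ (Fin N)) : ℝ :=
  -(a / 2) * log (‖y‖ ^ 2 + δ) +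
    (1 / 2 * log (min (max (bdist Ω y) m') t1) - c * min (max (bdist Ω y) m') t1)

lemma Wfun_cont {N : ℕ} (Ω : Set (EuclideanSpace ℝ (Fin N))) (a δ c m' t1 : ℝ) (hδ : 0 < δ)
    (hm : 0 < m') (ht : 0 < t1) : Continuous (Wfun Ω a δ c m' t1) := by
  have hb : Continuous (bdist Ω) := Metric.continuous_infDist_pt _
  have hT : Continuous fun y => min (max (bdist Ω y) m') t1 := by fun_prop
  have hT0 : ∀ y, min (max (bdist Ω y) m') t1 ≠ 0 := fun y =>
    (lt_min (lt_max_of_lt_right hm) ht).ne'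
  have hS : Continuous fun y : EuclideanSpace ℝ (Fin N) => ‖y‖ ^ 2 + δ := by fun_prop
  have hS0 : ∀ y : EuclideanSpace ℝ (Fin N), ‖y‖ ^ 2 + δ ≠ 0 := fun y => by positivity
  exact (continuous_const.mul (hS.log hS0)).add
    ((continuous_const.mul (hT.log hT0)).sub (continuous_const.mul hT))

lemma log_part {N : ℕ} (a δ s : ℝ) (hδ : 0 < δ) (x : EuclideanSpace ℝ (Fin N)) (i : Fin N) :
    -(a / 2) * log (‖x + s • EuclideanSpace.single i (1:ℝ)‖ ^ 2 + δ) - -(a / 2) * log (‖x‖ ^ 2 + δ) =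
      -(a / 2) * log (1 + (2 * x i / (‖x‖ ^ 2 + δ) * s + 1 / (‖x‖ ^ 2 + δ) * s ^ 2)) := by
  have hS : 0 < ‖x‖ ^ 2 + δ := by positivity
  have hS' : 0 < ‖x + s • EuclideanSpace.single i (1:ℝ)‖ ^ 2 + δ := by positivity
  have e : 1 + (2 * x i / (‖x‖ ^ 2 + δ) * s + 1 / (‖x‖ ^ 2 + δ) * s ^ 2) =
      (‖x + s • EuclideanSpace.single i (1:ℝ)‖ ^ 2 + δ) / (‖x‖ ^ 2 + δ) := by
    rw [norm_add_sq_real, inner_smul_right, EuclideanSpace.inner_single_right, norm_smul]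
    simp
    field_simp
    ring
  rw [e, log_div hS'.ne' hS.ne']
  ring

set_option maxHeartbeats 1000000 in
lemma point_est {N : ℕ} (Ω : Set (EuclideanSpace ℝ (Fin N))) (a c r r0 δ m t1 ε h : ℝ)
    (ha : 0 ≤ a) (hN : (N : ℝ) = 2 * a + 2) (hr : 0 < r) (hr0 : 0 < r0) (hδ : 0 < δ)
    (hm : 0 < m) (ht1 : 0 < t1)
    (hc : c = N / r + 2 * a / r0) (htc : 4 * c * t1 ≤ 1) (hε : ε ≤ t1)
    (h0 : 0 < h) (hhm : h < m / 2) (hhc : 8 * c * h ≤ 1) (hhr : h ≤ 2 * r)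
    (hhK : h ≤ 1 / (3 * (18 * (a + 1 + c) * (1 + 1 / δ + 1 / m + 1 / (2 * r * m) + 1 / (2 * r)) ^ 3)))
    (x : EuclideanSpace ℝ (Fin N)) (hxm : m ≤ bdist Ω x) (hxr : bdist Ω x < t1 → r0 ≤ ‖x‖)
    (hball : Metric.ball x (bdist Ω x) ⊆ Ω)
    (n : EuclideanSpace ℝ (Fin N)) (hn : ‖n‖ = 1)
    (htouch : ∀ v, x + v ∈ Ω →
      bdist Ω (x + v) ≤ bdist Ω x + inner ℝ n v + ‖v‖ ^ 2 / (2 * r)) :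
    ∑ i, (exp (Wfun Ω a δ c (m / 2) t1 (x + h • EuclideanSpace.single i 1)
          - Wfun Ω a δ c (m / 2) t1 x) +
        exp (Wfun Ω a δ c (m / 2) t1 (x - h • EuclideanSpace.single i 1)
          - Wfun Ω a δ c (m / 2) t1 x) - 2) ≤
      - (if ε ≤ bdist Ω x then a ^ 2 / (‖x‖ ^ 2 + δ) else 1 / (4 * bdist Ω x ^ 2)) * h ^ 2 +
      (N * (64 * (18 * (a + 1 + c) *
        (1 + 1 / δ + 1 / m + 1 / (2 * r * m) + 1 / (2 * r)) ^ 3) ^ 3)) * h ^ 3 := by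
  have hNpos : (0:ℝ) < N := by rw [hN]; linarith
  have hcpos : 0 < c := by
    rw [hc]; have : 0 < (N:ℝ) / r := by positivity
    have : 0 ≤ 2 * a / r0 := by positivity
    linarith
  set t := bdist Ω x with ht
  have htpos : 0 < t := hm.trans_le hxm
  set S := ‖x‖ ^ 2 + δ with hS
  have hSpos : 0 < S := by positivity
  have hδS : δ ≤ S := by rw [hS]; nlinarith [sq_nonneg ‖x‖]
  set K0 := 1 + 1 / δ + 1 / m + 1 / (2 * r * m) + 1 / (2 * r) with hK0
  have z1 : 0 < 1 / δ := by positivity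
  have z2 : 0 < 1 / m := by positivity
  have z3 : 0 < 1 / (2 * r * m) := by positivity
  have z4 : 0 < 1 / (2 * r) := by positivity
  have hK01 : 1 ≤ K0 := by linarith
  have bq1 : |1 / S| ≤ K0 := by
    rw [abs_of_pos (by positivity)]
    have : 1 / S ≤ 1 / δ := by gcongr
    linarith
  have hxi : ∀ i, |x i| ≤ ‖x‖ := fun i => by simpa using PiLp.norm_apply_le x i
  have hni : ∀ i, |n i| ≤ 1 := fun i => by
    rw [← hn]; simpa using PiLp.norm_apply_le n i
  have bp1 : ∀ i, |2 * x i / S| ≤ K0 := by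
    intro i
    rw [abs_div, abs_mul, abs_of_pos hSpos, abs_two]
    have : 2 * |x i| ≤ 1 + S := by
      rw [hS]; nlinarith [hxi i, sq_nonneg (‖x‖ - 1)]
    calc 2 * |x i| / S ≤ (1 + S) / S := by gcongr
      _ = 1 / S + 1 := by field_simp
      _ ≤ 1 / δ + 1 := by gcongr
      _ ≤ K0 := by linarith
  have hTx : max t (m / 2) = t := max_eq_left (by linarith)
  -- membership
  have hmem : ∀ s : ℝ, |s| = h → ∀ i, x + s • EuclideanSpace.single i (1:ℝ) ∈ Ω := by
    intro s hs i
    apply hball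
    rw [Metric.mem_ball, dist_self_add_left, norm_smul]
    simp only [norm_eq_abs, PiLp.norm_single, abs_one, mul_one, hs]
    linarith
  have hnrm : ∀ s : ℝ, |s| = h → ∀ i : Fin N, ‖s • EuclideanSpace.single i (1:ℝ)‖ = h := by
    intro s hs i
    rw [norm_smul]; simp [hs]
  have hsub : ∀ i, x - h • EuclideanSpace.single i (1:ℝ) = x + (-h) • EuclideanSpace.single i (1:ℝ) := by
    intro i; rw [neg_smul, sub_eq_add_neg]
  have habs : |h| = h := abs_of_pos h0
  have hnabs : |(-h)| = h := by rw [abs_neg, habs]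
  have fin : ∀ (A U : ℝ) (f : Fin N → ℝ) (C : ℝ), ∑ i, f i ≤ A → U ≤ - A →
      ∑ i : Fin N, (f i * h ^ 2 + C * h ^ 3) ≤ - U * h ^ 2 + (N * C) * h ^ 3 := by
    intro A U f C hf hU
    rw [Finset.sum_add_distrib, ← Finset.sum_mul]
    simp only [Finset.sum_const, Finset.card_univ, Fintype.card_fin, nsmul_eq_mul]
    have : (∑ i, f i) * h ^ 2 ≤ - U * h ^ 2 := by gcongr; linarith
    linarith
  by_cases hcase : t < t1
  · have hprof : ∀ s : ℝ, |s| = h → ∀ i,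
        Wfun Ω a δ c (m / 2) t1 (x + s • EuclideanSpace.single i 1)
          - Wfun Ω a δ c (m / 2) t1 x ≤
        -(a / 2) * log (1 + (2 * x i / S * s + 1 / S * s ^ 2))
          + 1 / 2 * log (1 + (n i / t * s + 1 / (2 * r * t) * s ^ 2))
          - c * (n i * s + 1 / (2 * r) * s ^ 2) := by
      intro s hs i
      have hl := log_part a δ s hδ x i
      rw [← hS] at hl
      have htc' := htouch _ (hmem s hs i)
      have hs2 : s ^ 2 = h ^ 2 := by rw [← sq_abs, hs]
      rw [hnrm s hs i, inner_smul_right, EuclideanSpace.inner_single_right] at htc'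
      simp only [conj_trivial, one_mul] at htc'
      set y := x + s • EuclideanSpace.single i (1:ℝ) with hy
      set σ := n i * s + 1 / (2 * r) * s ^ 2 with hσ
      have hyσ : bdist Ω y ≤ t + σ := by
        rw [hσ, hs2]; convert htc' using 1; ring
      have hylow : m / 2 ≤ bdist Ω y := by
        have := Metric.infDist_le_infDist_add_dist (s := frontier Ω) (x := x) (y := y)
        rw [hy, dist_self_add_right, hnrm s hs i] at this
        have h1 : t ≤ bdist Ω y + h := this
        linarith
      have hσup : σ ≤ 2 * h := by
        have h1 : n i * s ≤ h := by
          calc n i * s ≤ |n i * s| := le_abs_self _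
            _ = |n i| * h := by rw [abs_mul, hs]
            _ ≤ 1 * h := by gcongr; exact hni i
            _ = h := one_mul h
        have h2 : 1 / (2 * r) * s ^ 2 ≤ h := by
          rw [hs2, div_mul_eq_mul_div, div_le_iff₀ (by positivity)]
          nlinarith
        linarith
      have hTy : max (bdist Ω y) (m / 2) = bdist Ω y := max_eq_left hylow
      have htcσ : 2 * c * (t + σ) ≤ 1 := by
        have g1 : c * t ≤ c * t1 := by gcongr
        have g2 : c * σ ≤ c * (2 * h) := by gcongr
        linarith
      have hmono := prof_mono c (min (bdist Ω y) t1) (t + σ)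
        (lt_min (by linarith) ht1) ((min_le_left _ _).trans hyσ) htcσ
      have htσ : 0 < t + σ := by linarith
      have elog : log (1 + (n i / t * s + 1 / (2 * r * t) * s ^ 2)) = log (t + σ) - log t := by
        rw [← log_div htσ.ne' htpos.ne']
        congr 1
        rw [hσ]; field_simp
      unfold Wfun
      rw [← ht, hTx, hTy, min_eq_left hcase.le, elog, ← hS]
      linarith
    have bp2 : ∀ i, |n i / t| ≤ K0 := by
      intro i
      rw [abs_div, abs_of_pos htpos]
      calc |n i| / t ≤ 1 / m := by gcongr; exact hni i
        _ ≤ K0 := by linarith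
    have bq2 : |1 / (2 * r * t)| ≤ K0 := by
      rw [abs_of_pos (by positivity)]
      calc 1 / (2 * r * t) ≤ 1 / (2 * r * m) := by gcongr
        _ ≤ K0 := by linarith
    have htct : 2 * c * t ≤ 1 := by
      have g1 : c * t ≤ c * t1 := by gcongr
      have g2 : 0 < c * t1 := by positivity
      linarith
    have hsum := sum_case1 a c r r0 δ t x n ha hN hr hr0 hδ htpos hc htct hn (hxr hcase)
    refine le_trans (Finset.sum_le_sum fun i _ => ?_)
      (fin _ _ _ (64 * (18 * (a + 1 + c) * K0 ^ 3) ^ 3) hsum ?_)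
    · rw [hsub]
      exact dir_est a c K0 _ _ _ _ (n i) (1 / (2 * r)) h _ _ ha hcpos.le hK01 (bp1 i) bq1 (bp2 i) bq2
        ((hni i).trans hK01) (by rw [abs_of_pos z4]; linarith) h0 hhK
        (hprof h habs i) (hprof (-h) hnabs i)
    · rw [neg_neg]
      have y1 : 0 ≤ a ^ 2 / S := by positivity
      have y2 : 0 ≤ 1 / (4 * t ^ 2) := by positivity
      split_ifs <;> linarith
  · push Not at hcase
    have htct1 : 2 * c * t1 ≤ 1 := by
      have g2 : 0 < c * t1 := by positivity
      linarith
    have hprof : ∀ s : ℝ, |s| = h → ∀ i,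
        Wfun Ω a δ c (m / 2) t1 (x + s • EuclideanSpace.single i 1)
          - Wfun Ω a δ c (m / 2) t1 x ≤
        -(a / 2) * log (1 + (2 * x i / S * s + 1 / S * s ^ 2))
          + 1 / 2 * log (1 + (0 * s + 0 * s ^ 2))
          - c * (0 * s + 0 * s ^ 2) := by
      intro s hs i
      have hl := log_part a δ s hδ x i
      rw [← hS] at hl
      have hmono := prof_mono c
        (min (max (bdist Ω (x + s • EuclideanSpace.single i (1:ℝ))) (m / 2)) t1) t1
        (lt_min (lt_max_of_lt_right (by linarith)) ht1) (min_le_right _ _) htct1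
      unfold Wfun
      rw [← ht, hTx, min_eq_right hcase, ← hS]
      simp only [zero_mul, add_zero, log_one, mul_zero, sub_zero]
      linarith
    have hsum := sum_case2 a c δ x ha hN hδ
    have z0 : |(0:ℝ)| ≤ K0 := by rw [abs_zero]; linarith
    refine le_trans (Finset.sum_le_sum fun i _ => ?_)
      (fin _ _ _ (64 * (18 * (a + 1 + c) * K0 ^ 3) ^ 3) hsum ?_)
    · rw [hsub]
      exact dir_est a c K0 _ _ _ _ 0 0 h _ _ ha hcpos.le hK01 (bp1 i) bq1 z0 z0
        z0 z0 h0 hhK (hprof h habs i) (hprof (-h) hnabs i)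
    · rw [neg_neg, if_pos (hε.trans hcase)]

/-- Hardy inequality for the mixed potential that is the critical inverse-square potential
at the origin away from the boundary and the critical boundary-distance potential near
the boundary. -/
theorem hardy_mixed_potential
    (N : ℕ) (hN : 3 ≤ N)
    (Ω : Set (EuclideanSpace ℝ (Fin N))) (hΩo : IsOpen Ω) (hΩconn : IsConnected Ω)
    (hΩb : Bornology.IsBounded Ω) (hΩsm : IsC2Domain Ω)
    (h0 : (0 : EuclideanSpace ℝ (Fin N)) ∈ Ω) :
    ∃ ε₀ : ℝ, 0 < ε₀ ∧ ∀ ε : ℝ, 0 < ε → ε ≤ ε₀ →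
      ∀ u : EuclideanSpace ℝ (Fin N) → ℝ,
        ContDiff ℝ (⊤ : ℕ∞) u → HasCompactSupport u → tsupport u ⊆ Ω →
        (∫ x in Ω, (if ε ≤ bdist Ω x then ((N : ℝ) - 2) ^ 2 / (4 * ‖x‖ ^ 2)
            else 1 / (4 * bdist Ω x ^ 2)) * u x ^ 2) ≤
          ∫ x in Ω, ‖gradient u x‖ ^ 2 := by
  have hne : (frontier Ω).Nonempty := by
    have : Nonempty (Fin N) := ⟨⟨0, by omega⟩⟩
    rw [nonempty_frontier_iff]
    refine ⟨⟨0, h0⟩, fun h => ?_⟩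
    rw [h] at hΩb
    exact NormedSpace.unbounded_univ ℝ (EuclideanSpace ℝ (Fin N)) hΩb
  obtain ⟨r, hr, hext⟩ := ext_ball Ω hΩo hΩb hΩsm hne
  have htouch := touching Ω hΩo hΩb hne r hr hext
  set a : ℝ := ((N : ℝ) - 2) / 2 with ha_def
  have hN3 : (3 : ℝ) ≤ N := by exact_mod_cast hN
  have ha : 0 ≤ a := by rw [ha_def]; linarith
  have hNa : (N : ℝ) = 2 * a + 2 := by rw [ha_def]; ring
  have hd0 : 0 < bdist Ω 0 := (htouch 0 h0).1
  set r0 := bdist Ω 0 / 2 with hr0_def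
  have hr0 : 0 < r0 := by positivity
  set c : ℝ := N / r + 2 * a / r0 with hc
  have hcpos : 0 < c := by
    have : 0 < (N:ℝ) / r := by positivity
    have : 0 ≤ 2 * a / r0 := by positivity
    linarith
  have hbc : Continuous (bdist Ω) := Metric.continuous_infDist_pt _
  refine ⟨min r0 (1 / (4 * c)), by positivity, ?_⟩
  set t1 := min r0 (1 / (4 * c)) with ht1_def
  have ht1 : 0 < t1 := by positivity
  have ht1c : 4 * c * t1 ≤ 1 := by
    have : t1 ≤ 1 / (4 * c) := min_le_right _ _
    rw [le_div_iff₀ (by positivity)] at this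
    linarith
  intro ε hε hεt u hu hs hsupp
  have hu1 : ContDiff ℝ 1 u := hu.of_le (by exact_mod_cast le_top)
  have huc := hu1.continuous
  have hz : ∀ x, x ∉ Ω → u x = 0 := fun x hx =>
    image_eq_zero_of_notMem_tsupport fun h => hx (hsupp h)
  have hgz : ∀ x, x ∉ Ω → gradient u x = 0 := by
    intro x hx
    have h1 : x ∉ tsupport u := fun h => hx (hsupp h)
    have : fderiv ℝ u x = 0 := by
      by_contra hne
      exact h1 (support_fderiv_subset ℝ hne)
    rw [gradient, this, map_zero]
  rw [setIntegral_eq_integral_of_forall_compl_eq_zero (fun x hx => by simp [hz x hx]),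
    setIntegral_eq_integral_of_forall_compl_eq_zero (fun x hx => by simp [hgz x hx])]
  set V : EuclideanSpace ℝ (Fin N) → ℝ := fun x =>
    (if ε ≤ bdist Ω x then ((N : ℝ) - 2) ^ 2 / (4 * ‖x‖ ^ 2)
            else 1 / (4 * bdist Ω x ^ 2)) * u x ^ 2 with hV
  by_cases hVint : Integrable V
  swap
  · rw [integral_undef hVint]
    exact integral_nonneg fun x => by positivity
  set Vd : ℝ → EuclideanSpace ℝ (Fin N) → ℝ := fun δ x =>
    (if ε ≤ bdist Ω x then a ^ 2 / (‖x‖ ^ 2 + δ) else 1 / (4 * bdist Ω x ^ 2)) with hVd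
  have : Nonempty (Fin N) := ⟨⟨0, by omega⟩⟩
  have hae : ∀ᵐ x : EuclideanSpace ℝ (Fin N), x ≠ 0 := by
    rw [ae_iff]; simp
  have hbound : ∀ δ, 0 < δ → ∀ᵐ x : EuclideanSpace ℝ (Fin N), ‖Vd δ x * u x ^ 2‖ ≤ V x := by
    intro δ hδ
    filter_upwards [hae] with x hx
    have hxpos : 0 < ‖x‖ := norm_pos_iff.mpr hx
    rw [norm_mul, norm_pow, norm_eq_abs, norm_eq_abs, sq_abs, hV, hVd]
    simp only
    gcongr
    split_ifs
    · rw [abs_of_nonneg (by positivity)]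
      calc a ^ 2 / (‖x‖ ^ 2 + δ) ≤ a ^ 2 / ‖x‖ ^ 2 := by gcongr; linarith
        _ = _ := by rw [ha_def]; field_simp; ring
    · rw [abs_of_nonneg (by positivity)]
  have hmeas : ∀ δ, 0 < δ → AEStronglyMeasurable (fun x => Vd δ x * u x ^ 2) volume := by
    intro δ hδ
    apply Measurable.aestronglyMeasurable
    have hbm := hbc.measurable
    refine Measurable.mul (Measurable.ite (measurableSet_le measurable_const hbm) ?_ ?_)
      (huc.measurable.pow_const 2)
    · fun_prop
    · fun_prop
  have hlow : ∃ m, 0 < m ∧ ∀ x ∈ tsupport u, m ≤ bdist Ω x := by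
    rcases (tsupport u).eq_empty_or_nonempty with he | hne'
    · exact ⟨1, one_pos, by simp [he]⟩
    · obtain ⟨p, hp, hpm⟩ := IsCompact.exists_isMinOn (s := tsupport u) hs hne' hbc.continuousOn
      exact ⟨bdist Ω p, (htouch p (hsupp hp)).1, fun x hx => hpm hx⟩
  obtain ⟨m, hm, hmle⟩ := hlow
  have main : ∀ δ, 0 < δ → ∫ x, Vd δ x * u x ^ 2 ≤ ∫ x, ‖gradient u x‖ ^ 2 := by
    intro δ hδ
    have hint : Integrable (fun x => Vd δ x * u x ^ 2) :=
      hVint.mono' (hmeas δ hδ) (hbound δ hδ)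
    set B := 1 / (3 * (18 * (a + 1 + c) *
      (1 + 1 / δ + 1 / m + 1 / (2 * r * m) + 1 / (2 * r)) ^ 3)) with hB
    have hBpos : 0 < B := by positivity
    refine limit_hardy u (Wfun Ω a δ c (m / 2) t1) (Vd δ) hu1 hs
      (Wfun_cont Ω a δ c (m / 2) t1 hδ (by positivity) ht1) hint
      (N * (64 * (18 * (a + 1 + c) *
        (1 + 1 / δ + 1 / m + 1 / (2 * r * m) + 1 / (2 * r)) ^ 3) ^ 3))
      (min (min (m / 2) (1 / (8 * c))) (min (2 * r) B)) (by positivity) ?_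
    intro x hx h hh hhlt
    rw [lt_min_iff, lt_min_iff, lt_min_iff] at hhlt
    obtain ⟨⟨hl1, hl2⟩, hl3, hl4⟩ := hhlt
    obtain ⟨_, hball, n, hn, htn⟩ := htouch x (hsupp hx)
    rw [lt_div_iff₀ (by positivity)] at hl2
    refine point_est Ω a c r r0 δ m t1 ε h ha hNa hr hr0 hδ hm ht1 hc ht1c hεt hh hl1
      (by linarith) hl3.le hl4.le x (hmle x hx) ?_ hball n hn htn
    intro hxt
    have h1 : bdist Ω 0 ≤ bdist Ω x + dist 0 x := Metric.infDist_le_infDist_add_dist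
    rw [dist_zero_left] at h1
    have h2 : t1 ≤ r0 := min_le_left _ _
    linarith
  have hlim : Filter.Tendsto (fun δ : ℝ => ∫ x, Vd δ x * u x ^ 2)
      (nhdsWithin 0 (Set.Ioi 0)) (nhds (∫ x, V x)) := by
    apply tendsto_integral_filter_of_dominated_convergence V
    · filter_upwards [self_mem_nhdsWithin] with δ hδ
      exact hmeas δ hδ
    · filter_upwards [self_mem_nhdsWithin] with δ hδ
      exact hbound δ hδ
    · exact hVint
    · filter_upwards [hae] with x hx
      have hxpos : 0 < ‖x‖ := norm_pos_iff.mpr hx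
      rw [hV, hVd]
      simp only
      refine Filter.Tendsto.mul_const _ ?_
      split_ifs
      · have e : ((N : ℝ) - 2) ^ 2 / (4 * ‖x‖ ^ 2) = a ^ 2 / (‖x‖ ^ 2 + 0) := by
          rw [ha_def, add_zero]; field_simp; ring
        rw [e]
        refine Filter.Tendsto.mono_left ?_ nhdsWithin_le_nhds
        refine Filter.Tendsto.div tendsto_const_nhds
          (tendsto_const_nhds.add Filter.tendsto_id) ?_
        simp [hx]
      · exact tendsto_const_nhds
  refine le_of_tendsto hlim ?_
  filter_upwards [self_mem_nhdsWithin] with δ hδ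
  exact main δ hδ
end
end
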